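/- arXiv:2507.23467 — 4 statements merged into one kernel-verified Lean document; each statement's English description precedes it below -/
import Mathlib

section
/- For 0 < β < 1 and every complex z with Re(z) > 0, the Mellin transform of the M-Wright function satisfies ∫₀^∞ x^(z-1) M_β(x) dx = Γ(z) / Γ(β(z-1) + 1). -/
open MeasureTheory Set

/-- The `M`-Wright function. -/
noncomputable def MWright (β t : ℝ) : ℝ :=
  ∑' n : ℕ, (-t) ^ n / (n.factorial * Real.Gamma (-β * n + 1 - β))

namespace MW

lemma integrable_rexp {p c : ℝ} (hp : 0 < p) (hc : 0 < c) :
    IntegrableOn (fun t : ℝ => t ^ (p - 1) * Real.exp (-(c * t))) (Ioi 0) := by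
  have h := integrableOn_rpow_mul_exp_neg_mul_rpow (p := 1) (s := p - 1) (b := c)
    (by linarith) one_pos hc
  refine h.congr_fun (fun t _ => ?_) measurableSet_Ioi
  simp

lemma meas_aux (p : ℝ) (r : ℂ) (μ : Measure ℝ) :
    AEStronglyMeasurable (fun t : ℝ => ((t ^ (p - 1) : ℝ) : ℂ) * Complex.exp (-(r * t))) μ := by
  apply Measurable.aestronglyMeasurable
  fun_prop

lemma norm_aux (p : ℝ) (r : ℂ) {t : ℝ} (ht : 0 < t) :
    ‖((t ^ (p - 1) : ℝ) : ℂ) * Complex.exp (-(r * t))‖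
      = t ^ (p - 1) * Real.exp (-(r.re * t)) := by
  rw [norm_mul, Complex.norm_real, Complex.norm_exp, Real.norm_of_nonneg (by positivity)]
  simp

lemma integrable_cexp {p : ℝ} {r : ℂ} (hp : 0 < p) (hr : 0 < r.re) :
    IntegrableOn (fun t : ℝ => ((t ^ (p - 1) : ℝ) : ℂ) * Complex.exp (-(r * t))) (Ioi 0) := by
  refine Integrable.mono' (integrable_rexp hp hr) (meas_aux _ _ _) ?_
  refine (ae_restrict_mem measurableSet_Ioi).mono fun t ht => ?_
  exact (norm_aux p r ht).le

lemma differentiableAt_laplace {p : ℝ} (hp : 0 < p) {r : ℂ} (hr : 0 < r.re) :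
    DifferentiableAt ℂ (fun r : ℂ => ∫ t in Ioi (0:ℝ),
      ((t ^ (p - 1) : ℝ) : ℂ) * Complex.exp (-(r * t))) r := by
  have hs : {x : ℂ | r.re / 2 < x.re} ∈ nhds r :=
    (isOpen_lt continuous_const Complex.continuous_re).mem_nhds (by simp; linarith)
  have := hasDerivAt_integral_of_dominated_loc_of_deriv_le (μ := volume.restrict (Ioi (0:ℝ)))
    (F := fun (r : ℂ) (t : ℝ) => ((t ^ (p - 1) : ℝ) : ℂ) * Complex.exp (-(r * t)))
    (F' := fun (r : ℂ) (t : ℝ) => ((t ^ (p - 1) : ℝ) : ℂ) * (Complex.exp (-(r * t)) * (-(t:ℂ))))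
    (bound := fun t => t ^ ((p + 1) - 1) * Real.exp (-((r.re / 2) * t)))
    (x₀ := r) (s := {x : ℂ | r.re / 2 < x.re}) hs
    (Filter.Eventually.of_forall fun x => meas_aux _ _ _) (integrable_cexp hp hr)
    (by apply Measurable.aestronglyMeasurable; fun_prop)
    ?_ (integrable_rexp (by linarith) (by linarith)) ?_
  · exact this.2.differentiableAt
  · refine (ae_restrict_mem measurableSet_Ioi).mono fun t ht x hx => ?_
    have ht : 0 < t := ht
    rw [← mul_assoc, norm_mul, norm_aux p x ht, norm_neg, Complex.norm_real,
      Real.norm_of_nonneg ht.le]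
    have e : t ^ (p + 1 - 1) = t ^ (p - 1) * t := by
      rw [← Real.rpow_add_one ht.ne']; ring_nf
    rw [e, mul_assoc, mul_comm (Real.exp _), ← mul_assoc]
    have hx : r.re / 2 < x.re := hx
    gcongr
  · refine (ae_restrict_mem measurableSet_Ioi).mono fun t ht x hx => ?_
    have h1 : HasDerivAt (fun x : ℂ => -(x * (t:ℂ))) (-(t:ℂ)) x := by
      have h := ((hasDerivAt_id x).mul_const (t:ℂ)).neg
      rw [one_mul] at h
      exact h
    exact (h1.cexp).const_mul _

lemma laplace_gamma {p : ℝ} (hp : 0 < p) {r : ℂ} (hr : 0 < r.re) :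
    ∫ t in Ioi (0:ℝ), ((t ^ (p - 1) : ℝ) : ℂ) * Complex.exp (-(r * t))
      = Real.Gamma p * Complex.exp (-(p * Complex.log r)) := by
  have hU : IsOpen {x : ℂ | 0 < x.re} := isOpen_lt continuous_const Complex.continuous_re
  have hc : IsPreconnected {x : ℂ | 0 < x.re} := (convex_halfSpace_re_gt 0).isPreconnected
  have hf : AnalyticOnNhd ℂ (fun r : ℂ => ∫ t in Ioi (0:ℝ),
      ((t ^ (p - 1) : ℝ) : ℂ) * Complex.exp (-(r * t))) {x : ℂ | 0 < x.re} :=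
    DifferentiableOn.analyticOnNhd
      (fun x hx => (differentiableAt_laplace hp hx).differentiableWithinAt) hU
  have hg : AnalyticOnNhd ℂ (fun r : ℂ => Real.Gamma p * Complex.exp (-(p * Complex.log r)))
      {x : ℂ | 0 < x.re} := by
    refine DifferentiableOn.analyticOnNhd (fun x hx => ?_) hU
    have : x ∈ Complex.slitPlane := Or.inl hx
    have := (Complex.hasDerivAt_log this).differentiableAt
    apply DifferentiableAt.differentiableWithinAt
    fun_prop
  have key : ∀ x : ℝ, 0 < x → ∫ t in Ioi (0:ℝ), ((t ^ (p - 1) : ℝ) : ℂ) * Complex.exp (-((x:ℂ) * t))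
      = Real.Gamma p * Complex.exp (-(p * Complex.log x)) := by
    intro x hx
    have h := Real.integral_rpow_mul_exp_neg_mul_Ioi hp hx
    have h2 := congrArg (fun y : ℝ => (y : ℂ)) h
    rw [← integral_complex_ofReal] at h2
    calc _ = _ := by
            refine integral_congr_ae (Filter.Eventually.of_forall fun t => ?_)
            show _ = ((t ^ (p - 1) * Real.exp (-(x * t)) : ℝ) : ℂ)
            push_cast
            rfl
         _ = _ := h2
         _ = _ := by
            rw [Real.rpow_def_of_pos (by positivity), one_div, Real.log_inv, ← Complex.ofReal_log hx.le]
            push_cast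
            rw [mul_comm]; congr 2; ring
  refine hf.eqOn_of_preconnected_of_frequently_eq hg hc (z₀ := 1) (by simp) ?_ hr
  have ht : Filter.Tendsto (fun x : ℝ => (x : ℂ)) (nhdsWithin 1 {1}ᶜ) (nhdsWithin 1 {1}ᶜ) := by
    refine tendsto_nhdsWithin_iff.2 ⟨?_, ?_⟩
    · have : Filter.Tendsto (fun x : ℝ => (x : ℂ)) (nhds 1) (nhds ((1:ℝ):ℂ)) :=
        Complex.continuous_ofReal.tendsto 1
      simpa using this.mono_left nhdsWithin_le_nhds
    · filter_upwards [self_mem_nhdsWithin] with x hx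
      simpa using hx
  refine ht.frequently (Filter.Eventually.frequently ?_)
  have : ∀ᶠ x : ℝ in nhdsWithin 1 {1}ᶜ, 0 < x :=
    nhdsWithin_le_nhds (lt_mem_nhds one_pos)
  filter_upwards [this] with x hx using key x hx

/-- rotated gamma integral -/
lemma gamma_rot {p y φ : ℝ} (hp : 0 < p) (hy : 0 < y) (h1 : -(Real.pi / 2) < φ)
    (h2 : φ < Real.pi / 2) :
    ∫ t in Ioi (0:ℝ), ((t ^ (p - 1) : ℝ) : ℂ) * Complex.exp (-(y * Complex.exp (φ * Complex.I) * t))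
      = Real.Gamma p * ((y ^ (-p) : ℝ) : ℂ) * Complex.exp (-(p * φ * Complex.I)) := by
  have hpi := Real.pi_pos
  have hre : 0 < ((y : ℂ) * Complex.exp (φ * Complex.I)).re := by
    rw [Complex.re_ofReal_mul, Complex.exp_ofReal_mul_I_re]
    exact mul_pos hy (Real.cos_pos_of_mem_Ioo ⟨h1, h2⟩)
  rw [laplace_gamma hp hre, Complex.log_ofReal_mul hy (Complex.exp_ne_zero _), Complex.log_exp,
    Real.rpow_def_of_pos hy]
  · push_cast
    rw [mul_assoc, ← Complex.exp_add]
    congr 2; ring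
  · simp; linarith
  · simp; linarith

lemma gamma_refl {a : ℝ} (ha : 0 < a) :
    Real.Gamma a * Real.sin (Real.pi * a) / Real.pi = (Real.Gamma (1 - a))⁻¹ := by
  have h := Real.Gamma_mul_Gamma_one_sub a
  have hg : Real.Gamma a ≠ 0 := (Real.Gamma_pos_of_pos ha).ne'
  have hpi := Real.pi_ne_zero
  by_cases hs : Real.sin (Real.pi * a) = 0
  · rw [hs] at h ⊢
    simp [hg] at h
    simp [h]
  · have h3 : Real.Gamma (1 - a) ≠ 0 := by
      intro h0
      rw [h0, mul_zero] at h
      exact (div_ne_zero hpi hs) h.symm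
    rw [eq_div_iff hs] at h
    apply eq_inv_of_mul_eq_one_left
    rw [div_mul_eq_mul_div, div_eq_one_iff_eq hpi]
    linarith


lemma ray_int {a θ : ℝ} (ha : 0 < a) (h1 : Real.pi / 2 < θ) (h2 : θ < Real.pi) :
    Complex.exp (a * θ * Complex.I) *
      ∫ s in Ioi (0:ℝ), ((s ^ (a - 1) : ℝ) : ℂ) * Complex.exp (Complex.exp (θ * Complex.I) * s)
      = Real.Gamma a * Complex.exp ((Real.pi * a : ℝ) * Complex.I) := by
  have h := gamma_rot (p := a) (y := 1) (φ := θ - Real.pi) ha one_pos (by linarith)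
    (by linarith [Real.pi_pos])
  have e1 : Complex.exp (((θ - Real.pi : ℝ) : ℂ) * Complex.I) = - Complex.exp (θ * Complex.I) := by
    push_cast
    rw [sub_mul, Complex.exp_sub, Complex.exp_pi_mul_I, div_neg, div_one]
  rw [e1] at h
  simp only [Complex.ofReal_one, one_mul, neg_mul, neg_neg, Real.one_rpow, mul_one] at h
  rw [h, mul_left_comm, ← Complex.exp_add]
  congr 2
  push_cast
  ring

lemma rpow_le_lin {β δ : ℝ} (hβ0 : 0 < β) (hβ1 : β < 1) (hδ : 0 < δ) :
    ∃ A : ℝ, ∀ s : ℝ, 0 < s → s ^ β ≤ δ * s + A := by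
  set L := δ ^ (1 / (β - 1)) with hL
  have hL0 : 0 < L := by positivity
  have hLd : L ^ (β - 1) = δ := by
    rw [hL, ← Real.rpow_mul hδ.le, one_div, inv_mul_cancel₀ (by linarith), Real.rpow_one]
  refine ⟨L ^ β, fun s hs => ?_⟩
  have hLb : 0 < L ^ β := by positivity
  rcases le_total s L with h | h
  · have := Real.rpow_le_rpow hs.le h hβ0.le
    nlinarith
  · have h3 : s ^ (β - 1) ≤ L ^ (β - 1) :=
      Real.rpow_le_rpow_of_nonpos hL0 h (by linarith)
    have h4 : s ^ β = s ^ (β - 1) * s := by rw [← Real.rpow_add_one hs.ne']; ring_nf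
    rw [h4, ← hLd]
    nlinarith

lemma integrable_growth {β c y : ℝ} (hβ0 : 0 < β) (hβ1 : β < 1) (hc : 0 < c) (hy : 0 ≤ y) :
    IntegrableOn (fun s : ℝ => s ^ (β - 1) * Real.exp (-(c * s)) * Real.exp (y * s ^ β)) (Ioi 0) := by
  obtain ⟨A, hA⟩ := rpow_le_lin hβ0 hβ1 (δ := c / 2 / (y + 1)) (by positivity)
  refine Integrable.mono' ((integrable_rexp hβ0 (c := c / 2) (by positivity)).const_mul
    (Real.exp (y * A))) ?_ ?_
  · apply Measurable.aestronglyMeasurable; fun_prop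
  · refine (ae_restrict_mem measurableSet_Ioi).mono fun s hs => ?_
    have hs : 0 < s := hs
    rw [Real.norm_of_nonneg (by positivity), mul_left_comm, mul_assoc, ← Real.exp_add,
      ← Real.exp_add]
    refine mul_le_mul_of_nonneg_left (Real.exp_le_exp.2 ?_) (by positivity)
    have h1 := mul_le_mul_of_nonneg_left (hA s hs) hy
    have h2 : y * (c / 2 / (y + 1) * s) ≤ c / 2 * s := by
      have : y / (y + 1) ≤ 1 := by rw [div_le_one (by positivity)]; linarith
      calc y * (c / 2 / (y + 1) * s) = y / (y + 1) * (c / 2 * s) := by ring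
        _ ≤ 1 * (c / 2 * s) := by gcongr
        _ = _ := by ring
    nlinarith

/-- integrand -/
noncomputable def K (β θ x s : ℝ) : ℂ :=
  ((s ^ (β - 1) : ℝ) : ℂ) * Complex.exp (Complex.exp (θ * Complex.I) * s) *
    Complex.exp (-(x * Complex.exp ((θ * β : ℝ) * Complex.I) * ((s ^ β : ℝ) : ℂ)))

lemma norm_ray (β θ : ℝ) {s : ℝ} (hs : 0 < s) :
    ‖((s ^ (β - 1) : ℝ) : ℂ) * Complex.exp (Complex.exp (θ * Complex.I) * s)‖
      = s ^ (β - 1) * Real.exp (-(-Real.cos θ * s)) := by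
  rw [norm_mul, Complex.norm_real, Complex.norm_exp, Real.norm_of_nonneg (by positivity),
    Complex.re_mul_ofReal, Complex.exp_ofReal_mul_I_re]
  simp

lemma norm_exp_w (β θ x : ℝ) (s : ℝ) :
    ‖Complex.exp (-(x * Complex.exp ((θ * β : ℝ) * Complex.I) * ((s ^ β : ℝ) : ℂ)))‖
      = Real.exp (-(x * Real.cos (θ * β)) * s ^ β) := by
  rw [Complex.norm_exp, Complex.neg_re, Complex.re_mul_ofReal, Complex.re_ofReal_mul,
    Complex.exp_ofReal_mul_I_re, neg_mul]

lemma MWright_hasSum {β θ : ℝ} (hβ0 : 0 < β) (hβ1 : β < 1) (h1 : Real.pi / 2 < θ)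
    (h2 : θ < Real.pi) (x : ℝ) :
    HasSum (fun n : ℕ => ((-x : ℝ) : ℂ) ^ n / n.factorial *
        (Real.Gamma (β * (n + 1)) * Complex.exp ((Real.pi * (β * (n + 1)) : ℝ) * Complex.I)))
      (Complex.exp ((θ * β : ℝ) * Complex.I) * ∫ s in Ioi (0:ℝ), K β θ x s) := by
  have hc : 0 < - Real.cos θ := by
    have := Real.cos_neg_of_pi_div_two_lt_of_lt h1 (by linarith)
    linarith
  set w := Complex.exp ((θ * β : ℝ) * Complex.I) with hw
  have hwn : ‖w‖ = 1 := Complex.norm_exp_ofReal_mul_I _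
  have key := hasSum_integral_of_dominated_convergence (μ := volume.restrict (Ioi (0:ℝ)))
    (F := fun (n : ℕ) (s : ℝ) => ((s ^ (β - 1) : ℝ) : ℂ) *
      Complex.exp (Complex.exp (θ * Complex.I) * s) *
      ((-(x * w * ((s ^ β : ℝ) : ℂ))) ^ n / n.factorial))
    (f := fun s => K β θ x s)
    (fun n s => s ^ (β - 1) * Real.exp (-(-Real.cos θ * s)) * ((|x| * s ^ β) ^ n / n.factorial))
    ?_ ?_ ?_ ?_ ?_
  · have key2 := key.mul_left w
    refine key2.congr_fun ?_
    intro n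
    have ha : 0 < β * ((n:ℝ) + 1) := by positivity
    rw [← ray_int ha h1 h2]
    have : ∫ s in Ioi (0:ℝ), ((s ^ (β - 1) : ℝ) : ℂ) *
      Complex.exp (Complex.exp (θ * Complex.I) * s) *
      ((-(x * w * ((s ^ β : ℝ) : ℂ))) ^ n / n.factorial) = ((-x : ℝ) : ℂ) ^ n / n.factorial * w ^ n *
       ∫ s in Ioi (0:ℝ), ((s ^ (β * ((n:ℝ) + 1) - 1) : ℝ) : ℂ) * Complex.exp (Complex.exp (θ * Complex.I) * s) := by
      rw [← integral_const_mul]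
      refine setIntegral_congr_fun measurableSet_Ioi fun s hs => ?_
      have hs : 0 < s := hs
      have : s ^ (β * ((n:ℝ) + 1) - 1) = s ^ (β - 1) * (s ^ β) ^ n := by
        rw [← Real.rpow_mul_natCast hs.le, ← Real.rpow_add hs]; ring_nf
      simp only [this]
      push_cast
      ring
    rw [this]
    have : Complex.exp (((β * ((n:ℝ) + 1) : ℝ) : ℂ) * θ * Complex.I) = w ^ n * w := by
      rw [hw, ← pow_succ, ← Complex.exp_nat_mul]
      push_cast
      ring_nf
    rw [this]
    ring
  · intro n; apply Measurable.aestronglyMeasurable; fun_prop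
  · intro n
    refine (ae_restrict_mem measurableSet_Ioi).mono fun s hs => ?_
    have hs : 0 < s := hs
    rw [norm_mul, norm_ray β θ hs]
    simp only [norm_div, norm_pow, norm_neg, norm_mul, hwn, Complex.norm_real, mul_one,
      Real.norm_eq_abs, abs_of_pos (Real.rpow_pos_of_pos hs β), Complex.norm_natCast]
    exact le_rfl
  · refine Filter.Eventually.of_forall fun s => ?_
    exact (Real.summable_pow_div_factorial _).mul_left _
  · refine (integrable_growth hβ0 hβ1 hc (abs_nonneg x)).congr (Filter.Eventually.of_forall fun s => ?_)
    simp only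
    rw [tsum_mul_left, Real.exp_eq_exp_ℝ, NormedSpace.exp_eq_tsum_div]
  · refine Filter.Eventually.of_forall fun s => ?_
    refine HasSum.mul_left _ ?_
    rw [hw]
    generalize -(x * Complex.exp ((θ * β : ℝ) * Complex.I) * ((s ^ β : ℝ) : ℂ)) = q
    rw [Complex.exp_eq_exp_ℂ]
    exact NormedSpace.expSeries_div_hasSum_exp q

lemma MWright_eq {β θ : ℝ} (hβ0 : 0 < β) (hβ1 : β < 1) (h1 : Real.pi / 2 < θ)
    (h2 : θ < Real.pi) (x : ℝ) :
    MWright β x = (Complex.exp ((θ * β : ℝ) * Complex.I) * ∫ s in Ioi (0:ℝ), K β θ x s).im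
      / Real.pi := by
  have h := ((Complex.hasSum_im (MWright_hasSum hβ0 hβ1 h1 h2 x)).div_const Real.pi)
  rw [← h.tsum_eq, MWright]
  refine tsum_congr fun n => ?_
  have ha : 0 < β * ((n:ℝ) + 1) := by positivity
  have e : -β * (n:ℝ) + 1 - β = 1 - β * ((n:ℝ) + 1) := by ring
  rw [e, div_mul_eq_div_div, div_eq_mul_inv _ (Real.Gamma _), ← gamma_refl ha]
  have : (((-x : ℝ) : ℂ) ^ n / n.factorial *
        (Real.Gamma (β * (n + 1)) * Complex.exp ((Real.pi * (β * (n + 1)) : ℝ) * Complex.I)))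
     = (((-x) ^ n / n.factorial * Real.Gamma (β * (n + 1)) : ℝ) : ℂ)
        * Complex.exp ((Real.pi * (β * (n + 1)) : ℝ) * Complex.I) := by
    push_cast; ring
  rw [this, Complex.im_ofReal_mul, Complex.exp_ofReal_mul_I_im]
  ring

lemma zero_term {β θ x : ℝ} (hβ0 : 0 < β) (h1 : 0 < θ) (h2 : θ * β < Real.pi / 2) (hx : 0 < x)
    (k : ℕ) :
    (Complex.exp ((θ * β : ℝ) * Complex.I) * ∫ s in Ioi (0:ℝ),
      ((s ^ (β - 1) : ℝ) : ℂ) * ((Complex.exp (θ * Complex.I) * s) ^ k / k.factorial) *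
      Complex.exp (-(x * Complex.exp ((θ * β : ℝ) * Complex.I) * ((s ^ β : ℝ) : ℂ)))).im = 0 := by
  have hp : 0 < (k:ℝ) / β + 1 := by positivity
  have hpi := Real.pi_pos
  have h0 : 0 < θ * β := by positivity
  have hg := gamma_rot hp hx (φ := θ * β) (by linarith) h2
  rw [← integral_comp_rpow_Ioi_of_pos hβ0] at hg
  have e : ∫ s in Ioi (0:ℝ),
      ((s ^ (β - 1) : ℝ) : ℂ) * ((Complex.exp (θ * Complex.I) * s) ^ k / k.factorial) *
      Complex.exp (-(x * Complex.exp ((θ * β : ℝ) * Complex.I) * ((s ^ β : ℝ) : ℂ)))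
      = Complex.exp (θ * Complex.I) ^ k / (k.factorial * β) * (Real.Gamma (k / β + 1) *
       ((x ^ (-((k:ℝ) / β + 1)) : ℝ) : ℂ) *
       Complex.exp (-(((k / β + 1 : ℝ) : ℂ) * ((θ * β : ℝ) : ℂ) * Complex.I))) := by
    rw [← hg, ← integral_const_mul]
    refine setIntegral_congr_fun measurableSet_Ioi fun s hs => ?_
    have hs : 0 < s := hs
    have : (s ^ β) ^ ((k:ℝ) / β + 1 - 1) = s ^ k := by
      rw [← Real.rpow_mul hs.le, add_sub_cancel_right, mul_div_cancel₀ _ hβ0.ne', Real.rpow_natCast]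
    simp only [this, Complex.real_smul]
    have hb : (β : ℂ) ≠ 0 := by exact_mod_cast hβ0.ne'
    push_cast
    field_simp
    rw [mul_pow]
    ring
  rw [e]
  have e2 : Complex.exp ((θ * β : ℝ) * Complex.I) * (Complex.exp (θ * Complex.I) ^ k *
       Complex.exp (-(((k / β + 1 : ℝ) : ℂ) * ((θ * β : ℝ) : ℂ) * Complex.I))) = 1 := by
    have hb : (β : ℂ) ≠ 0 := by exact_mod_cast hβ0.ne'
    rw [← Complex.exp_nat_mul, ← Complex.exp_add, ← Complex.exp_add, Complex.exp_eq_one_iff]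
    refine ⟨0, ?_⟩
    push_cast
    field_simp
    ring
  have e3 : Complex.exp ((θ * β : ℝ) * Complex.I) * (Complex.exp (θ * Complex.I) ^ k / (k.factorial * β) * (Real.Gamma (k / β + 1) *
       ((x ^ (-((k:ℝ) / β + 1)) : ℝ) : ℂ) *
       Complex.exp (-(((k / β + 1 : ℝ) : ℂ) * ((θ * β : ℝ) : ℂ) * Complex.I))))
     = ((Real.Gamma (k / β + 1) * x ^ (-((k:ℝ) / β + 1)) / (k.factorial * β) : ℝ) : ℂ) := by
    calc _ = Complex.exp ((θ * β : ℝ) * Complex.I) * (Complex.exp (θ * Complex.I) ^ k *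
       Complex.exp (-(((k / β + 1 : ℝ) : ℂ) * ((θ * β : ℝ) : ℂ) * Complex.I))) *
        (Real.Gamma (k / β + 1) * ((x ^ (-((k:ℝ) / β + 1)) : ℝ) : ℂ) / (k.factorial * β)) := by ring
      _ = _ := by rw [e2]; push_cast; ring
  rw [e3, Complex.ofReal_im]


lemma exp_rem {θ : ℝ} (hc : Real.cos θ < 0) (N : ℕ) : ∃ C : ℝ, ∀ s : ℝ, 0 < s →
    ‖Complex.exp (Complex.exp (θ * Complex.I) * s) -
      ∑ k ∈ Finset.range N, (Complex.exp (θ * Complex.I) * s) ^ k / k.factorial‖ ≤ C * s ^ N := by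
  refine ⟨max (Real.exp 1) (1 + N), fun s hs => ?_⟩
  have hn : ‖Complex.exp (θ * Complex.I) * (s:ℂ)‖ = s := by
    rw [norm_mul, Complex.norm_exp_ofReal_mul_I, Complex.norm_real, Real.norm_of_nonneg hs.le,
      one_mul]
  rcases le_total s 1 with h | h
  · refine (Complex.norm_exp_sub_sum_le_norm_mul_exp _ N).trans ?_
    rw [hn, mul_comm]
    gcongr
    exact (Real.exp_le_exp.2 h).trans (le_max_left _ _)
  · calc _ ≤ ‖Complex.exp (Complex.exp (θ * Complex.I) * s)‖ +
          ‖∑ k ∈ Finset.range N, (Complex.exp (θ * Complex.I) * s) ^ k / k.factorial‖ :=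
            norm_sub_le _ _
      _ ≤ s ^ N + ∑ k ∈ Finset.range N, s ^ N := by
        gcongr
        · rw [Complex.norm_exp, Complex.re_mul_ofReal, Complex.exp_ofReal_mul_I_re]
          have h1 : Real.exp (Real.cos θ * s) ≤ 1 := by
            rw [Real.exp_le_one_iff]
            nlinarith
          exact h1.trans (one_le_pow₀ h)
        · refine norm_sum_le_of_le _ fun k hk => ?_
          rw [norm_div, norm_pow, hn, Complex.norm_natCast]
          have h1 : s ^ k ≤ s ^ N := pow_le_pow_right₀ h (Finset.mem_range.1 hk).le
          have h2 : (1:ℝ) ≤ k.factorial := by exact_mod_cast k.factorial_pos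
          exact (div_le_self (by positivity) h2).trans h1
      _ = (1 + N) * s ^ N := by simp; ring
      _ ≤ _ := by gcongr; exact le_max_right _ _

lemma K_norm_le {β θ x s : ℝ} (hd : 0 < Real.cos (θ * β)) (hx : 0 ≤ x) (hs : 0 < s) :
    ‖K β θ x s‖ ≤ s ^ (β - 1) * Real.exp (-(-Real.cos θ * s)) := by
  rw [K, norm_mul, norm_ray _ _ hs, norm_exp_w]
  refine mul_le_of_le_one_right (by positivity) ?_
  rw [Real.exp_le_one_iff]
  have := mul_nonneg (mul_nonneg hx hd.le) (Real.rpow_nonneg hs.le β)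
  linarith

lemma K_meas (β θ x : ℝ) (μ : Measure ℝ) : AEStronglyMeasurable (K β θ x) μ := by
  apply Measurable.aestronglyMeasurable
  unfold K
  fun_prop

lemma K_int {β θ x : ℝ} (hβ0 : 0 < β) (hc : Real.cos θ < 0) (hd : 0 < Real.cos (θ * β))
    (hx : 0 ≤ x) : IntegrableOn (K β θ x) (Ioi 0) := by
  refine Integrable.mono' (integrable_rexp hβ0 (neg_pos.2 hc)) (K_meas _ _ _ _) ?_
  exact (ae_restrict_mem measurableSet_Ioi).mono fun t ht => K_norm_le hd hx ht

lemma MWright_cont {β θ : ℝ} (hβ0 : 0 < β) (hβ1 : β < 1) (h1 : Real.pi / 2 < θ)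
    (h2 : θ < Real.pi) (hc : Real.cos θ < 0) (hd : 0 < Real.cos (θ * β)) :
    ContinuousOn (MWright β) (Ici 0) := by
  have : ContinuousOn (fun x => ∫ s in Ioi (0:ℝ), K β θ x s) (Ici 0) := by
    refine continuousOn_of_dominated (fun x _ => K_meas _ _ _ _) (fun x hx => ?_)
      (integrable_rexp hβ0 (neg_pos.2 hc)) ?_
    · exact (ae_restrict_mem measurableSet_Ioi).mono fun t ht => K_norm_le hd hx ht
    · refine Filter.Eventually.of_forall fun s => ?_
      unfold K
      fun_prop
  have h3 : MWright β = fun x => (Complex.exp ((θ * β : ℝ) * Complex.I) * ∫ s in Ioi (0:ℝ), K β θ x s).im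
      / Real.pi := funext fun x => MWright_eq hβ0 hβ1 h1 h2 x
  rw [h3]
  exact (Complex.continuous_im.comp_continuousOn (continuousOn_const.mul this)).div_const _

lemma MWright_decay {β θ : ℝ} (hβ0 : 0 < β) (hβ1 : β < 1) (h1 : Real.pi / 2 < θ)
    (h2 : θ < Real.pi) (h3 : θ * β < Real.pi / 2) (hc : Real.cos θ < 0)
    (hd : 0 < Real.cos (θ * β)) (N : ℕ) :
    ∃ C : ℝ, ∀ x : ℝ, 0 < x → |MWright β x| ≤ C * x ^ (-((N + β) / β)) := by
  have hpi := Real.pi_pos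
  obtain ⟨C, hC⟩ := exp_rem hc N
  refine ⟨C * (Real.cos (θ * β) ^ (-((N + β) / β)) * (1 / β) * Real.Gamma ((N + β) / β)) / Real.pi,
    fun x hx => ?_⟩
  set w := Complex.exp ((θ * β : ℝ) * Complex.I) with hw
  set T : ℕ → ℝ → ℂ := fun k s =>
      ((s ^ (β - 1) : ℝ) : ℂ) * ((Complex.exp (θ * Complex.I) * s) ^ k / k.factorial) *
      Complex.exp (-(x * Complex.exp ((θ * β : ℝ) * Complex.I) * ((s ^ β : ℝ) : ℂ))) with hT
  have hxd : 0 < x * Real.cos (θ * β) := by positivity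
  have hTint : ∀ k, IntegrableOn (T k) (Ioi 0) := by
    intro k
    have hk : -1 < β - 1 + k := by
      have : (0:ℝ) ≤ k := k.cast_nonneg
      linarith
    refine Integrable.mono' (integrableOn_rpow_mul_exp_neg_mul_rpow hk hβ0 hxd) ?_ ?_
    · apply Measurable.aestronglyMeasurable
      simp only [hT]
      fun_prop
    · refine (ae_restrict_mem measurableSet_Ioi).mono fun s hs => ?_
      have hs : 0 < s := hs
      simp only [hT]
      rw [norm_mul, norm_exp_w, norm_mul, norm_div, norm_pow, norm_mul,
        Complex.norm_exp_ofReal_mul_I, Complex.norm_real, Complex.norm_real, one_mul,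
        Real.norm_of_nonneg hs.le, Real.norm_of_nonneg (by positivity), Complex.norm_natCast,
        Real.rpow_add hs, Real.rpow_natCast]
      have h2 : (1:ℝ) ≤ k.factorial := by exact_mod_cast k.factorial_pos
      gcongr
      exact div_le_self (by positivity) h2
  have hz : ∀ k, (w * ∫ s in Ioi (0:ℝ), T k s).im = 0 := fun k =>
    zero_term hβ0 (by linarith) h3 hx k
  have hsub : w * (∫ s in Ioi (0:ℝ), (K β θ x s - ∑ k ∈ Finset.range N, T k s))
      = w * (∫ s in Ioi (0:ℝ), K β θ x s) - ∑ k ∈ Finset.range N, w * ∫ s in Ioi (0:ℝ), T k s := by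
    rw [integral_sub (K_int hβ0 hc hd hx.le) (integrable_finsetSum _ fun k _ => hTint k),
      integral_finsetSum _ fun k _ => hTint k, mul_sub, Finset.mul_sum]
  have him : (w * (∫ s in Ioi (0:ℝ), K β θ x s)).im
      = (w * (∫ s in Ioi (0:ℝ), (K β θ x s - ∑ k ∈ Finset.range N, T k s))).im := by
    rw [hsub, Complex.sub_im, Complex.im_sum, Finset.sum_eq_zero (fun k _ => hz k), sub_zero]
  rw [MWright_eq hβ0 hβ1 h1 h2 x, ← hw, him, abs_div, abs_of_pos hpi, div_mul_eq_mul_div]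
  gcongr
  refine (Complex.abs_im_le_norm _).trans ?_
  rw [norm_mul, hw, Complex.norm_exp_ofReal_mul_I, one_mul]
  have hN : -1 < β - 1 + N := by
    have : (0:ℝ) ≤ N := N.cast_nonneg
    linarith
  have hb := norm_integral_le_of_norm_le (μ := volume.restrict (Ioi (0:ℝ)))
    (f := fun s => K β θ x s - ∑ k ∈ Finset.range N, T k s)
    ((integrableOn_rpow_mul_exp_neg_mul_rpow hN hβ0 hxd).const_mul C) (by
      refine (ae_restrict_mem measurableSet_Ioi).mono fun s hs => ?_
      have hs : 0 < s := hs
      have e : K β θ x s - ∑ k ∈ Finset.range N, T k s = ((s ^ (β - 1) : ℝ) : ℂ) *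
        (Complex.exp (Complex.exp (θ * Complex.I) * s) -
          ∑ k ∈ Finset.range N, (Complex.exp (θ * Complex.I) * s) ^ k / k.factorial) *
        Complex.exp (-(x * Complex.exp ((θ * β : ℝ) * Complex.I) * ((s ^ β : ℝ) : ℂ))) := by
        simp only [hT, K]
        rw [mul_sub, sub_mul, Finset.mul_sum, Finset.sum_mul]
      rw [e, norm_mul, norm_exp_w, norm_mul, Complex.norm_real, Real.norm_of_nonneg (by positivity),
        Real.rpow_add hs, Real.rpow_natCast]
      calc _ ≤ s ^ (β - 1) * (C * s ^ N) * Real.exp (-(x * Real.cos (θ * β)) * s ^ β) := by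
            gcongr
            exact hC s hs
        _ = _ := by ring)
  refine hb.trans (le_of_eq ?_)
  rw [integral_const_mul, integral_rpow_mul_exp_neg_mul_rpow hβ0 hN hxd]
  have e1 : β - 1 + (N:ℝ) + 1 = N + β := by ring
  rw [e1, neg_div, Real.mul_rpow hx.le hd.le]
  ring

lemma mellin_real {β θ r : ℝ} (hβ0 : 0 < β) (hβ1 : β < 1) (h1 : Real.pi / 2 < θ)
    (h2 : θ < Real.pi) (h3 : θ * β < Real.pi / 2) (hc : Real.cos θ < 0)
    (hd : 0 < Real.cos (θ * β)) (hr0 : 0 < r) (hr1 : r < 1) :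
    ∫ x in Ioi (0:ℝ), x ^ (r - 1) * MWright β x = Real.Gamma r / Real.Gamma (β * (r - 1) + 1) := by
  have hpi := Real.pi_pos
  set w := Complex.exp ((θ * β : ℝ) * Complex.I) with hw
  have ha : 0 < β * (1 - r) := mul_pos hβ0 (by linarith)
  have hr' : 0 < r := hr0
  set G : ℝ → ℝ → ℂ := fun x s => ((x ^ (r - 1) : ℝ) : ℂ) * K β θ x s with hG
  have hGn : ∀ x ∈ Ioi (0:ℝ), ∀ s ∈ Ioi (0:ℝ), ‖G x s‖ = s ^ (β - 1) * Real.exp (-(-Real.cos θ * s)) *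
      (x ^ (r - 1) * Real.exp (-(s ^ β * Real.cos (θ * β) * x))) := by
    intro x hx s hs
    have hx : 0 < x := hx
    simp only [hG, K]
    rw [norm_mul, norm_mul, norm_ray _ _ hs, norm_exp_w, Complex.norm_real,
      Real.norm_of_nonneg (by positivity)]
    have : -(x * Real.cos (θ * β)) * s ^ β = -(s ^ β * Real.cos (θ * β) * x) := by ring
    rw [this]; ring
  have hmeas : Measurable (Function.uncurry G) := by
    simp only [hG, K, Function.uncurry_def]
    fun_prop
  have hGint : Integrable (Function.uncurry G)
      ((volume.restrict (Ioi (0:ℝ))).prod (volume.restrict (Ioi (0:ℝ)))) := by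
    rw [integrable_prod_iff' hmeas.aestronglyMeasurable]
    constructor
    · refine (ae_restrict_mem measurableSet_Ioi).mono fun s hs => ?_
      have hs' : 0 < s := hs
      refine Integrable.mono' ((integrable_rexp hr0 (c := s ^ β * Real.cos (θ * β))
        (by positivity)).const_mul (s ^ (β - 1) * Real.exp (-(-Real.cos θ * s)))) ?_ ?_
      · exact (hmeas.comp measurable_prodMk_right).aestronglyMeasurable
      · refine (ae_restrict_mem measurableSet_Ioi).mono fun x hx => ?_
        exact (hGn x hx s hs).le
    · refine ((integrable_rexp ha (neg_pos.2 hc)).const_mul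
        (Real.cos (θ * β) ^ (-r) * Real.Gamma r)).congr ?_
      refine (ae_restrict_mem measurableSet_Ioi).mono fun s hs => ?_
      have hs' : 0 < s := hs
      have e : ∫ x in Ioi (0:ℝ), ‖Function.uncurry G (x, s)‖ = ∫ x in Ioi (0:ℝ),
        s ^ (β - 1) * Real.exp (-(-Real.cos θ * s)) *
          (x ^ (r - 1) * Real.exp (-(s ^ β * Real.cos (θ * β) * x))) :=
        setIntegral_congr_fun measurableSet_Ioi fun x hx => hGn x hx s hs
      beta_reduce
      rw [e, integral_const_mul, Real.integral_rpow_mul_exp_neg_mul_Ioi hr0 (by positivity),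
        one_div, Real.inv_rpow (by positivity), ← Real.rpow_neg (by positivity),
        Real.mul_rpow (by positivity) hd.le, ← Real.rpow_mul hs'.le]
      have e2 : s ^ (β * (1 - r) - 1) = s ^ (β - 1) * s ^ (β * -r) := by
        rw [← Real.rpow_add hs']; ring_nf
      rw [e2]; ring
  have hswap := integral_integral_swap hGint
  have hinner : ∀ s ∈ Ioi (0:ℝ), ∫ x in Ioi (0:ℝ), G x s =
      Real.Gamma r * Complex.exp (-(r * (θ * β : ℝ) * Complex.I)) *
       (((s ^ (β * (1 - r) - 1) : ℝ) : ℂ) * Complex.exp (Complex.exp (θ * Complex.I) * s)) := by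
    intro s hs
    have hs' : 0 < s := hs
    have hg := gamma_rot hr0 (y := s ^ β) (φ := θ * β) (by positivity)
      (by have : 0 < θ * β := mul_pos (by linarith) hβ0
          linarith) h3
    have e : ∀ x, G x s = ((s ^ (β - 1) : ℝ) : ℂ) * Complex.exp (Complex.exp (θ * Complex.I) * s) *
      (((x ^ (r - 1) : ℝ) : ℂ) * Complex.exp (-(((s ^ β : ℝ) : ℂ) * Complex.exp ((θ * β : ℝ) * Complex.I) * x))) := by
      intro x
      simp only [hG, K]
      have : (x * Complex.exp ((θ * β : ℝ) * Complex.I) * ((s ^ β : ℝ) : ℂ))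
        = (((s ^ β : ℝ) : ℂ) * Complex.exp ((θ * β : ℝ) * Complex.I) * x) := by ring
      rw [this]; ring
    simp_rw [e]
    rw [integral_const_mul, hg, ← Real.rpow_mul hs'.le]
    have e2 : s ^ (β * (1 - r) - 1) = s ^ (β - 1) * s ^ (β * -r) := by
      rw [← Real.rpow_add hs']; ring_nf
    rw [e2]; push_cast; ring
  rw [setIntegral_congr_fun measurableSet_Ioi hinner, integral_const_mul] at hswap
  have hray := ray_int ha h1 h2
  have hfin : w * ∫ x in Ioi (0:ℝ), ∫ s in Ioi (0:ℝ), G x s =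
      ((Real.Gamma r * Real.Gamma (β * (1 - r)) : ℝ) : ℂ) *
        Complex.exp ((Real.pi * (β * (1 - r)) : ℝ) * Complex.I) := by
    rw [hswap]
    push_cast at hray ⊢
    rw [mul_assoc (Real.Gamma r : ℂ) (Real.Gamma (β * (1 - r)) : ℂ), ← hray]
    have : Complex.exp ((β * (1 - r)) * θ * Complex.I) =
        w * Complex.exp (-(r * (θ * β) * Complex.I)) := by
      rw [hw, ← Complex.exp_add]; push_cast; ring_nf
    rw [this]
    ring
  have hcomm : ∫ x in Ioi (0:ℝ), x ^ (r - 1) * MWright β x =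
      (w * ∫ x in Ioi (0:ℝ), ∫ s in Ioi (0:ℝ), G x s).im / Real.pi := by
    have hi : Integrable (fun x => w * ∫ s in Ioi (0:ℝ), G x s) (volume.restrict (Ioi (0:ℝ))) :=
      hGint.integral_prod_left.const_mul w
    rw [← integral_const_mul]
    have := Complex.imCLM.integral_comp_comm hi
    simp only [Complex.imCLM_apply] at this
    rw [← this, ← integral_div]
    refine setIntegral_congr_fun measurableSet_Ioi fun x hx => ?_
    simp only [hG]
    rw [integral_const_mul, mul_left_comm, Complex.im_ofReal_mul, MWright_eq hβ0 hβ1 h1 h2 x]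
    ring
  rw [hcomm, hfin, Complex.im_ofReal_mul, Complex.exp_ofReal_mul_I_im]
  have := gamma_refl ha
  have e : β * (r - 1) + 1 = 1 - β * (1 - r) := by ring
  rw [e, div_eq_mul_inv (Real.Gamma r), ← this]
  ring

end MW

theorem mellin_MWright (β : ℝ) (hβ0 : 0 < β) (hβ1 : β < 1) (z : ℂ) (hz : 0 < z.re) :
    ∫ x in Ioi (0 : ℝ), (x : ℂ) ^ (z - 1) * (MWright β x : ℂ)
      = Complex.Gamma z / Complex.Gamma ((β : ℂ) * (z - 1) + 1) := by
  have hpi := Real.pi_pos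
  obtain ⟨θ, h1, h2, h3⟩ : ∃ θ : ℝ, Real.pi / 2 < θ ∧ θ < Real.pi ∧ θ * β < Real.pi / 2 := by
    have : Real.pi / 2 < min Real.pi (Real.pi / 2 / β) := by
      refine lt_min (by linarith) ?_
      rw [lt_div_iff₀ hβ0]
      nlinarith
    obtain ⟨θ, ha, hb⟩ := exists_between this
    exact ⟨θ, ha, hb.trans_le (min_le_left _ _),
      (lt_div_iff₀ hβ0).1 (hb.trans_le (min_le_right _ _))⟩
  have hc : Real.cos θ < 0 := Real.cos_neg_of_pi_div_two_lt_of_lt h1 (by linarith)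
  have hd : 0 < Real.cos (θ * β) := by
    have : 0 < θ * β := mul_pos (by linarith) hβ0
    exact Real.cos_pos_of_mem_Ioo ⟨by linarith, h3⟩
  have hcont := MW.MWright_cont hβ0 hβ1 h1 h2 hc hd
  have hcont' : ContinuousOn (fun x : ℝ => (MWright β x : ℂ)) (Ici 0) :=
    Complex.continuous_ofReal.comp_continuousOn hcont
  have hU : IsOpen {x : ℂ | 0 < x.re} := isOpen_lt continuous_const Complex.continuous_re
  have hpc : IsPreconnected {x : ℂ | 0 < x.re} := (convex_halfSpace_re_gt 0).isPreconnected
  have hf : AnalyticOnNhd ℂ (mellin fun x : ℝ => (MWright β x : ℂ)) {x : ℂ | 0 < x.re} := by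
    refine DifferentiableOn.analyticOnNhd (fun u hu => ?_) hU
    apply DifferentiableAt.differentiableWithinAt
    have hu : 0 < u.re := hu
    obtain ⟨N, hN⟩ := exists_nat_gt (u.re * β)
    obtain ⟨C, hC⟩ := MW.MWright_decay hβ0 hβ1 h1 h2 h3 hc hd N
    refine mellin_differentiableAt_of_isBigO_rpow (a := (N + β) / β) (b := 0) ?_ ?_ ?_ ?_ hu
    · exact (hcont'.mono Ioi_subset_Ici_self).locallyIntegrableOn measurableSet_Ioi
    · refine Asymptotics.IsBigO.of_bound C ?_
      filter_upwards [Filter.eventually_gt_atTop 0] with x hx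
      rw [Complex.norm_real, Real.norm_eq_abs, Real.norm_of_nonneg (by positivity)]
      exact hC x hx
    · rw [lt_div_iff₀ hβ0]; linarith
    · have ht : Filter.Tendsto (fun x : ℝ => (MWright β x : ℂ)) (nhdsWithin 0 (Ioi 0))
          (nhds (MWright β 0 : ℂ)) :=
        (hcont' 0 self_mem_Ici).mono_left (nhdsWithin_mono _ Ioi_subset_Ici_self)
      simpa using ht.isBigO_one ℝ
  have hg : AnalyticOnNhd ℂ (fun u : ℂ => Complex.Gamma u *
      (Complex.Gamma ((β : ℂ) * (u - 1) + 1))⁻¹) {x : ℂ | 0 < x.re} := by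
    refine DifferentiableOn.analyticOnNhd (fun u hu => ?_) hU
    apply DifferentiableAt.differentiableWithinAt
    have hu : 0 < u.re := hu
    have hA : DifferentiableAt ℂ Complex.Gamma u := by
      refine Complex.differentiableAt_Gamma u fun m hm => ?_
      rw [hm] at hu
      have : (0:ℝ) ≤ m := m.cast_nonneg
      simp at hu
      linarith
    refine hA.mul ?_
    have hB : DifferentiableAt ℂ (fun u : ℂ => (β : ℂ) * (u - 1) + 1) u := by fun_prop
    exact (Complex.differentiable_one_div_Gamma _).comp u hB
  have key : ∀ r : ℝ, 0 < r → r < 1 → mellin (fun x : ℝ => (MWright β x : ℂ)) (r : ℂ) =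
      Complex.Gamma r * (Complex.Gamma ((β : ℂ) * ((r : ℂ) - 1) + 1))⁻¹ := by
    intro r hr0 hr1
    have h := congrArg (fun y : ℝ => (y : ℂ)) (MW.mellin_real hβ0 hβ1 h1 h2 h3 hc hd hr0 hr1)
    rw [← integral_complex_ofReal] at h
    rw [mellin]
    have e : ∫ x in Ioi (0:ℝ), (x : ℂ) ^ ((r : ℂ) - 1) • (MWright β x : ℂ) =
        ∫ x in Ioi (0:ℝ), ((x ^ (r - 1) * MWright β x : ℝ) : ℂ) := by
      refine setIntegral_congr_fun measurableSet_Ioi fun x hx => ?_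
      have hx : 0 < x := hx
      simp only [smul_eq_mul]
      push_cast [Complex.ofReal_cpow hx.le]
      rfl
    rw [e, h]
    push_cast [← Complex.Gamma_ofReal]
    rw [div_eq_mul_inv]
  have hmain : mellin (fun x : ℝ => (MWright β x : ℂ)) z =
      Complex.Gamma z * (Complex.Gamma ((β : ℂ) * (z - 1) + 1))⁻¹ := by
    refine hf.eqOn_of_preconnected_of_frequently_eq hg hpc (z₀ := ((1 / 2 : ℝ) : ℂ)) ?_ ?_ hz
    · show 0 < (((1 / 2 : ℝ) : ℂ)).re
      rw [Complex.ofReal_re]; norm_num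
    have ht : Filter.Tendsto (fun x : ℝ => (x : ℂ)) (nhdsWithin (1 / 2) {1 / 2}ᶜ)
        (nhdsWithin ((1 / 2 : ℝ) : ℂ) {((1 / 2 : ℝ) : ℂ)}ᶜ) := by
      refine tendsto_nhdsWithin_iff.2 ⟨?_, ?_⟩
      · exact (Complex.continuous_ofReal.tendsto _).mono_left nhdsWithin_le_nhds
      · filter_upwards [self_mem_nhdsWithin] with x hx
        intro h
        exact hx (Complex.ofReal_injective h)
    refine ht.frequently (Filter.Eventually.frequently ?_)
    have : ∀ᶠ x : ℝ in nhdsWithin (1 / 2) {1 / 2}ᶜ, 0 < x ∧ x < 1 :=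
      nhdsWithin_le_nhds (Ioo_mem_nhds (by norm_num) (by norm_num))
    filter_upwards [this] with x hx using key x hx.1 hx.2
  rw [div_eq_mul_inv, ← hmain, mellin]
  simp only [smul_eq_mul]
end

section
/- For 0 < β < 1, the Laplace transform of the M-Wright function is the Mittag-Leffler function: ∫₀^∞ e^(-st) M_β(t) dt = Σ_{n=0}^∞ (-s)^n / Γ(nβ + 1) for all s ≥ 0. -/
open MeasureTheory Set

namespace MWHelper
open Filter Topology

/-- The path `a + u ω`. -/
noncomputable def P (ω : ℂ) (a u : ℝ) : ℂ := (a : ℂ) + (u : ℂ) * ω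

/-- Admissible directions. -/
structure Adm (ω : ℂ) : Prop where
  re_neg : ω.re < 0
  im_pos : 0 < ω.im
  norm_one : ‖ω‖ = 1

variable {ω : ℂ}

lemma P_re (a u : ℝ) : (P ω a u).re = a + u * ω.re := by simp [P]
lemma P_im (a u : ℝ) : (P ω a u).im = u * ω.im := by simp [P]

lemma Adm.sq (h : Adm ω) : ω.re ^ 2 + ω.im ^ 2 = 1 := by
  have := h.norm_one
  have h2 : ‖ω‖ ^ 2 = 1 := by rw [this]; norm_num
  rw [Complex.sq_norm, Complex.normSq_apply] at h2
  nlinarith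

lemma P_slit (h : Adm ω) {a u : ℝ} (ha : 0 ≤ a) (hu : 0 ≤ u) (hau : 0 < a ∨ 0 < u) :
    P ω a u ∈ Complex.slitPlane := by
  rw [Complex.mem_slitPlane_iff, P_re, P_im]
  rcases hu.eq_or_lt with rfl | hu
  · left; simpa using hau
  · right; exact (mul_pos hu h.im_pos).ne'

lemma P_norm_ge (h : Adm ω) {a u : ℝ} (ha : 0 ≤ a) : a * ω.im ≤ ‖P ω a u‖ := by
  apply le_of_sq_le_sq _ (norm_nonneg _) |> fun h => h
  rw [Complex.sq_norm, Complex.normSq_apply, P_re, P_im]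
  have := h.sq
  have e : (a + u * ω.re) * (a + u * ω.re) + u * ω.im * (u * ω.im)
    = (u + a * ω.re) ^ 2 + (a * ω.im) ^ 2 + (u ^ 2 - a ^ 2) * (ω.re ^ 2 + ω.im ^ 2 - 1) := by ring
  rw [e, this]
  nlinarith [sq_nonneg (u + a * ω.re)]

lemma P_norm_ge' (h : Adm ω) {a u : ℝ} (hu : 0 ≤ u) : u * ω.im ≤ ‖P ω a u‖ := by
  have := Complex.abs_im_le_norm (P ω a u)
  rw [P_im, abs_of_nonneg (mul_nonneg hu h.im_pos.le)] at this
  exact this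

lemma P_norm_le (h : Adm ω) {a u : ℝ} (ha : 0 ≤ a) (hu : 0 ≤ u) : ‖P ω a u‖ ≤ a + u := by
  refine (norm_add_le _ _).trans ?_
  rw [norm_mul, h.norm_one]
  simp [abs_of_nonneg ha, abs_of_nonneg hu]

lemma P_arg_le (h : Adm ω) {a u : ℝ} (ha : 0 ≤ a) (hu : 0 ≤ u) (hau : 0 < a ∨ 0 < u) :
    0 ≤ (P ω a u).arg ∧ (P ω a u).arg ≤ ω.arg := by
  have h0 : P ω a u ≠ 0 := Complex.slitPlane_ne_zero (P_slit h ha hu hau)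
  have him : 0 ≤ (P ω a u).im := by rw [P_im]; exact mul_nonneg hu h.im_pos.le
  refine ⟨Complex.arg_nonneg_iff.2 him, ?_⟩
  have hω : ω ≠ 0 := by intro h'; have := h.im_pos; simp [h'] at this
  rw [Complex.arg_of_im_nonneg_of_ne_zero him h0,
    Complex.arg_of_im_nonneg_of_ne_zero h.im_pos.le hω, h.norm_one, div_one]
  apply Real.arccos_le_arccos
  rw [le_div_iff₀ (norm_pos_iff.2 h0), P_re]
  have h1 : u - a ≤ ‖P ω a u‖ := by
    have : ‖(u : ℂ) * ω‖ - ‖(-(a : ℂ))‖ ≤ ‖(u : ℂ) * ω - (-(a : ℂ))‖ := norm_sub_norm_le _ _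
    rw [norm_mul, h.norm_one, norm_neg, sub_neg_eq_add, add_comm] at this
    simpa [P, abs_of_nonneg ha, abs_of_nonneg hu] using this
  have h2 := h.sq
  have h3 := h.re_neg
  have h4 : -1 ≤ ω.re := by nlinarith [sq_nonneg ω.im]
  nlinarith [mul_nonneg_of_nonpos_of_nonpos h3.le (sub_nonpos.2 h1)]

lemma norm_exp_P (a u : ℝ) : ‖Complex.exp (P ω a u)‖ = Real.exp a * Real.exp (u * ω.re) := by
  rw [Complex.norm_exp, P_re, Real.exp_add]

lemma rpow_le_add {x y y1 y2 : ℝ} (hx : 0 < x) (h1 : y1 ≤ y) (h2 : y ≤ y2) :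
    x ^ y ≤ x ^ y1 + x ^ y2 := by
  have p1 := Real.rpow_nonneg hx.le y1
  have p2 := Real.rpow_nonneg hx.le y2
  rcases le_total 1 x with h | h
  · have := Real.rpow_le_rpow_of_exponent_le h h2; linarith
  · have := Real.rpow_le_rpow_of_exponent_ge hx h h1; linarith

/-- The integrand. -/
noncomputable def F (ω : ℂ) (y a u : ℝ) : ℂ := Complex.exp (P ω a u) * (P ω a u) ^ (y : ℂ)

lemma F_bound (h : Adm ω) (y : ℝ) {m A : ℝ} (hm : 0 < m) (hA : 0 ≤ A) :
    ∃ C, 0 ≤ C ∧ ∀ a u, 0 ≤ a → a ≤ A → 0 ≤ u → m ≤ ‖P ω a u‖ →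
      ‖F ω y a u‖ ≤ C * Real.exp (-(-ω.re / 2) * u) := by
  obtain ⟨N, hN⟩ := exists_nat_ge |y|
  set k := -ω.re / 2 with hk
  have hk0 : 0 < k := by have := h.re_neg; rw [hk]; linarith
  refine ⟨Real.exp A * (m ^ (-(N : ℝ)) + N.factorial / k ^ N * Real.exp (k * A)), ?_, ?_⟩
  · have := Real.rpow_nonneg hm.le (-(N : ℝ)); positivity
  intro a u ha haA hu hmP
  have hP : 0 < ‖P ω a u‖ := hm.trans_le hmP
  rw [F, norm_mul, Complex.norm_cpow_real, norm_exp_P]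
  have hy := abs_le.1 hN
  have h1 := rpow_le_add hP hy.1 hy.2
  have h2 : ‖P ω a u‖ ^ (-(N : ℝ)) ≤ m ^ (-(N : ℝ)) :=
    Real.rpow_le_rpow_of_nonpos hm hmP (by simp)
  have h3 : ‖P ω a u‖ ^ (N : ℝ) ≤ N.factorial / k ^ N * Real.exp (k * A) * Real.exp (k * u) := by
    rw [Real.rpow_natCast]
    have h4 := Real.pow_div_factorial_le_exp (k * (A + u)) (by positivity) N
    rw [mul_assoc, ← Real.exp_add, ← mul_add, div_mul_eq_mul_div, le_div_iff₀ (by positivity)]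
    rw [div_le_iff₀ (by positivity), mul_pow] at h4
    have h5 : ‖P ω a u‖ ^ N ≤ (A + u) ^ N := by
      apply pow_le_pow_left₀ (norm_nonneg _)
      have := P_norm_le h ha hu
      linarith
    calc _ ≤ (A + u) ^ N * k ^ N := by gcongr
      _ ≤ _ := by linarith
  have h6 : 1 ≤ Real.exp (k * u) := Real.one_le_exp (by positivity)
  have h7 : ‖P ω a u‖ ^ y ≤ (m ^ (-(N : ℝ)) + N.factorial / k ^ N * Real.exp (k * A))
      * Real.exp (k * u) := by
    have := Real.rpow_nonneg hm.le (-(N : ℝ))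
    nlinarith
  have h8 : Real.exp (u * ω.re) * Real.exp (k * u) = Real.exp (-k * u) := by
    rw [← Real.exp_add]; congr 1; rw [hk]; ring
  have h9 : Real.exp a ≤ Real.exp A := Real.exp_le_exp.2 haA
  calc _ ≤ Real.exp A * Real.exp (u * ω.re) * ((m ^ (-(N : ℝ)) + N.factorial / k ^ N
          * Real.exp (k * A)) * Real.exp (k * u)) := by gcongr
    _ = _ := by rw [← h8]; ring

lemma exp_int (h : Adm ω) : IntegrableOn (fun u : ℝ => Real.exp (-(-ω.re / 2) * u)) (Ioi 0) :=
  exp_neg_integrableOn_Ioi 0 (by have := h.re_neg; linarith)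

lemma P_cont (a : ℝ) : Continuous (P ω a) := by unfold P; fun_prop
lemma P_cont' (u : ℝ) : Continuous (fun a => P ω a u) := by unfold P; fun_prop

lemma F_cont (h : Adm ω) (y : ℝ) {a : ℝ} (ha : 0 < a) : ContinuousOn (F ω y a) (Ici 0) := by
  unfold F
  apply ContinuousOn.mul
  · exact (Complex.continuous_exp.comp (P_cont a)).continuousOn
  · exact (P_cont a).continuousOn.cpow_const
      (fun u hu => P_slit h ha.le hu (Or.inl ha))

lemma F_meas (y a : ℝ) : Measurable (F ω y a) := by
  unfold F
  have := (P_cont (ω := ω) a).measurable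
  exact (Complex.measurable_exp.comp this).mul (this.pow_const _)

lemma F_int (h : Adm ω) (y : ℝ) {a : ℝ} (ha : 0 < a) : IntegrableOn (F ω y a) (Ioi 0) := by
  obtain ⟨C, hC, hb⟩ := F_bound h y (mul_pos ha h.im_pos) ha.le
  refine Integrable.mono' ((exp_int h).const_mul C) (F_meas y a).aestronglyMeasurable ?_
  filter_upwards [ae_restrict_mem measurableSet_Ioi] with u hu
  exact hb a u ha.le le_rfl (le_of_lt hu) (P_norm_ge h ha.le)

lemma F_tendsto (h : Adm ω) (y : ℝ) {a : ℝ} (ha : 0 < a) :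
    Tendsto (F ω y a) atTop (𝓝 0) := by
  obtain ⟨C, hC, hb⟩ := F_bound h y (mul_pos ha h.im_pos) ha.le
  have hk : 0 < -ω.re / 2 := by have := h.re_neg; linarith
  have : Tendsto (fun u : ℝ => C * Real.exp (-(-ω.re / 2) * u)) atTop (𝓝 0) := by
    rw [← mul_zero C]
    apply Tendsto.const_mul
    apply Real.tendsto_exp_atBot.comp
    exact tendsto_id.const_mul_atTop_of_neg (by linarith)
  refine squeeze_zero_norm' ?_ this
  filter_upwards [eventually_ge_atTop 0] with u hu
  exact hb a u ha.le le_rfl hu (P_norm_ge h ha.le)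

/-- Complex derivative of the integrand. -/
noncomputable def F' (ω : ℂ) (y a u : ℝ) : ℂ := F ω y a u + y * F ω (y - 1) a u

lemma F_hasDeriv (y : ℝ) {p : ℂ} (hp : p ∈ Complex.slitPlane) :
    HasDerivAt (fun p : ℂ => Complex.exp p * p ^ (y : ℂ))
      (Complex.exp p * p ^ (y : ℂ) + y * (Complex.exp p * p ^ ((y - 1 : ℝ) : ℂ))) p := by
  have := (Complex.hasDerivAt_exp p).mul ((hasDerivAt_id p).cpow_const (c := (y : ℂ)) hp)
  refine HasDerivAt.congr_deriv this ?_
  push_cast; simp only [id]; ring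

lemma F_deriv_u (h : Adm ω) (y : ℝ) {a u : ℝ} (ha : 0 < a) (hu : 0 ≤ u) :
    HasDerivAt (F ω y a) (F' ω y a u * ω) u := by
  have h1 : HasDerivAt (P ω a) ω u := by
    have := ((Complex.ofRealCLM.hasDerivAt (x := u)).mul_const ω).const_add (a : ℂ)
    simp only [Complex.ofRealCLM_apply, Complex.ofReal_one, one_mul] at this
    exact this
  exact HasDerivAt.comp u (F_hasDeriv y (P_slit h ha.le hu (Or.inl ha))) h1

lemma F_deriv_a (h : Adm ω) (y : ℝ) {a u : ℝ} (ha : 0 < a) (hu : 0 ≤ u) :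
    HasDerivAt (fun a => F ω y a u) (F' ω y a u) a := by
  have h1 : HasDerivAt (fun a => P ω a u) 1 a := by
    have := ((Complex.ofRealCLM.hasDerivAt (x := a))).add_const ((u : ℂ) * ω)
    simp only [Complex.ofRealCLM_apply, Complex.ofReal_one] at this
    exact this
  have := HasDerivAt.comp a (F_hasDeriv y (P_slit (u := u) h ha.le hu (Or.inl ha))) h1
  rw [mul_one] at this
  exact this

lemma F'_int (h : Adm ω) (y : ℝ) {a : ℝ} (ha : 0 < a) : IntegrableOn (F' ω y a) (Ioi 0) :=
  (F_int h y ha).add ((F_int h (y - 1) ha).const_mul _)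

lemma int_F' (h : Adm ω) (y : ℝ) {a : ℝ} (ha : 0 < a) :
    (∫ u in Ioi (0 : ℝ), F' ω y a u * ω).im = 0 := by
  rw [integral_Ioi_of_hasDerivAt_of_tendsto (f := F ω y a) (m := 0)
    ((F_cont h y ha).continuousWithinAt (by simp))
    (fun u hu => F_deriv_u h y ha (le_of_lt hu))
    ((F'_int h y ha).mul_const ω) (F_tendsto h y ha)]
  have : F ω y a 0 = ((Real.exp a * a ^ y : ℝ) : ℂ) := by
    simp [F, P, Complex.ofReal_cpow ha.le]
  rw [this, zero_sub, Complex.neg_im, Complex.ofReal_im, neg_zero]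

/-- The Hankel integral. -/
noncomputable def H (ω : ℂ) (b a : ℝ) : ℝ := (∫ u in Ioi (0 : ℝ), F ω (-b) a u * ω).im

lemma H_rec (h : Adm ω) (b : ℝ) {a : ℝ} (ha : 0 < a) : H ω b a = b * H ω (b + 1) a := by
  have := int_F' h (-b) ha
  have e : (fun u => F' ω (-b) a u * ω) =
      fun u => F ω (-b) a u * ω - b * (F ω (-(b + 1)) a u * ω) := by
    funext u; simp only [F']; rw [show -b - 1 = -(b + 1) by ring]; push_cast; ring
  rw [e, integral_sub ((F_int h _ ha).mul_const ω) (((F_int h _ ha).mul_const ω).const_mul _),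
    integral_const_mul, Complex.sub_im, Complex.im_ofReal_mul] at this
  simp only [H]; linarith

lemma H_deriv (h : Adm ω) (b : ℝ) {a : ℝ} (ha : 0 < a) : HasDerivAt (H ω b) 0 a := by
  have hm : 0 < a / 2 * ω.im := by have := h.im_pos; positivity
  obtain ⟨C, hC, hb⟩ := F_bound h (-b) hm (A := 2 * a) (by positivity)
  obtain ⟨D, hD, hd⟩ := F_bound h (-b - 1) hm (A := 2 * a) (by positivity)
  have key := hasDerivAt_integral_of_dominated_loc_of_deriv_le (μ := volume.restrict (Ioi (0 : ℝ)))
    (F := fun a u => F ω (-b) a u * ω) (F' := fun a u => F' ω (-b) a u * ω) (x₀ := a)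
    (s := Ioo (a / 2) (2 * a)) (bound := fun u => (C + |b| * D) * Real.exp (-(-ω.re / 2) * u))
    (Ioo_mem_nhds (by linarith) (by linarith))
    (Eventually.of_forall fun x => ((F_meas _ x).mul_const ω).aestronglyMeasurable)
    ((F_int h _ ha).mul_const ω)
    ((F'_int h _ ha).mul_const ω).aestronglyMeasurable ?_ ((exp_int h).const_mul _) ?_
  · have := (Complex.imCLM.hasFDerivAt.comp_hasDerivAt a key.2)
    have e : Complex.imCLM (∫ u in Ioi (0 : ℝ), F' ω (-b) a u * ω) = 0 := int_F' h (-b) ha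
    rw [e] at this
    exact this
  · filter_upwards [ae_restrict_mem measurableSet_Ioi] with u hu x hx
    have hu' : 0 ≤ u := le_of_lt hu
    have hx0 : 0 < x := by have := hx.1; linarith
    have hP : a / 2 * ω.im ≤ ‖P ω x u‖ :=
      le_trans (mul_le_mul_of_nonneg_right hx.1.le h.im_pos.le) (P_norm_ge h hx0.le)
    have h1 := hb x u hx0.le hx.2.le hu' hP
    have h2 := hd x u hx0.le hx.2.le hu' hP
    rw [norm_mul, h.norm_one, mul_one, F']
    refine (norm_add_le _ _).trans ?_
    rw [norm_mul, Complex.norm_real, Real.norm_eq_abs, abs_neg]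
    have := mul_le_mul_of_nonneg_left h2 (abs_nonneg b)
    linarith
  · filter_upwards [ae_restrict_mem measurableSet_Ioi] with u hu x hx
    have hx0 : 0 < x := by have := hx.1; linarith
    exact (F_deriv_a h _ hx0 (le_of_lt hu)).mul_const ω

end MWHelper

namespace MWHelper
open Filter Topology

lemma gint {c r : ℝ} (hc : -1 < c) (hr : 0 < r) :
    IntegrableOn (fun u : ℝ => u ^ c * Real.exp (-r * u)) (Ioi 0) := by
  simpa using integrableOn_rpow_mul_exp_neg_mul_rpow (p := 1) hc one_pos hr

/-- integrand of the Gamma integral. -/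
noncomputable def g (c : ℝ) (z : ℂ) (u : ℝ) : ℂ := ((u ^ c : ℝ) : ℂ) * Complex.exp (-z * u)

lemma g_norm {c : ℝ} {z : ℂ} {u : ℝ} (hu : 0 < u) :
    ‖g c z u‖ = u ^ c * Real.exp (-z.re * u) := by
  rw [g, norm_mul, Complex.norm_exp, Complex.norm_real, Real.norm_eq_abs,
    abs_of_nonneg (Real.rpow_nonneg hu.le _)]
  simp

lemma g_meas (c : ℝ) (z : ℂ) : Measurable (g c z) := by
  unfold g
  fun_prop

lemma g_int {c : ℝ} {z : ℂ} (hc : -1 < c) (hz : 0 < z.re) : IntegrableOn (g c z) (Ioi 0) := by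
  refine Integrable.mono' (gint hc hz) (g_meas c z).aestronglyMeasurable ?_
  filter_upwards [ae_restrict_mem measurableSet_Ioi] with u hu
  rw [g_norm hu]

lemma g_parts {c : ℝ} {z : ℂ} (hc : 0 < c) (hz : 0 < z.re) :
    c * (∫ u in Ioi (0 : ℝ), g (c - 1) z u) = z * ∫ u in Ioi (0 : ℝ), g c z u := by
  have key := integral_Ioi_of_hasDerivAt_of_tendsto (f := g c z) (a := 0) (m := 0)
    (f' := fun u => c * g (c - 1) z u - z * g c z u) ?_ ?_ ?_ ?_
  · rw [integral_sub ((g_int (by linarith) hz).const_mul _) ((g_int (by linarith) hz).const_mul _),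
      integral_const_mul, integral_const_mul] at key
    have h0 : g c z 0 = 0 := by simp [g, Real.zero_rpow hc.ne']
    rw [h0, sub_zero] at key
    exact sub_eq_zero.1 key
  · apply Continuous.continuousWithinAt
    unfold g
    have : Continuous fun u : ℝ => u ^ c := Real.continuous_rpow_const hc.le
    fun_prop
  · intro u hu
    have h1 := (Real.hasDerivAt_rpow_const (x := u) (p := c) (Or.inl (ne_of_gt hu))).ofReal_comp
    have h2 : HasDerivAt (fun u : ℝ => Complex.exp (-z * u)) (Complex.exp (-z * u) * (-z)) u := by
      have := ((Complex.ofRealCLM.hasDerivAt (x := u)).const_mul (-z)).cexp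
      simpa using this
    refine HasDerivAt.congr_deriv (h1.mul h2) ?_
    simp only [g]; push_cast; ring
  · exact ((g_int (by linarith) hz).const_mul _).sub ((g_int (by linarith) hz).const_mul _)
  · have := tendsto_rpow_mul_exp_neg_mul_atTop_nhds_zero c z.re hz
    refine squeeze_zero_norm' ?_ this
    filter_upwards [eventually_gt_atTop 0] with u hu
    rw [g_norm hu]

lemma g_deriv {c : ℝ} {z : ℂ} (hc : 0 < c) (hz : 0 < z.re) :
    HasDerivAt (fun z => ∫ u in Ioi (0 : ℝ), g (c - 1) z u) (- ∫ u in Ioi (0 : ℝ), g c z u) z := by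
  have key := hasDerivAt_integral_of_dominated_loc_of_deriv_le (μ := volume.restrict (Ioi (0 : ℝ)))
    (F := fun z u => g (c - 1) z u) (F' := fun z u => - g c z u) (x₀ := z)
    (s := {w : ℂ | z.re / 2 < w.re}) (bound := fun u => u ^ c * Real.exp (-(z.re / 2) * u))
    ((isOpen_lt continuous_const Complex.continuous_re).mem_nhds (by simp; linarith))
    (Eventually.of_forall fun w => (g_meas _ w).aestronglyMeasurable)
    (g_int (by linarith) hz) (g_meas _ z).neg.aestronglyMeasurable ?_
    (gint (by linarith) (by linarith)) ?_
  · have := key.2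
    rwa [integral_neg] at this
  · filter_upwards [ae_restrict_mem measurableSet_Ioi] with u hu w hw
    have hu' : 0 < u := hu
    have hw' : z.re / 2 < w.re := hw
    rw [norm_neg, g_norm hu]
    have := Real.rpow_nonneg hu'.le c
    gcongr
  · filter_upwards [ae_restrict_mem measurableSet_Ioi] with u hu w hw
    have hu' : 0 < u := hu
    have h2 : HasDerivAt (fun w : ℂ => Complex.exp (-w * u)) (Complex.exp (-w * u) * (-u)) w := by
      have := ((hasDerivAt_id w).neg.mul_const (u : ℂ)).cexp
      simpa using this
    refine HasDerivAt.congr_deriv (h2.const_mul (((u ^ (c - 1) : ℝ) : ℂ))) ?_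
    have : u ^ c = u ^ (c - 1) * u := by
      rw [← Real.rpow_add_one hu'.ne', sub_add_cancel]
    simp only [g, this]; push_cast; ring

lemma gamma_int {c : ℝ} {z : ℂ} (hc : 0 < c) (hz : 0 < z.re) :
    z ^ (c : ℂ) * (∫ u in Ioi (0 : ℝ), g (c - 1) z u) = Real.Gamma c := by
  set K : ℂ → ℂ := fun z => z ^ (c : ℂ) * (∫ u in Ioi (0 : ℝ), g (c - 1) z u) with hK
  have hopen : IsOpen {w : ℂ | 0 < w.re} := isOpen_lt continuous_const Complex.continuous_re
  have hd : ∀ w ∈ {w : ℂ | 0 < w.re}, HasDerivAt K 0 w := by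
    intro w hw
    have hw' : 0 < w.re := hw
    have h0 : w ≠ 0 := by rintro rfl; simp at hw'
    have h1 := (hasDerivAt_id w).cpow_const (c := (c : ℂ)) (Or.inl hw')
    refine HasDerivAt.congr_deriv (h1.mul (g_deriv hc hw')) ?_
    have h2 := g_parts hc hw'
    have h3 : w ^ (c : ℂ) = w ^ ((c : ℂ) - 1) * w := by
      rw [Complex.cpow_sub _ _ h0, Complex.cpow_one]; field_simp
    simp only [id, mul_one]
    rw [h3]
    linear_combination w ^ ((c : ℂ) - 1) * h2
  have hconst : K z = K 1 := by
    refine hopen.is_const_of_deriv_eq_zero (convex_halfSpace_re_gt 0).isPreconnected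
      (fun w hw => (hd w hw).differentiableAt.differentiableWithinAt)
      (fun w hw => (hd w hw).deriv) hz (by simp)
  show K z = _
  rw [hconst, hK]
  simp only [Complex.one_cpow, one_mul]
  rw [Real.Gamma_eq_integral hc, ← integral_complex_ofReal]
  refine setIntegral_congr_fun measurableSet_Ioi fun u hu => ?_
  simp only [g]; push_cast; rw [neg_one_mul, mul_comm]

variable {ω : ℂ}

lemma H_zero (h : Adm ω) {b : ℝ} (hb1 : b < 1) :
    H ω b 0 = Real.sin (Real.pi * b) * Real.Gamma (1 - b) := by
  have hω : ω ≠ 0 := by intro h'; have := h.im_pos; simp [h'] at this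
  have hz : 0 < (-ω).re := by have := h.re_neg; simpa using this
  have hc : 0 < 1 - b := by linarith
  have key := gamma_int hc hz
  have e : (∫ u in Ioi (0 : ℝ), F ω (-b) 0 u * ω)
      = ω ^ ((1 - b : ℝ) : ℂ) * ∫ u in Ioi (0 : ℝ), g (1 - b - 1) (-ω) u := by
    rw [← integral_const_mul]
    refine setIntegral_congr_fun measurableSet_Ioi fun u hu => ?_
    have hu' : 0 < u := hu
    have e1 : ω ^ ((1 - b : ℝ) : ℂ) = ω ^ ((-b : ℝ) : ℂ) * ω := by
      push_cast
      rw [sub_eq_add_neg, add_comm, Complex.cpow_add _ _ hω, Complex.cpow_one]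
    have e3 : ((u : ℂ) * ω) ^ ((-b : ℝ) : ℂ) = (u : ℂ) ^ ((-b : ℝ) : ℂ) * ω ^ ((-b : ℝ) : ℂ) := by
      have hu0 : (u : ℂ) ≠ 0 := Complex.ofReal_ne_zero.2 hu'.ne'
      rw [Complex.cpow_def_of_ne_zero (mul_ne_zero hu0 hω), Complex.cpow_def_of_ne_zero hω,
        Complex.cpow_def_of_ne_zero hu0, Complex.log_ofReal_mul hu' hω, ← Complex.exp_add,
        Complex.ofReal_log hu'.le]
      congr 1; ring
    simp only [F, P, g]
    rw [e1, show 1 - b - 1 = -b by ring, Complex.ofReal_zero, zero_add, e3, Complex.ofReal_cpow hu'.le, neg_neg, mul_comm ω (u : ℂ)]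
    ring
  have e2 : ω ^ ((1 - b : ℝ) : ℂ) =
      Complex.exp (((Real.pi * (1 - b) : ℝ) : ℂ) * Complex.I) * (-ω) ^ ((1 - b : ℝ) : ℂ) := by
    rw [Complex.cpow_def_of_ne_zero hω, Complex.cpow_def_of_ne_zero (neg_ne_zero.2 hω),
      ← Complex.exp_add]
    congr 1
    simp only [Complex.log, Complex.arg_neg_eq_arg_sub_pi_of_im_pos h.im_pos, norm_neg]
    push_cast; ring
  rw [H, e, e2, mul_assoc, key, Complex.im_mul_ofReal, Complex.exp_ofReal_mul_I_im,
    show Real.pi * (1 - b) = Real.pi - Real.pi * b by ring, Real.sin_pi_sub]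

lemma H_contAt_zero (h : Adm ω) {b : ℝ} (hb0 : 0 ≤ b) (hb1 : b < 1) :
    ContinuousWithinAt (H ω b) (Ici 0) 0 := by
  have : ContinuousWithinAt (fun a => ∫ u in Ioi (0 : ℝ), F ω (-b) a u * ω) (Ici 0) 0 := by
    have hk := h.re_neg
    refine continuousWithinAt_of_dominated
      (bound := fun u => Real.exp 1 * ω.im ^ (-b) * (u ^ (-b) * Real.exp (-(-ω.re) * u)))
      (Eventually.of_forall fun x => ((F_meas _ x).mul_const ω).aestronglyMeasurable) ?_
      ((gint (by linarith) (by linarith)).const_mul _) ?_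
    · have h1 : ∀ᶠ x in 𝓝[Ici 0] (0 : ℝ), x < 1 :=
        nhdsWithin_le_nhds (eventually_lt_nhds one_pos)
      filter_upwards [h1, self_mem_nhdsWithin] with x hx hx0
      filter_upwards [ae_restrict_mem measurableSet_Ioi] with u hu
      have hu' : 0 < u := hu
      rw [norm_mul, h.norm_one, mul_one, F, norm_mul, norm_exp_P, Complex.norm_cpow_real]
      have h2 : ‖P ω x u‖ ^ (-b) ≤ (u * ω.im) ^ (-b) :=
        Real.rpow_le_rpow_of_nonpos (mul_pos hu' h.im_pos) (P_norm_ge' h hu'.le) (by linarith)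
      rw [Real.mul_rpow hu'.le h.im_pos.le] at h2
      have h3 : Real.exp x ≤ Real.exp 1 := Real.exp_le_exp.2 hx.le
      calc _ ≤ Real.exp 1 * Real.exp (u * ω.re) * (u ^ (-b) * ω.im ^ (-b)) := by gcongr
        _ = _ := by rw [show -(-ω.re) * u = u * ω.re by ring]; ring
    · filter_upwards [ae_restrict_mem measurableSet_Ioi] with u hu
      have hu' : 0 < u := hu
      apply ContinuousAt.continuousWithinAt
      have c1 := (P_cont' (ω := ω) u).continuousAt (x := 0)
      have c2 := (F_hasDeriv (-b) (P_slit h le_rfl hu'.le (Or.inr hu'))).continuousAt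
      exact (ContinuousAt.comp (f := fun a => P ω a u) c2 c1).mul continuousAt_const
  exact Complex.continuous_im.continuousAt.comp_continuousWithinAt this

lemma H_small (h : Adm ω) {a b : ℝ} (ha : 0 < a) (hb0 : 0 < b) (hb1 : b < 1) :
    H ω b a = Real.pi / Real.Gamma b := by
  have hc : ContinuousOn (H ω b) (Icc 0 a) := by
    intro x hx
    rcases hx.1.eq_or_lt with h0 | h0
    · rw [← h0]; exact (H_contAt_zero h hb0.le hb1).mono Icc_subset_Ici_self
    · exact (H_deriv h b h0).continuousAt.continuousWithinAt
  obtain ⟨c, hc, hs⟩ := exists_deriv_eq_slope (H ω b) ha hc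
    (fun x hx => (H_deriv h b hx.1).differentiableAt.differentiableWithinAt)
  rw [(H_deriv h b hc.1).deriv, sub_zero, eq_comm, div_eq_zero_iff] at hs
  have h1 : H ω b a = H ω b 0 := by
    rcases hs with hs | hs <;> linarith
  rw [h1, H_zero h hb1]
  have h2 := Real.Gamma_mul_Gamma_one_sub b
  have h3 := Real.Gamma_pos_of_pos hb0
  have h4 : 0 < Real.sin (Real.pi * b) :=
    Real.sin_pos_of_pos_of_lt_pi (by positivity) (by nlinarith [Real.pi_pos])
  rw [eq_div_iff h4.ne'] at h2
  rw [eq_div_iff h3.ne']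
  linarith

lemma H_one (h : Adm ω) {a : ℝ} (ha : 0 < a) : H ω 1 a = Real.pi / Real.Gamma 1 := by
  have hm : 0 < a * ω.im := mul_pos ha h.im_pos
  obtain ⟨C, hC, hb⟩ := F_bound h 0 hm ha.le
  obtain ⟨D, hD, hd⟩ := F_bound h (-2) hm ha.le
  have h1 : ContinuousAt (fun b => ∫ u in Ioi (0 : ℝ), F ω (-b) a u * ω) 1 := by
    refine continuousAt_of_dominated
      (bound := fun u => (C + D) * Real.exp (-(-ω.re / 2) * u))
      (Eventually.of_forall fun x => ((F_meas _ a).mul_const ω).aestronglyMeasurable) ?_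
      ((exp_int h).const_mul _) ?_
    · filter_upwards [Ioo_mem_nhds (show (0 : ℝ) < 1 by norm_num) (show (1 : ℝ) < 2 by norm_num)]
        with b hb'
      filter_upwards [ae_restrict_mem measurableSet_Ioi] with u hu
      have hu' : 0 < u := hu
      have hP := P_norm_ge (u := u) h ha.le
      have e1 := hb a u ha.le le_rfl hu'.le hP
      have e2 := hd a u ha.le le_rfl hu'.le hP
      rw [norm_mul, h.norm_one, mul_one]
      rw [F, norm_mul, Complex.norm_cpow_real] at e1 e2 ⊢
      have e3 := rpow_le_add (y := -b) (y1 := -2) (y2 := 0) (hm.trans_le hP)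
        (by linarith [hb'.2]) (by linarith [hb'.1])
      have := mul_le_mul_of_nonneg_left e3 (norm_nonneg (Complex.exp (P ω a u)))
      linarith
    · filter_upwards [ae_restrict_mem measurableSet_Ioi] with u hu
      have hu' : 0 < u := hu
      have h0 : P ω a u ≠ 0 := Complex.slitPlane_ne_zero (P_slit h ha.le hu'.le (Or.inl ha))
      unfold F
      apply Continuous.continuousAt
      apply Continuous.mul _ continuous_const
      apply Continuous.mul continuous_const
      apply Continuous.const_cpow (by fun_prop) (Or.inl h0)
  have h2 : ContinuousAt (fun b => H ω b a) 1 :=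
    Complex.continuous_im.continuousAt.comp h1
  have h3 : ContinuousAt (fun b => Real.pi / Real.Gamma b) 1 := by
    apply ContinuousAt.div continuousAt_const _ (by simp)
    apply DifferentiableAt.continuousAt (𝕜 := ℝ)
    apply Real.differentiableAt_Gamma
    intro m hm
    have : (0 : ℝ) ≤ m := m.cast_nonneg
    linarith
  have h4 := h2.tendsto.mono_left (nhdsWithin_le_nhds (s := Iio 1))
  have h5 := h3.tendsto.mono_left (nhdsWithin_le_nhds (s := Iio 1))
  refine tendsto_nhds_unique h4 (h5.congr' ?_)
  filter_upwards [Ioo_mem_nhdsLT (show (0 : ℝ) < 1 by norm_num)] with b hb'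
  exact (H_small h ha hb'.1 hb'.2).symm

lemma gamma_rec (b : ℝ) : Real.pi / Real.Gamma b = b * (Real.pi / Real.Gamma (b + 1)) := by
  by_cases hb : b = 0
  · simp [hb, Real.Gamma_zero]
  · rw [Real.Gamma_add_one hb]; field_simp

lemma H_pos (h : Adm ω) {a : ℝ} (ha : 0 < a) (n : ℕ) : ∀ b : ℝ, 0 < b → b ≤ n + 1 →
    H ω b a = Real.pi / Real.Gamma b := by
  induction n with
  | zero =>
    intro b hb hb1
    norm_num at hb1
    rcases hb1.eq_or_lt with rfl | hb1
    · exact H_one h ha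
    · exact H_small h ha hb hb1
  | succ n ih =>
    intro b hb hb1
    by_cases hb2 : b ≤ n + 1
    · exact ih b hb hb2
    · push_cast at hb1
      have hn : (0 : ℝ) ≤ n := n.cast_nonneg
      push Not at hb2
      have h1 := ih (b - 1) (by linarith) (by linarith)
      rw [H_rec h _ ha, gamma_rec, sub_add_cancel] at h1
      exact mul_left_cancel₀ (by linarith) h1

lemma H_neg (h : Adm ω) {a : ℝ} (ha : 0 < a) (n : ℕ) : ∀ b : ℝ, -n < b →
    H ω b a = Real.pi / Real.Gamma b := by
  induction n with
  | zero =>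
    intro b hb
    obtain ⟨N, hN⟩ := exists_nat_ge b
    exact H_pos h ha N b (by simpa using hb) (by linarith)
  | succ n ih =>
    intro b hb
    push_cast at hb
    rw [H_rec h _ ha, gamma_rec, ih (b + 1) (by linarith)]

lemma hankel (h : Adm ω) {a : ℝ} (ha : 0 < a) (b : ℝ) :
    (∫ u in Ioi (0 : ℝ), F ω (-b) a u * ω).im = Real.pi / Real.Gamma b := by
  obtain ⟨n, hn⟩ := exists_nat_gt (-b)
  exact H_neg h ha n b (by linarith)

end MWHelper

namespace MWHelper
open Filter Topology

variable {ω : ℂ}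

lemma exists_adm {β : ℝ} (hβ0 : 0 < β) (hβ1 : β < 1) :
    ∃ ω : ℂ, Adm ω ∧ β * ω.arg < Real.pi / 2 := by
  have hpi := Real.pi_pos
  obtain ⟨φ, h1, h2⟩ := exists_between (show Real.pi / 2 < min Real.pi (Real.pi / 2 / β) by
    rw [lt_min_iff]
    refine ⟨by linarith, ?_⟩
    rw [lt_div_iff₀ hβ0]; nlinarith)
  rw [lt_min_iff] at h2
  refine ⟨Complex.exp (φ * Complex.I), ⟨?_, ?_, ?_⟩, ?_⟩
  · rw [Complex.exp_ofReal_mul_I_re]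
    exact Real.cos_neg_of_pi_div_two_lt_of_lt h1 (by linarith)
  · rw [Complex.exp_ofReal_mul_I_im]
    exact Real.sin_pos_of_pos_of_lt_pi (by linarith) h2.1
  · exact Complex.norm_exp_ofReal_mul_I φ
  · rw [Complex.arg_exp_mul_I, (toIocMod_eq_self _).2 ⟨by linarith, by linarith⟩]
    have := (lt_div_iff₀ hβ0).1 h2.2
    linarith

lemma Pβ_re (h : Adm ω) {β a u : ℝ} (hβ0 : 0 < β) (harg : β * ω.arg < Real.pi / 2)
    (ha : 0 < a) (ha1 : 1 ≤ a * ω.im) (hu : 0 ≤ u) :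
    Real.cos (β * ω.arg) ≤ ((P ω a u) ^ (β : ℂ)).re := by
  have hP := ha1.trans (P_norm_ge (u := u) h ha.le)
  have h0 : P ω a u ≠ 0 := Complex.slitPlane_ne_zero (P_slit h ha.le hu (Or.inl ha))
  obtain ⟨g0, g1⟩ := P_arg_le h ha.le hu (Or.inl ha)
  have hpi := Real.pi_pos
  rw [Complex.cpow_ofReal_re]
  have h1 : Real.cos (β * ω.arg) ≤ Real.cos ((P ω a u).arg * β) := by
    apply Real.cos_le_cos_of_nonneg_of_le_pi
    · positivity
    · linarith
    · nlinarith
  have h2 : 0 ≤ Real.cos (β * ω.arg) := by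
    apply Real.cos_nonneg_of_neg_pi_div_two_le_of_le
    · nlinarith [mul_nonneg hβ0.le (g0.trans g1)]
    · linarith
  have h3 : 1 ≤ ‖P ω a u‖ ^ β := Real.one_le_rpow hP hβ0.le
  nlinarith

lemma young {β t ε : ℝ} (hβ0 : 0 < β) (hβ1 : β < 1) (ht : 0 ≤ t) (hε : 0 < ε) :
    ∃ D, ∀ x, 0 < x → t * x ^ β ≤ ε * x + D := by
  set X := (t / ε) ^ (1 / (1 - β)) with hX
  have hX0 : 0 ≤ X := by positivity
  refine ⟨t * X ^ β, fun x hx => ?_⟩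
  rcases le_total x X with hx' | hx'
  · have : x ^ β ≤ X ^ β := Real.rpow_le_rpow hx.le hx' hβ0.le
    have := mul_le_mul_of_nonneg_left this ht
    have : 0 ≤ ε * x := by positivity
    linarith
  · have h1 : X ^ (1 - β) ≤ x ^ (1 - β) := Real.rpow_le_rpow hX0 hx' (by linarith)
    rw [hX, ← Real.rpow_mul (by positivity), one_div, inv_mul_cancel₀ (by linarith), Real.rpow_one,
      div_le_iff₀ hε] at h1
    have h2 : x = x ^ (1 - β) * x ^ β := by
      rw [← Real.rpow_add hx]; simp
    have h3 : 0 ≤ x ^ β := Real.rpow_nonneg hx.le _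
    have h4 : 0 ≤ t * X ^ β := by positivity
    have := mul_le_mul_of_nonneg_right h1 h3
    calc t * x ^ β ≤ ε * (x ^ (1 - β) * x ^ β) := by linarith
      _ = ε * x := by rw [← h2]
      _ ≤ _ := by linarith

lemma cexp_hasSum (z : ℂ) : HasSum (fun n : ℕ => z ^ n / n.factorial) (Complex.exp z) := by
  rw [Complex.exp_eq_exp_ℂ]; exact NormedSpace.expSeries_div_hasSum_exp z

lemma rexp_hasSum (z : ℝ) : HasSum (fun n : ℕ => z ^ n / n.factorial) (Real.exp z) := by
  rw [Real.exp_eq_exp_ℝ]; exact NormedSpace.expSeries_div_hasSum_exp z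

lemma F_add {a u : ℝ} (h0 : P ω a u ≠ 0) (y β : ℝ) (n : ℕ) :
    F ω (y + n * β) a u = F ω y a u * ((P ω a u) ^ (β : ℂ)) ^ n := by
  simp only [F]
  rw [← Complex.cpow_nat_mul]
  push_cast
  rw [Complex.cpow_add _ _ h0, mul_assoc]

lemma P_ne (h : Adm ω) {a u : ℝ} (ha : 0 < a) (hu : 0 ≤ u) : P ω a u ≠ 0 :=
  Complex.slitPlane_ne_zero (P_slit h ha.le hu (Or.inl ha))

lemma MW_int (h : Adm ω) {β a t : ℝ} (hβ0 : 0 < β) (hβ1 : β < 1)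
    (ha : 0 < a) (ha1 : 1 ≤ a * ω.im) (ht : 0 ≤ t) :
    MWright β t = (Real.pi)⁻¹ *
      (∫ u in Ioi (0 : ℝ), F ω (β - 1) a u * ω * Complex.exp (-t * (P ω a u) ^ (β : ℂ))).im := by
  have hk := h.re_neg
  obtain ⟨D, hD⟩ := young hβ0 hβ1 ht (ε := -ω.re / 2) (by linarith)
  have key := hasSum_integral_of_dominated_convergence (μ := volume.restrict (Ioi (0 : ℝ)))
    (F := fun (n : ℕ) u => (((-t) ^ n / n.factorial : ℝ) : ℂ) * (F ω (-(-β * n + 1 - β)) a u * ω))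
    (f := fun u => F ω (β - 1) a u * ω * Complex.exp (-t * (P ω a u) ^ (β : ℂ)))
    (fun n u => Real.exp a * Real.exp (u * ω.re) * ((t * ‖P ω a u‖ ^ β) ^ n / n.factorial))
    (fun n => ((((F_meas _ a).mul_const ω)).const_mul _).aestronglyMeasurable) ?_ ?_ ?_ ?_
  · have k2 := key.mapL Complex.imCLM
    have k3 := (k2.mul_left (Real.pi)⁻¹).tsum_eq
    simp only [Complex.imCLM_apply] at k3
    rw [← k3, MWright]
    refine tsum_congr fun n => ?_
    rw [integral_const_mul, Complex.im_ofReal_mul, hankel h ha]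
    have := Real.pi_pos
    field_simp
  · intro n
    filter_upwards [ae_restrict_mem measurableSet_Ioi] with u hu
    have hu' : 0 < u := hu
    have h0 := P_ne h ha hu'.le
    have hP := ha1.trans (P_norm_ge (u := u) h ha.le)
    rw [show -(-β * n + 1 - β) = (β - 1) + n * β by ring, F_add h0, F, norm_mul, norm_mul, norm_mul,
      norm_mul, norm_pow, norm_exp_P, h.norm_one, Complex.norm_cpow_real, Complex.norm_cpow_real,
      Complex.norm_real, norm_div, norm_pow, norm_neg, Real.norm_of_nonneg ht,
      Real.norm_of_nonneg (Nat.cast_nonneg _), mul_pow]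
    have h1 : ‖P ω a u‖ ^ (β - 1) ≤ 1 := Real.rpow_le_one_of_one_le_of_nonpos hP (by linarith)
    have : 0 ≤ Real.exp a * Real.exp (u * ω.re) * (t ^ n * (‖P ω a u‖ ^ β) ^ n / n.factorial) := by
      positivity
    calc _ = ‖P ω a u‖ ^ (β - 1) *
          (Real.exp a * Real.exp (u * ω.re) * (t ^ n * (‖P ω a u‖ ^ β) ^ n / n.factorial)) := by ring
      _ ≤ _ := mul_le_of_le_one_left this h1
  · filter_upwards with u
    exact (rexp_hasSum _).summable.mul_left _
  · have e : (fun u => ∑' n : ℕ, Real.exp a * Real.exp (u * ω.re) *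
        ((t * ‖P ω a u‖ ^ β) ^ n / n.factorial)) =
        fun u => Real.exp a * Real.exp (u * ω.re) * Real.exp (t * ‖P ω a u‖ ^ β) := by
      funext u
      exact ((rexp_hasSum _).mul_left _).tsum_eq
    rw [e]
    refine Integrable.mono' ((exp_int h).const_mul (Real.exp (a + -ω.re / 2 * a + D))) ?_ ?_
    · have := (P_cont (ω := ω) a).measurable
      apply Measurable.aestronglyMeasurable
      fun_prop
    · filter_upwards [ae_restrict_mem measurableSet_Ioi] with u hu
      have hu' : 0 < u := hu
      rw [Real.norm_of_nonneg (by positivity), ← Real.exp_add, ← Real.exp_add, ← Real.exp_add]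
      apply Real.exp_le_exp.2
      have h1 := hD ‖P ω a u‖ (norm_pos_iff.2 (P_ne h ha hu'.le))
      have h2 := P_norm_le h ha.le hu'.le
      nlinarith
  · filter_upwards [ae_restrict_mem measurableSet_Ioi] with u hu
    have hu' : 0 < u := hu
    have h0 := P_ne h ha hu'.le
    have := (cexp_hasSum (-t * (P ω a u) ^ (β : ℂ))).mul_left (F ω (β - 1) a u * ω)
    refine Eq.mp (congrArg (fun f => HasSum f _) (funext fun n => ?_)) this
    symm
    rw [show -(-β * n + 1 - β) = (β - 1) + n * β by ring, F_add h0, mul_pow]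
    push_cast
    ring

lemma laplace_int (h : Adm ω) {β a s : ℝ} (hβ0 : 0 < β) (hβ1 : β < 1)
    (harg : β * ω.arg < Real.pi / 2)
    (ha : 0 < a) (ha1 : 1 ≤ a * ω.im) (hs : 0 ≤ s) :
    ∫ t in Ioi (0 : ℝ), Real.exp (-(s * t)) * MWright β t = (Real.pi)⁻¹ *
      (∫ u in Ioi (0 : ℝ), F ω (β - 1) a u * ω / (s + (P ω a u) ^ (β : ℂ))).im := by
  set c := Real.cos (β * ω.arg) with hc
  have hpi := Real.pi_pos
  have hc0 : 0 < c := by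
    apply Real.cos_pos_of_mem_Ioo
    refine ⟨?_, harg⟩
    have := mul_nonneg hβ0.le (Complex.arg_nonneg_iff.2 h.im_pos.le)
    linarith
  let G : ℝ → ℝ → ℂ := fun t u =>
    F ω (β - 1) a u * ω * Complex.exp (-(s + (P ω a u) ^ (β : ℂ)) * t)
  have hG : Integrable (Function.uncurry G)
      ((volume.restrict (Ioi (0 : ℝ))).prod (volume.restrict (Ioi (0 : ℝ)))) := by
    have hb := Integrable.mul_prod (exp_neg_integrableOn_Ioi 0 hc0)
      ((F_int h (β - 1) ha).norm)
    refine hb.mono' ?_ ?_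
    · have h1 := (P_cont (ω := ω) a).measurable
      have h2 := F_meas (ω := ω) (β - 1) a
      have h3 : Measurable fun p : ℝ × ℝ => (P ω a p.2) ^ (β : ℂ) :=
        (h1.comp measurable_snd).pow_const _
      have h4 : Measurable fun p : ℝ × ℝ => F ω (β - 1) a p.2 := h2.comp measurable_snd
      apply Measurable.aestronglyMeasurable
      simp only [G, Function.uncurry_def]
      fun_prop
    · rw [Measure.prod_restrict]
      filter_upwards [ae_restrict_mem (measurableSet_Ioi.prod measurableSet_Ioi)] with p hp
      have hp1 : 0 < p.1 := hp.1
      have hp2 : 0 < p.2 := hp.2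
      have hre := Pβ_re h hβ0 harg ha ha1 hp2.le
      simp only [G, Function.uncurry_def]
      rw [norm_mul, norm_mul, h.norm_one, mul_one, Complex.norm_exp, mul_comm]
      gcongr
      simp only [Complex.re_mul_ofReal, Complex.neg_re, Complex.add_re, Complex.ofReal_re]
      nlinarith
  have e1 : ∀ t ∈ Ioi (0 : ℝ), Real.exp (-(s * t)) * MWright β t =
      (Real.pi)⁻¹ * (∫ u in Ioi (0 : ℝ), G t u).im := by
    intro t ht
    rw [MW_int h hβ0 hβ1 ha ha1 (le_of_lt ht), mul_left_comm, ← Complex.im_ofReal_mul,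
      ← integral_const_mul]
    congr 3
    funext u
    simp only [G]
    rw [show -((s : ℂ) + P ω a u ^ (β : ℂ)) * t = -(s * t) + -t * P ω a u ^ (β : ℂ) by ring,
      Complex.exp_add]
    push_cast
    ring
  rw [setIntegral_congr_fun measurableSet_Ioi e1, integral_const_mul]
  congr 1
  have e2 : ∫ t in Ioi (0 : ℝ), (∫ u in Ioi (0 : ℝ), G t u).im =
      (∫ t in Ioi (0 : ℝ), ∫ u in Ioi (0 : ℝ), G t u).im :=
    Complex.imCLM.integral_comp_comm hG.integral_prod_left
  rw [e2, integral_integral_swap hG]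
  congr 1
  refine setIntegral_congr_fun measurableSet_Ioi fun u hu => ?_
  have hu' : 0 < u := hu
  have hre := Pβ_re h hβ0 harg ha ha1 hu'.le
  simp only [G]
  have hneg : (-(s + (P ω a u) ^ (β : ℂ))).re < 0 := by
    simp only [Complex.neg_re, Complex.add_re, Complex.ofReal_re]; linarith
  rw [integral_const_mul, integral_exp_mul_complex_Ioi hneg]
  rw [Complex.ofReal_zero, mul_zero, Complex.exp_zero, neg_div_neg_eq, mul_one_div]

lemma ML_int (h : Adm ω) {β a s : ℝ} (hβ0 : 0 < β)
    (ha : 0 < a) (ha1 : 1 ≤ a * ω.im) (hs : 0 ≤ s) (has : 2 * s ≤ (a * ω.im) ^ β) :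
    ∑' n : ℕ, (-s) ^ n / Real.Gamma (n * β + 1) = (Real.pi)⁻¹ *
      (∫ u in Ioi (0 : ℝ), F ω (β - 1) a u * ω / (s + (P ω a u) ^ (β : ℂ))).im := by
  have key := hasSum_integral_of_dominated_convergence (μ := volume.restrict (Ioi (0 : ℝ)))
    (F := fun (n : ℕ) u => (((-s) ^ n : ℝ) : ℂ) * (F ω (-(n * β + 1)) a u * ω))
    (f := fun u => F ω (β - 1) a u * ω / (s + (P ω a u) ^ (β : ℂ)))
    (fun n u => ‖F ω (-1) a u‖ * (1 / 2) ^ n)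
    (fun n => ((((F_meas _ a).mul_const ω)).const_mul _).aestronglyMeasurable) ?_ ?_ ?_ ?_
  · have k2 := key.mapL Complex.imCLM
    have k3 := (k2.mul_left (Real.pi)⁻¹).tsum_eq
    simp only [Complex.imCLM_apply] at k3
    rw [← k3]
    refine tsum_congr fun n => ?_
    rw [integral_const_mul, Complex.im_ofReal_mul, hankel h ha]
    have := Real.pi_pos
    field_simp
  · intro n
    filter_upwards [ae_restrict_mem measurableSet_Ioi] with u hu
    have hu' : 0 < u := hu
    have h0 := P_ne h ha hu'.le
    have hP := P_norm_ge (u := u) h ha.le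
    rw [show -(n * β + 1) = (-1) + n * (-β) by ring, F_add h0, norm_mul, norm_mul, norm_mul,
      norm_pow, h.norm_one, Complex.norm_cpow_real, Complex.norm_real, norm_pow, norm_neg,
      Real.norm_of_nonneg hs, mul_one, mul_left_comm, ← mul_pow]
    have h1 : (a * ω.im) ^ β ≤ ‖P ω a u‖ ^ β := Real.rpow_le_rpow (by linarith) hP hβ0.le
    have h2 : s * ‖P ω a u‖ ^ (-β) ≤ 1 / 2 := by
      have : 0 < ‖P ω a u‖ ^ β := Real.rpow_pos_of_pos (norm_pos_iff.2 h0) _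
      rw [Real.rpow_neg (norm_nonneg _), ← div_eq_mul_inv, div_le_iff₀ this]
      linarith
    gcongr
  · filter_upwards with u
    exact (summable_geometric_of_lt_one (by norm_num) (by norm_num)).mul_left _
  · simp only [tsum_mul_left]
    exact (F_int h (-1) ha).norm.mul_const _
  · filter_upwards [ae_restrict_mem measurableSet_Ioi] with u hu
    have hu' : 0 < u := hu
    have h0 := P_ne h ha hu'.le
    have hP := P_norm_ge (u := u) h ha.le
    have h1 : (a * ω.im) ^ β ≤ ‖P ω a u‖ ^ β := Real.rpow_le_rpow (by linarith) hP hβ0.le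
    have h3 : 0 < ‖P ω a u‖ ^ β := Real.rpow_pos_of_pos (norm_pos_iff.2 h0) _
    have hw : (P ω a u) ^ (β : ℂ) ≠ 0 := by
      rw [← norm_pos_iff, Complex.norm_cpow_real]; exact h3
    set W := (P ω a u) ^ (β : ℂ) with hW
    have hWn : ‖W‖ = ‖P ω a u‖ ^ β := Complex.norm_cpow_real _ _
    have hr : ‖-(s : ℂ) * W⁻¹‖ < 1 := by
      rw [norm_mul, norm_neg, norm_inv, hWn, Complex.norm_real, Real.norm_of_nonneg hs,
        ← div_eq_mul_inv, div_lt_one h3]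
      rcases hs.eq_or_lt with rfl | hs
      · exact h3
      · linarith
    have := (hasSum_geometric_of_norm_lt_one hr).mul_left (F ω (-1) a u * ω)
    have hne : (s : ℂ) + W ≠ 0 := by
      intro h'
      have : -(s : ℂ) * W⁻¹ = 1 := by
        rw [show -(s : ℂ) = W by linear_combination -h']; exact mul_inv_cancel₀ hw
      rw [this] at hr; simp at hr
    have eF : F ω (β - 1) a u = F ω (-1) a u * W := by
      have := F_add (ω := ω) h0 (-1) β 1
      rw [pow_one, Nat.cast_one, one_mul] at this
      rw [← this]; congr 1; ring
    have e : F ω (-1) a u * ω * (1 - -(s : ℂ) * W⁻¹)⁻¹ = F ω (β - 1) a u * ω / (s + W) := by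
      rw [eF, show 1 - -(s : ℂ) * W⁻¹ = (s + W) * W⁻¹ by field_simp; ring, mul_inv, inv_inv]
      field_simp
    rw [e] at this
    refine Eq.mp (congrArg (fun f => HasSum f _) (funext fun n => ?_)) this
    symm
    have eW : (P ω a u) ^ ((-β : ℝ) : ℂ) = W⁻¹ := by
      rw [hW, Complex.ofReal_neg, Complex.cpow_neg]
    rw [show -(n * β + 1) = (-1) + n * (-β) by ring, F_add h0, eW, mul_pow]
    push_cast
    ring

end MWHelper

theorem laplace_MWright_eq_mittagLeffler (β : ℝ) (hβ0 : 0 < β) (hβ1 : β < 1)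
    (s : ℝ) (hs : 0 ≤ s) :
    ∫ t in Ioi (0 : ℝ), Real.exp (-(s * t)) * MWright β t
      = ∑' n : ℕ, (-s) ^ n / Real.Gamma (n * β + 1) := by
  obtain ⟨ω, h, harg⟩ := MWHelper.exists_adm hβ0 hβ1
  have hl := h.im_pos
  set x := 1 + (2 * s) ^ (1 / β) with hx
  have hy : 0 ≤ (2 * s) ^ (1 / β) := by positivity
  have hx1 : x / ω.im * ω.im = x := by field_simp
  have ha : 0 < x / ω.im := by positivity
  have ha1 : 1 ≤ x / ω.im * ω.im := by rw [hx1]; linarith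
  rw [MWHelper.laplace_int h hβ0 hβ1 harg ha ha1 hs, MWHelper.ML_int h hβ0 ha ha1 hs]
  rw [hx1]
  calc 2 * s = ((2 * s) ^ (1 / β)) ^ β := by
        rw [← Real.rpow_mul (by positivity), one_div, inv_mul_cancel₀ hβ0.ne', Real.rpow_one]
    _ ≤ x ^ β := Real.rpow_le_rpow hy (by linarith) hβ0.le
end

section
/- Let 0 < β < 1, let Y₀ be an exponential random variable with rate 1, and let Y_β be an independent random variable with density M_β on (0,∞). Then Y₀ and the product Y₀^β · Y_β have the same distribution. -/
open MeasureTheory Set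

lemma norm_kern (s z : ℂ) {t : ℝ} (ht : 0 < t) :
    ‖(t:ℂ)^(s-1) * Complex.exp (-(z * t))‖ = t ^ (s.re - 1) * Real.exp (-(z.re * t)) := by
  rw [norm_mul, Complex.norm_cpow_eq_rpow_re_of_pos ht, Complex.norm_exp]
  simp

lemma int_real {s c : ℝ} (hs : 0 < s) (hc : 0 < c) :
    IntegrableOn (fun t : ℝ => t ^ (s - 1) * Real.exp (-(c * t))) (Ioi 0) := by
  have := integrableOn_rpow_mul_exp_neg_mul_rpow (p := 1) (s := s - 1) (b := c)
    (by linarith) one_pos hc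
  simpa using this

lemma int_cplx {s z : ℂ} (hs : 0 < s.re) (hz : 0 < z.re) :
    IntegrableOn (fun t : ℝ => (t:ℂ)^(s-1) * Complex.exp (-(z * t))) (Ioi 0) := by
  refine Integrable.mono' (int_real hs hz) ?_ ?_
  · exact Measurable.aestronglyMeasurable (by fun_prop)
  · filter_upwards [self_mem_ae_restrict measurableSet_Ioi] with t ht
    rw [norm_kern s z ht]

lemma gamma_cplx {s z : ℂ} (hs : 0 < s.re) (hz : 0 < z.re) :
    ∫ t in Ioi (0:ℝ), (t:ℂ)^(s-1) * Complex.exp (-(z * t)) = z ^ (-s) * Complex.Gamma s := by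
  have hopen : IsOpen {z : ℂ | 0 < z.re} := isOpen_lt continuous_const Complex.continuous_re
  have hd : DifferentiableOn ℂ (fun z : ℂ => ∫ t in Ioi (0:ℝ), (t:ℂ)^(s-1) * Complex.exp (-(z * t)))
      {z : ℂ | 0 < z.re} := by
    intro w hw
    have hw : 0 < w.re := hw
    have hopen2 : IsOpen {z : ℂ | w.re / 2 < z.re} := isOpen_lt continuous_const Complex.continuous_re
    have := hasDerivAt_integral_of_dominated_loc_of_deriv_le (𝕜 := ℂ)
      (μ := volume.restrict (Ioi (0:ℝ))) (x₀ := w)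
      (F := fun (z : ℂ) (t : ℝ) => (t:ℂ)^(s-1) * Complex.exp (-(z * t)))
      (F' := fun (z : ℂ) (t : ℝ) => (t:ℂ)^(s-1) * (Complex.exp (-(z * t)) * (-t)))
      (bound := fun t : ℝ => t ^ ((s.re + 1) - 1) * Real.exp (-(w.re / 2 * t)))
      (hopen2.mem_nhds (by simp; linarith))
      (Filter.Eventually.of_forall fun z => Measurable.aestronglyMeasurable (by fun_prop))
      (int_cplx hs hw)
      (Measurable.aestronglyMeasurable (by fun_prop)) ?_ (int_real (by linarith) (by linarith)) ?_
    · exact this.2.differentiableAt.differentiableWithinAt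
    · filter_upwards [self_mem_ae_restrict measurableSet_Ioi] with t ht z hz
      have ht : 0 < t := ht
      have hz : w.re / 2 < z.re := hz
      rw [← mul_assoc, norm_mul, norm_kern s z ht, norm_neg, Complex.norm_real, Real.norm_of_nonneg ht.le,
        mul_right_comm, ← Real.rpow_add_one ht.ne']
      have : s.re - 1 + 1 = s.re + 1 - 1 := by ring
      rw [this]
      gcongr
    · refine Filter.Eventually.of_forall fun t z _ => ?_
      have : HasDerivAt (fun z : ℂ => -(z * t)) (-(t:ℂ)) z := by
        have h := ((hasDerivAt_id z).mul_const (t:ℂ)).neg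
        rw [one_mul] at h
        exact h
      exact this.cexp.const_mul _
  have hd2 : DifferentiableOn ℂ (fun z : ℂ => z ^ (-s) * Complex.Gamma s) {z : ℂ | 0 < z.re} := by
    intro w hw
    have hw : 0 < w.re := hw
    have : w ∈ Complex.slitPlane := Or.inl hw
    exact ((differentiableAt_id.cpow_const this).mul_const _).differentiableWithinAt
  have hconv : IsPreconnected {z : ℂ | 0 < z.re} :=
    (convex_halfSpace_re_gt 0).isPreconnected
  refine (hd.analyticOnNhd hopen).eqOn_of_preconnected_of_frequently_eq (hd2.analyticOnNhd hopen)
    hconv (z₀ := 1) (by simp) ?_ hz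
  have h1 : Filter.Tendsto (fun n : ℕ => (((1 + 1 / ((n:ℝ)+1) : ℝ)) : ℂ)) Filter.atTop (nhdsWithin 1 {1}ᶜ) := by
    rw [tendsto_nhdsWithin_iff]
    constructor
    · have := (tendsto_one_div_add_atTop_nhds_zero_nat (𝕜 := ℝ)).const_add 1
      rw [add_zero] at this
      exact (Complex.continuous_ofReal.tendsto 1).comp this
    · refine Filter.Eventually.of_forall fun n => ?_
      have : (0:ℝ) < 1 / ((n:ℝ)+1) := by positivity
      simp only [mem_compl_iff, mem_singleton_iff]
      intro h
      have : (1 + 1 / ((n:ℝ)+1)) = 1 := by exact_mod_cast h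
      linarith
  refine h1.frequently (Filter.Frequently.of_forall fun n => ?_)
  have hpos : (0:ℝ) < 1 + 1 / ((n:ℝ)+1) := by positivity
  rw [Complex.integral_cpow_mul_exp_neg_mul_Ioi hs hpos, Complex.cpow_neg, one_div, Complex.inv_cpow]
  rw [Complex.arg_ofReal_of_nonneg hpos.le]
  exact Real.pi_pos.ne

lemma gamma_rot {s : ℂ} (hs : 0 < s.re) {ρ δ : ℝ} (hρ : 0 < ρ) (hδ : |δ| < Real.pi / 2) :
    ∫ t in Ioi (0:ℝ), (t:ℂ)^(s-1) * Complex.exp (-(ρ * Complex.exp (δ * Complex.I) * t)) =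
      (ρ:ℂ) ^ (-s) * Complex.exp (-(δ * Complex.I * s)) * Complex.Gamma s := by
  obtain ⟨h1, h2⟩ := abs_lt.1 hδ
  have hre : 0 < ((ρ:ℂ) * Complex.exp (δ * Complex.I)).re := by
    rw [Complex.re_ofReal_mul, Complex.exp_ofReal_mul_I_re]
    exact mul_pos hρ (Real.cos_pos_of_mem_Ioo ⟨h1, h2⟩)
  rw [gamma_cplx hs hre]
  congr 1
  have hne : (ρ:ℂ) ≠ 0 := by exact_mod_cast hρ.ne'
  rw [Complex.cpow_def_of_ne_zero (mul_ne_zero hne (Complex.exp_ne_zero _)),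
    Complex.cpow_def_of_ne_zero hne, Complex.log_ofReal_mul hρ (Complex.exp_ne_zero _),
    Complex.log_exp, ← Complex.exp_add, Complex.ofReal_log hρ.le]
  · ring_nf
  · simp; linarith
  · simp; linarith

noncomputable def kern (β δ φ t r : ℝ) : ℂ :=
  ((r:ℂ)^((β:ℂ)-1) * Complex.exp (-(Complex.exp (δ * Complex.I) * r))) *
    (Complex.exp (φ * Complex.I) * Complex.exp (-(t * (r ^ β : ℝ) * Complex.exp (φ * Complex.I))))

lemma young {β c t : ℝ} (h0 : 0 < β) (h1 : β < 1) (hc : 0 < c) (ht : 0 ≤ t) :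
    ∃ C : ℝ, ∀ r : ℝ, 0 < r → t * r ^ β ≤ c * r + C := by
  set K : ℝ := (t / c ^ β) ^ (1 / (1 - β)) with hK
  have hq : 0 ≤ t / c ^ β := by positivity
  have hK0 : 0 ≤ K := by positivity
  refine ⟨K, fun r hr => ?_⟩
  have h := Real.geom_mean_le_arith_mean2_weighted (w₁ := β) (w₂ := 1 - β) (p₁ := c * r) (p₂ := K)
    h0.le (by linarith) (by positivity) hK0 (by ring)
  have hKp : K ^ (1 - β) = t / c ^ β := by
    rw [hK, ← Real.rpow_mul hq, one_div, inv_mul_cancel₀ (by linarith), Real.rpow_one]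
  rw [hKp, Real.mul_rpow hc.le hr.le] at h
  have hcb : (0:ℝ) < c ^ β := by positivity
  have e : c ^ β * r ^ β * (t / c ^ β) = t * r ^ β := by field_simp
  rw [e] at h
  have := mul_nonneg hc.le hr.le
  nlinarith

lemma norm_expI (φ : ℝ) : ‖Complex.exp (φ * Complex.I)‖ = 1 := Complex.norm_exp_ofReal_mul_I φ

lemma kern_series {β δ φ t : ℝ} (h0 : 0 < β) (h1 : β < 1) (hδ : |δ| < Real.pi / 2) (ht : 0 ≤ t) :
    HasSum (fun n : ℕ => (-(t:ℂ)) ^ n / n.factorial * (Complex.exp ((φ - δ * β : ℝ) * Complex.I * (n + 1)) *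
      Complex.Gamma (β * (n + 1)))) (∫ r in Ioi (0:ℝ), kern β δ φ t r) := by
  have hδ' := abs_lt.1 hδ
  set c := Real.cos δ with hc
  have hc0 : 0 < c := Real.cos_pos_of_mem_Ioo ⟨hδ'.1, hδ'.2⟩
  have hAre : (Complex.exp (δ * Complex.I)).re = c := Complex.exp_ofReal_mul_I_re δ
  have key := hasSum_integral_of_dominated_convergence (μ := volume.restrict (Ioi (0:ℝ)))
    (F := fun (n : ℕ) (r : ℝ) => ((-(t:ℂ)) ^ n / n.factorial * Complex.exp (φ * Complex.I) ^ (n + 1)) *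
      ((r:ℂ) ^ ((β:ℂ) * (n + 1) - 1) * Complex.exp (-(Complex.exp (δ * Complex.I) * r))))
    (f := fun r => kern β δ φ t r)
    (bound := fun (n : ℕ) (r : ℝ) => (r ^ (β - 1) * Real.exp (-(c * r))) * ((t * r ^ β) ^ n / n.factorial))
    (fun n => Measurable.aestronglyMeasurable (by fun_prop)) ?_ ?_ ?_ ?_
  · convert! key using 2 with n
    rw [integral_const_mul]
    have hs : 0 < ((β:ℂ) * (n + 1)).re := by
      have : ((β:ℂ) * (n + 1)) = ((β * (n + 1) : ℝ) : ℂ) := by push_cast; ring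
      rw [this, Complex.ofReal_re]; positivity
    have := gamma_rot hs one_pos hδ
    simp only [Complex.ofReal_one, one_mul, Complex.one_cpow] at this
    have e3 : Complex.exp ((φ - δ * β : ℝ) * Complex.I * (n + 1)) =
        Complex.exp (φ * Complex.I) ^ (n + 1) * Complex.exp (-(δ * Complex.I * (β * (n + 1)))) := by
      rw [← Complex.exp_nat_mul, ← Complex.exp_add]; push_cast; ring_nf
    rw [this, e3]; ring
  · intro n
    filter_upwards [self_mem_ae_restrict measurableSet_Ioi] with r hr
    have hr : 0 < r := hr
    rw [norm_mul, norm_kern _ _ hr, norm_mul, norm_pow, norm_expI, norm_div, norm_pow, norm_neg,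
      Complex.norm_real, Real.norm_of_nonneg ht, Complex.norm_natCast, one_pow, mul_one, hAre]
    have : ((β:ℂ) * (n + 1)).re - 1 = (β - 1) + β * n := by
      have : ((β:ℂ) * (n + 1)) = ((β * (n + 1) : ℝ) : ℂ) := by push_cast; ring
      rw [this, Complex.ofReal_re]; ring
    rw [this, Real.rpow_add hr, Real.rpow_mul hr.le, Real.rpow_natCast, mul_pow]
    apply le_of_eq
    ring
  · refine Filter.Eventually.of_forall fun r => ?_
    exact (Real.summable_pow_div_factorial _).mul_left _
  · obtain ⟨C, hC⟩ := young h0 h1 (half_pos hc0) ht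
    refine Integrable.mono' ((int_real h0 (half_pos hc0)).const_mul (Real.exp C)) ?_ ?_
    · simp_rw [tsum_mul_left]
      have : ∀ x : ℝ, ∑' n : ℕ, x ^ n / n.factorial = Real.exp x := fun x => by
        rw [Real.exp_eq_exp_ℝ, NormedSpace.exp_eq_tsum_div]
      simp_rw [this]
      exact Measurable.aestronglyMeasurable (by fun_prop)
    · filter_upwards [self_mem_ae_restrict measurableSet_Ioi] with r hr
      have hr : 0 < r := hr
      have : ∀ x : ℝ, ∑' n : ℕ, x ^ n / n.factorial = Real.exp x := fun x => by
        rw [Real.exp_eq_exp_ℝ, NormedSpace.exp_eq_tsum_div]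
      rw [tsum_mul_left, this, Real.norm_of_nonneg (by positivity), mul_left_comm (Real.exp C), mul_assoc]
      refine mul_le_mul_of_nonneg_left ?_ (by positivity)
      rw [← Real.exp_add, ← Real.exp_add]
      apply Real.exp_le_exp.2
      have := hC r hr
      linarith
  · filter_upwards [self_mem_ae_restrict measurableSet_Ioi] with r hr
    have hr : 0 < r := hr
    unfold kern
    have hne : (r:ℂ) ≠ 0 := by exact_mod_cast hr.ne'
    have hexp : HasSum (fun n : ℕ => (-(t * (r ^ β : ℝ) * Complex.exp (φ * Complex.I))) ^ n / n.factorial)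
        (Complex.exp (-(t * (r ^ β : ℝ) * Complex.exp (φ * Complex.I)))) := by
      rw [Complex.exp_eq_exp_ℂ]
      exact NormedSpace.expSeries_div_hasSum_exp _
    convert! (hexp.mul_left (Complex.exp (φ * Complex.I))).mul_left
      ((r:ℂ)^((β:ℂ)-1) * Complex.exp (-(Complex.exp (δ * Complex.I) * r))) using 2 with n
    have e1 : (r:ℂ) ^ ((β:ℂ) * (n + 1) - 1) = (r:ℂ) ^ ((β:ℂ) - 1) * ((r ^ β : ℝ) : ℂ) ^ n := by
      rw [Complex.ofReal_cpow hr.le, ← Complex.cpow_mul_nat, ← Complex.cpow_add _ _ hne]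
      ring_nf
    rw [e1]
    have : -(t * ((r ^ β : ℝ):ℂ) * Complex.exp (φ * Complex.I)) =
      (-t) * ((r ^ β : ℝ):ℂ) * Complex.exp (φ * Complex.I) := by ring
    rw [this, mul_pow, mul_pow]
    ring

lemma kern_factor (β δ φ t r : ℝ) (p : ℂ) :
    (t:ℂ)^(-p) * kern β δ φ t r =
      (((r:ℂ)^((β:ℂ)-1) * Complex.exp (-(Complex.exp (δ * Complex.I) * r))) *
        Complex.exp (φ * Complex.I)) *
      ((t:ℂ)^((1 - p) - 1) * Complex.exp (-((r ^ β : ℝ) * Complex.exp (φ * Complex.I) * t))) := by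
  unfold kern
  have e : (1 - p) - 1 = -p := by ring
  have e2 : (t * ((r ^ β : ℝ):ℂ) * Complex.exp (φ * Complex.I)) =
    ((r ^ β : ℝ) * Complex.exp (φ * Complex.I) * t) := by ring
  rw [e, e2]; ring

lemma kern_meas (β δ φ : ℝ) (p : ℂ) :
    Measurable (fun x : ℝ × ℝ => (x.1:ℂ)^(-p) * kern β δ φ x.1 x.2) := by
  unfold kern
  fun_prop

lemma kern_integrable {β δ φ : ℝ} {p : ℂ} (h0 : 0 < β)
    (hδ : |δ| < Real.pi / 2) (hφ : |φ| < Real.pi / 2) (hp0 : 0 < p.re) (hp1 : p.re < 1) :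
    Integrable (fun x : ℝ × ℝ => (x.1:ℂ)^(-p) * kern β δ φ x.1 x.2)
      ((volume.restrict (Ioi (0:ℝ))).prod (volume.restrict (Ioi (0:ℝ)))) := by
  have hδ' := abs_lt.1 hδ
  have hφ' := abs_lt.1 hφ
  have hc0 : 0 < Real.cos δ := Real.cos_pos_of_mem_Ioo ⟨hδ'.1, hδ'.2⟩
  have hd0 : 0 < Real.cos φ := Real.cos_pos_of_mem_Ioo ⟨hφ'.1, hφ'.2⟩
  have hAre : (Complex.exp (δ * Complex.I)).re = Real.cos δ := Complex.exp_ofReal_mul_I_re δ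
  have hre : ∀ r : ℝ, (((r ^ β : ℝ):ℂ) * Complex.exp (φ * Complex.I)).re = r ^ β * Real.cos φ := by
    intro r
    rw [Complex.re_ofReal_mul, Complex.exp_ofReal_mul_I_re]
  have hs : 0 < (1 - p).re := by simp; exact hp1
  rw [integrable_prod_iff' (kern_meas β δ φ p).aestronglyMeasurable]
  constructor
  · filter_upwards [self_mem_ae_restrict measurableSet_Ioi] with r hr
    have hr : 0 < r := hr
    simp only [kern_factor]
    refine Integrable.const_mul (int_cplx hs ?_) _
    rw [hre]; positivity
  · have hI := (int_real (s := β * p.re) (mul_pos h0 hp0) hc0).mul_const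
      ((1 / Real.cos φ) ^ (1 - p).re * Real.Gamma (1 - p).re)
    refine hI.congr ?_
    filter_upwards [self_mem_ae_restrict measurableSet_Ioi] with r hr
    have hr : 0 < r := hr
    simp only [kern_factor]
    simp only [norm_mul (_ * Complex.exp (φ * Complex.I)) _]
    rw [integral_const_mul, norm_mul, norm_expI, mul_one, norm_kern _ _ hr, hAre]
    have : ∫ t in Ioi (0:ℝ), ‖(t:ℂ)^((1 - p) - 1) *
        Complex.exp (-((r ^ β : ℝ) * Complex.exp (φ * Complex.I) * t))‖ =
        (1 / (r ^ β * Real.cos φ)) ^ (1 - p).re * Real.Gamma (1 - p).re := by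
      rw [← Real.integral_rpow_mul_exp_neg_mul_Ioi hs (by positivity)]
      refine setIntegral_congr_fun measurableSet_Ioi fun t ht => ?_
      rw [norm_kern _ _ ht, hre]
    rw [this]
    have e : (1 / (r ^ β * Real.cos φ)) ^ (1 - p).re =
        r ^ (-(β * (1 - p.re))) * (1 / Real.cos φ) ^ (1 - p).re := by
      rw [one_div, mul_inv, Real.mul_rpow (by positivity) (by positivity), one_div,
        Real.inv_rpow (by positivity), ← Real.rpow_mul hr.le, Real.rpow_neg hr.le]
      simp
    have e2 : r ^ (β * p.re - 1) = r ^ ((β:ℂ).re - 1) * r ^ (-(β * (1 - p.re))) := by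
      rw [← Real.rpow_add hr, Complex.ofReal_re]
      ring_nf
    rw [e, e2]; ring

lemma kern_mellin {β δ φ : ℝ} {p : ℂ} (h0 : 0 < β)
    (hδ : |δ| < Real.pi / 2) (hφ : |φ| < Real.pi / 2) (hp0 : 0 < p.re) (hp1 : p.re < 1) :
    ∫ t in Ioi (0:ℝ), (t:ℂ)^(-p) * ∫ r in Ioi (0:ℝ), kern β δ φ t r =
      Complex.Gamma (1 - p) * (Complex.exp ((φ - δ * β : ℝ) * Complex.I * p) * Complex.Gamma (β * p)) := by
  have hs : 0 < (1 - p).re := by simp; exact hp1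
  have hs2 : 0 < ((β:ℂ) * p).re := by simp; positivity
  simp_rw [← integral_const_mul]
  rw [integral_integral_swap (kern_integrable h0 hδ hφ hp0 hp1)]
  have : ∀ r ∈ Ioi (0:ℝ), ∫ t in Ioi (0:ℝ), (t:ℂ)^(-p) * kern β δ φ t r =
      (Complex.Gamma (1 - p) * Complex.exp (φ * Complex.I * p)) *
      ((r:ℂ)^((β:ℂ) * p -1) * Complex.exp (-(((1:ℝ):ℂ) * Complex.exp (δ * Complex.I) * r))) := by
    intro r hr
    have hr : 0 < r := hr
    have hne : (r:ℂ) ≠ 0 := by exact_mod_cast hr.ne'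
    simp only [kern_factor]
    rw [integral_const_mul, gamma_rot hs (Real.rpow_pos_of_pos hr β) hφ]
    have e1 : ((r ^ β : ℝ):ℂ) ^ (-(1 - p)) = (r:ℂ) ^ (-(β * (1 - p))) := by
      rw [Complex.cpow_def_of_ne_zero hne, Complex.cpow_def_of_ne_zero
        (by exact_mod_cast (Real.rpow_pos_of_pos hr β).ne'), ← Complex.ofReal_log hr.le,
        ← Complex.ofReal_log (Real.rpow_pos_of_pos hr β).le, Real.log_rpow hr]
      push_cast; ring_nf
    have e2 : (r:ℂ)^((β:ℂ) * p -1) = (r:ℂ)^((β:ℂ)-1) * (r:ℂ) ^ (-(β * (1 - p))) := by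
      rw [← Complex.cpow_add _ _ hne]; ring_nf
    have e3 : Complex.exp (φ * Complex.I * p) =
        Complex.exp (φ * Complex.I) * Complex.exp (-(φ * Complex.I * (1 - p))) := by
      rw [← Complex.exp_add]; ring_nf
    rw [e1, e2, e3, Complex.ofReal_one, one_mul]; ring
  rw [setIntegral_congr_fun measurableSet_Ioi this, integral_const_mul, gamma_rot hs2 one_pos hδ]
  have e3 : Complex.exp ((φ - δ * β : ℝ) * Complex.I * p) =
        Complex.exp (φ * Complex.I * p) * Complex.exp (-(δ * Complex.I * (β * p))) := by
      rw [← Complex.exp_add]; push_cast; ring_nf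
  rw [e3, Complex.ofReal_one, Complex.one_cpow]; ring

lemma refl_formula {z : ℂ} (hz : 0 < z.re) :
    (Complex.Gamma (1 - z))⁻¹ = Complex.Gamma z *
      (Complex.exp (Real.pi * Complex.I * z) - Complex.exp (-(Real.pi * Complex.I * z))) / (2 * Real.pi * Complex.I) := by
  have h := Complex.Gamma_mul_Gamma_one_sub z
  have hG := Complex.Gamma_ne_zero_of_re_pos hz
  have hpi : (Real.pi : ℂ) ≠ 0 := by exact_mod_cast Real.pi_ne_zero
  have hI := Complex.I_ne_zero
  have hsin : (Complex.exp (Real.pi * Complex.I * z) - Complex.exp (-(Real.pi * Complex.I * z))) / (2 * Real.pi * Complex.I)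
      = Complex.sin (Real.pi * z) / Real.pi := by
    rw [Complex.sin]
    have e1 : (Real.pi * Complex.I * z) = Real.pi * z * Complex.I := by ring
    have e2 : -((Real.pi:ℂ) * z * Complex.I) = -(Real.pi * z) * Complex.I := by ring
    rw [e1, e2]
    field_simp
    rw [Complex.I_sq]; ring
  rw [mul_div_assoc, hsin]
  by_cases hs : Complex.sin (Real.pi * z) = 0
  · rw [hs, div_zero] at h
    have : Complex.Gamma (1 - z) = 0 := (mul_eq_zero.1 h).resolve_left hG
    rw [this, hs]; simp
  · have h1 : Complex.Gamma (1 - z) ≠ 0 := by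
      intro h0
      rw [h0, mul_zero] at h
      exact div_ne_zero hpi hs h.symm
    rw [eq_div_iff hs] at h
    rw [eq_comm, ← mul_div_assoc, div_eq_iff hpi, inv_mul_eq_div, eq_div_iff h1]
    linear_combination h

lemma MWright_repr {β t : ℝ} (h0 : 0 < β) (h1 : β < 1) (ht : 0 ≤ t) {φ : ℝ}
    (hφ : φ * (1 + β) = Real.pi * β) (hφ2 : |φ| < Real.pi / 2) :
    (MWright β t : ℂ) = ((∫ r in Ioi (0:ℝ), kern β (-φ) φ t r) -
      ∫ r in Ioi (0:ℝ), kern β φ (-φ) t r) / (2 * Real.pi * Complex.I) := by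
  have ha := kern_series (φ := φ) (δ := -φ) h0 h1 (by rwa [abs_neg]) ht
  have hb := kern_series (φ := -φ) (δ := φ) h0 h1 hφ2 ht
  have hs := (ha.sub hb).div_const (2 * Real.pi * Complex.I)
  rw [← hs.tsum_eq, MWright, Complex.ofReal_tsum]
  congr 1
  funext n
  have e1 : φ - -φ * β = Real.pi * β := by linarith
  have e2 : -φ - φ * β = -(Real.pi * β) := by linarith
  have hz : 0 < ((β:ℂ) * (n + 1)).re := by
    have : ((β:ℂ) * (n + 1)) = ((β * (n + 1) : ℝ) : ℂ) := by push_cast; ring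
    rw [this, Complex.ofReal_re]; positivity
  have hr := refl_formula hz
  have e3 : (1:ℂ) - β * (n + 1) = -β * n + 1 - β := by ring
  rw [e3] at hr
  rw [e1, e2]
  push_cast [← Complex.Gamma_ofReal]
  rw [div_eq_mul_inv, mul_inv, hr]
  have e4 : (Real.pi:ℂ) * β * Complex.I * (n + 1) = Real.pi * Complex.I * (β * (n + 1)) := by ring
  have e5 : -((Real.pi:ℂ) * β) * Complex.I * (n + 1) = -(Real.pi * Complex.I * (β * (n + 1))) := by ring
  rw [e4, e5]
  ring

lemma exists_phi {β : ℝ} (h0 : 0 < β) (h1 : β < 1) :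
    ∃ φ : ℝ, φ * (1 + β) = Real.pi * β ∧ |φ| < Real.pi / 2 := by
  refine ⟨Real.pi * β / (1 + β), by field_simp, ?_⟩
  have := Real.pi_pos
  rw [abs_of_pos (by positivity), div_lt_div_iff₀ (by linarith) (by norm_num)]
  nlinarith

lemma MWright_mellin {β : ℝ} (h0 : 0 < β) (h1 : β < 1) {p : ℂ} (hp0 : 0 < p.re) (hp1 : p.re < 1) :
    IntegrableOn (fun t : ℝ => (t:ℂ)^(-p) * (MWright β t : ℂ)) (Ioi 0) ∧
    ∫ t in Ioi (0:ℝ), (t:ℂ)^(-p) * (MWright β t : ℂ) =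
      Complex.Gamma (1 - p) / Complex.Gamma (1 - β * p) := by
  obtain ⟨φ, hφ, hφ2⟩ := exists_phi h0 h1
  have hφ3 : |(-φ)| < Real.pi / 2 := by rwa [abs_neg]
  have ia := (kern_integrable h0 hφ3 hφ2 hp0 hp1).integral_prod_left
  have ib := (kern_integrable h0 hφ2 hφ3 hp0 hp1).integral_prod_left
  have ma := kern_mellin h0 hφ3 hφ2 hp0 hp1
  have mb := kern_mellin h0 hφ2 hφ3 hp0 hp1
  simp only [integral_const_mul] at ia ib
  have hc : ∀ t ∈ Ioi (0:ℝ), ((t:ℂ)^(-p) * (∫ r in Ioi (0:ℝ), kern β (-φ) φ t r) -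
      (t:ℂ)^(-p) * ∫ r in Ioi (0:ℝ), kern β φ (-φ) t r) / (2 * Real.pi * Complex.I) =
      (t:ℂ)^(-p) * (MWright β t : ℂ) := by
    intro t ht
    rw [MWright_repr h0 h1 (le_of_lt ht) hφ hφ2]; ring
  constructor
  · exact IntegrableOn.congr_fun ((ia.sub ib).div_const _) hc measurableSet_Ioi
  · rw [← setIntegral_congr_fun measurableSet_Ioi hc, integral_div, integral_sub ia ib, ma, mb]
    have e1 : φ - -φ * β = Real.pi * β := by linarith
    have e2 : -φ - φ * β = -(Real.pi * β) := by linarith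
    have hz : 0 < ((β:ℂ) * p).re := by simp; positivity
    rw [div_eq_mul_inv (Complex.Gamma (1 - p)), refl_formula hz, e1, e2]
    push_cast
    have e4 : (Real.pi:ℂ) * β * Complex.I * p = Real.pi * Complex.I * (β * p) := by ring
    have e5 : -((Real.pi:ℂ) * β) * Complex.I * p = -(Real.pi * Complex.I * (β * p)) := by ring
    rw [e4, e5]
    ring

lemma MWright_mellin_real {β : ℝ} (h0 : 0 < β) (h1 : β < 1) {p : ℝ} (hp0 : 0 < p) (hp1 : p < 1) :
    IntegrableOn (fun t : ℝ => t^(-p) * MWright β t) (Ioi 0) ∧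
    ∫ t in Ioi (0:ℝ), t^(-p) * MWright β t = Real.Gamma (1 - p) / Real.Gamma (1 - β * p) := by
  obtain ⟨hi, he⟩ := MWright_mellin h0 h1 (p := (p:ℂ)) (by simpa) (by simpa)
  have hc : ∀ t ∈ Ioi (0:ℝ), (t:ℂ)^(-(p:ℂ)) * (MWright β t : ℂ) = ((t^(-p) * MWright β t : ℝ) : ℂ) := by
    intro t ht
    rw [Complex.ofReal_mul, Complex.ofReal_cpow (le_of_lt ht)]
    push_cast; rfl
  constructor
  · have := IntegrableOn.congr_fun hi hc measurableSet_Ioi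
    have h2 := Integrable.re this
    rw [IntegrableOn]
    simpa using h2
  · rw [setIntegral_congr_fun measurableSet_Ioi hc, integral_complex_ofReal] at he
    have e : (1:ℂ) - β * p = ((1 - β * p : ℝ):ℂ) := by push_cast; rfl
    have e' : (1:ℂ) - p = ((1 - p : ℝ):ℂ) := by push_cast; rfl
    rw [e, e', Complex.Gamma_ofReal, Complex.Gamma_ofReal] at he
    exact_mod_cast he

lemma MWright_aemeas {β : ℝ} (h0 : 0 < β) (h1 : β < 1) :
    AEMeasurable (MWright β) (volume.restrict (Ioi (0:ℝ))) := by
  have h := (MWright_mellin_real h0 h1 (p := 1/2) (by norm_num) (by norm_num)).1.aemeasurable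
  have h2 : AEMeasurable (fun t : ℝ => t^(1/2:ℝ)) (volume.restrict (Ioi (0:ℝ))) :=
    Measurable.aemeasurable (by fun_prop)
  refine (h2.mul h).congr ?_
  filter_upwards [self_mem_ae_restrict measurableSet_Ioi] with t ht
  have ht : 0 < t := ht
  simp only [Pi.mul_apply]
  rw [← mul_assoc, ← Real.rpow_add ht]; simp

lemma rpow_bounds {t p : ℝ} (ht : 0 < t) (hp0 : 0 < p) (hp1 : p ≤ 1/2) :
    t ^ (-p) ≤ 1 + t ^ (-(1/2:ℝ)) ∧ min 1 (t ^ (-(1/2:ℝ))) ≤ t ^ (-p) := by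
  have hpos : 0 < t ^ (-(1/2:ℝ)) := by positivity
  rcases le_total t 1 with h | h
  · have a : t ^ (-p) ≤ t ^ (-(1/2:ℝ)) := Real.rpow_le_rpow_of_exponent_ge ht h (by linarith)
    have b : 1 ≤ t ^ (-p) := Real.one_le_rpow_of_pos_of_le_one_of_nonpos ht h (by linarith)
    exact ⟨by linarith, (min_le_left _ _).trans b⟩
  · have a : t ^ (-(1/2:ℝ)) ≤ t ^ (-p) := Real.rpow_le_rpow_of_exponent_le h (by linarith)
    have b : t ^ (-p) ≤ 1 := Real.rpow_le_one_of_one_le_of_nonpos h (by linarith)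
    exact ⟨by linarith, (min_le_right _ _).trans a⟩

lemma MWright_nonneg {β : ℝ} (h0 : 0 < β) (h1 : β < 1)
    (hprob : ∫⁻ t in Ioi (0:ℝ), ENNReal.ofReal (MWright β t) = 1) :
    ∀ᵐ t ∂(volume.restrict (Ioi (0:ℝ))), 0 ≤ MWright β t := by
  set ν := volume.restrict (Ioi (0:ℝ)) with hν
  have hm := MWright_aemeas h0 h1
  set P : ℝ → ℝ := fun t => max (MWright β t) 0 with hP
  have hPm : AEMeasurable P ν := hm.max aemeasurable_const
  have hP0 : ∀ t, 0 ≤ P t := fun t => le_max_right _ _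
  have hofP : ∀ t, ENNReal.ofReal (P t) = ENNReal.ofReal (MWright β t) := by
    intro t
    simp only [hP]
    rcases le_total (MWright β t) 0 with h | h
    · rw [max_eq_right h, ENNReal.ofReal_of_nonpos h, ENNReal.ofReal_zero]
    · rw [max_eq_left h]
  have hPint : Integrable P ν := by
    refine ⟨hPm.aestronglyMeasurable, ?_⟩
    rw [hasFiniteIntegral_iff_ofReal (Filter.Eventually.of_forall hP0)]
    simp_rw [hofP]
    rw [hprob]; exact ENNReal.one_lt_top
  have hP1 : ∫ t, P t ∂ν = 1 := by
    rw [integral_eq_lintegral_of_nonneg_ae (Filter.Eventually.of_forall hP0) hPm.aestronglyMeasurable]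
    simp_rw [hofP]
    rw [hprob]; simp
  set q : ℕ → ℝ := fun n => 1 / ((n:ℝ) + 1) / 2 with hq
  have hq0 : ∀ n, 0 < q n := fun n => by simp only [hq]; positivity
  have hq1 : ∀ n, q n ≤ 1 / 2 := fun n => by
    simp only [hq]
    have : 1 / ((n:ℝ) + 1) ≤ 1 := by
      rw [div_le_one (by positivity)]; linarith [Nat.cast_nonneg (α := ℝ) n]
    linarith
  have hqt : Filter.Tendsto q Filter.atTop (nhds 0) := by
    have h := (tendsto_one_div_add_atTop_nhds_zero_nat (𝕜 := ℝ)).div_const 2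
    rw [zero_div] at h
    exact h
  have hMi : ∀ n, Integrable (fun t => t ^ (-(q n)) * MWright β t) ν := fun n =>
    (MWright_mellin_real h0 h1 (hq0 n) (by linarith [hq1 n])).1
  have hPi : ∀ p : ℝ, 0 < p → p < 1 → Integrable (fun t => t ^ (-p) * P t) ν := fun p hp hp1 => by
    refine ((MWright_mellin_real h0 h1 hp hp1).1.pos_part).congr ?_
    filter_upwards [self_mem_ae_restrict measurableSet_Ioi] with t ht
    have ht : 0 < t := ht
    simp only [hP]
    rw [mul_max_of_nonneg _ _ (by positivity), mul_zero]
  have hlim1 : Filter.Tendsto (fun n => ∫ t, t ^ (-(q n)) * P t ∂ν) Filter.atTop (nhds (∫ t, P t ∂ν)) := by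
    refine tendsto_integral_of_dominated_convergence (fun t => (1 + t ^ (-(1/2:ℝ))) * P t)
      (fun n => (hPi _ (hq0 n) (by linarith [hq1 n])).aestronglyMeasurable) ?_ ?_ ?_
    · have := hPint.add (hPi (1/2) (by norm_num) (by norm_num))
      refine this.congr (Filter.Eventually.of_forall fun t => ?_)
      simp only [Pi.add_apply]; ring
    · intro n
      filter_upwards [self_mem_ae_restrict measurableSet_Ioi] with t ht
      have ht : 0 < t := ht
      have := hP0 t
      rw [Real.norm_of_nonneg (by positivity)]
      exact mul_le_mul_of_nonneg_right (rpow_bounds ht (hq0 n) (hq1 n)).1 this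
    · filter_upwards [self_mem_ae_restrict measurableSet_Ioi] with t ht
      have ht : 0 < t := ht
      have hc : ContinuousAt (fun p : ℝ => t ^ (-p)) 0 :=
        (Real.continuousAt_const_rpow ht.ne').comp continuousAt_neg
      have := (hc.tendsto.comp hqt).mul_const (P t)
      simpa using this
  have hGc : ContinuousAt Real.Gamma 1 := by
    refine (Real.differentiableAt_Gamma fun m => ?_).continuousAt
    have : (0:ℝ) ≤ m := Nat.cast_nonneg m
    linarith
  have hlim2 : Filter.Tendsto (fun n => ∫ t, t ^ (-(q n)) * MWright β t ∂ν) Filter.atTop (nhds 1) := by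
    have e : (fun n => ∫ t, t ^ (-(q n)) * MWright β t ∂ν) =
        fun n => Real.Gamma (1 - q n) / Real.Gamma (1 - β * q n) := by
      funext n
      exact (MWright_mellin_real h0 h1 (hq0 n) (by linarith [hq1 n])).2
    rw [e]
    have a : Filter.Tendsto (fun n => 1 - q n) Filter.atTop (nhds 1) := by
      simpa using hqt.const_sub 1
    have b : Filter.Tendsto (fun n => 1 - β * q n) Filter.atTop (nhds 1) := by
      simpa using (hqt.const_mul β).const_sub 1
    have := (hGc.tendsto.comp a).div (hGc.tendsto.comp b) (by simp)
    rw [Real.Gamma_one, div_one] at this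
    exact this
  have hlim : Filter.Tendsto (fun n => ∫ t, t ^ (-(q n)) * (P t - MWright β t) ∂ν) Filter.atTop (nhds 0) := by
    have := hlim1.sub hlim2
    rw [hP1, sub_self] at this
    refine this.congr fun n => ?_
    rw [← integral_sub (hPi _ (hq0 n) (by linarith [hq1 n])) (hMi n)]
    simp_rw [mul_sub]
  set N : ℝ → ℝ := fun t => P t - MWright β t with hN
  have hN0 : ∀ t, 0 ≤ N t := fun t => sub_nonneg.2 (le_max_left _ _)
  have hNi : ∀ n, Integrable (fun t => t ^ (-(q n)) * N t) ν := fun n => by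
    refine ((hPi _ (hq0 n) (by linarith [hq1 n])).sub (hMi n)).congr
      (Filter.Eventually.of_forall fun t => ?_)
    simp only [Pi.sub_apply, hN]; ring
  have hdom : ∀ n, ∀ᵐ t ∂ν, min 1 (t ^ (-(1/2:ℝ))) * N t ≤ t ^ (-(q n)) * N t := by
    intro n
    filter_upwards [self_mem_ae_restrict measurableSet_Ioi] with t ht
    exact mul_le_mul_of_nonneg_right (rpow_bounds ht (hq0 n) (hq1 n)).2 (hN0 t)
  have hnn : ∀ᵐ t ∂ν, 0 ≤ min 1 (t ^ (-(1/2:ℝ))) * N t := by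
    filter_upwards [self_mem_ae_restrict measurableSet_Ioi] with t ht
    have ht : 0 < t := ht
    have := hN0 t
    positivity
  have hwi : Integrable (fun t => min 1 (t ^ (-(1/2:ℝ))) * N t) ν := by
    refine Integrable.mono' (hNi 0) ?_ ?_
    · have h2 : AEMeasurable (fun t : ℝ => min 1 (t^(-(1/2:ℝ)))) ν :=
        Measurable.aemeasurable (by fun_prop)
      exact (h2.mul (hPm.sub hm)).aestronglyMeasurable
    · filter_upwards [hdom 0, hnn] with t ht ht2
      rw [Real.norm_of_nonneg ht2]; exact ht
  have hle : ∫ t, min 1 (t ^ (-(1/2:ℝ))) * N t ∂ν ≤ 0 :=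
    ge_of_tendsto' hlim fun n => integral_mono_ae hwi (hNi n) (hdom n)
  have hz := (integral_eq_zero_iff_of_nonneg_ae hnn hwi).1 (le_antisymm hle (integral_nonneg_of_ae hnn))
  filter_upwards [hz, self_mem_ae_restrict measurableSet_Ioi] with t h ht
  have ht : 0 < t := ht
  have hpos : 0 < min 1 (t ^ (-(1/2:ℝ))) := by positivity
  have hNz : N t = 0 := (mul_eq_zero.1 h).resolve_left hpos.ne'
  have := hP0 t
  simp only [hN] at hNz
  linarith

lemma ext_of_mellin {ν₁ ν₂ : Measure ℝ} [IsFiniteMeasure ν₁] [IsFiniteMeasure ν₂]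
    (hp₁ : ∀ᵐ x ∂ν₁, 0 < x) (hp₂ : ∀ᵐ x ∂ν₂, 0 < x)
    (hi₁ : Integrable (fun x : ℝ => (x:ℂ) ^ (-(1/2:ℂ))) ν₁)
    (hi₂ : Integrable (fun x : ℝ => (x:ℂ) ^ (-(1/2:ℂ))) ν₂)
    (heq : ∀ p : ℂ, p.re = 1/2 → ∫ x : ℝ, (x:ℂ) ^ (-p) ∂ν₁ = ∫ x : ℝ, (x:ℂ) ^ (-p) ∂ν₂) :
    ν₁ = ν₂ := by
  set w : ℝ → ENNReal := fun x => ENNReal.ofReal (x ^ (-(1/2:ℝ))) with hw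
  have hwm : Measurable w := by simp only [hw]; fun_prop
  have hfin : ∀ ν : Measure ℝ, (∀ᵐ x ∂ν, 0 < x) → Integrable (fun x : ℝ => (x:ℂ) ^ (-(1/2:ℂ))) ν →
      IsFiniteMeasure (ν.withDensity w) := by
    intro ν hp hi
    refine isFiniteMeasure_withDensity_ofReal (Integrable.hasFiniteIntegral ?_)
    refine hi.norm.congr ?_
    filter_upwards [hp] with x hx
    rw [Complex.norm_cpow_eq_rpow_re_of_pos hx]; simp
  have hchar : ∀ ν : Measure ℝ, (∀ᵐ x ∂ν, 0 < x) → ∀ s : ℝ,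
      charFun ((ν.withDensity w).map Real.log) s = ∫ x : ℝ, (x:ℂ) ^ (-(1/2 - s * Complex.I)) ∂ν := by
    intro ν hp s
    rw [charFun_apply_real, integral_map Real.measurable_log.aemeasurable
      (Measurable.aestronglyMeasurable (by fun_prop)),
      integral_withDensity_eq_integral_toReal_smul hwm
      (Filter.Eventually.of_forall fun x => ENNReal.ofReal_lt_top)]
    refine integral_congr_ae ?_
    filter_upwards [hp] with x hx
    have hne : (x:ℂ) ≠ 0 := by exact_mod_cast hx.ne'
    simp only [hw]
    rw [ENNReal.toReal_ofReal (by positivity), Complex.real_smul, Complex.ofReal_cpow hx.le,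
      Complex.cpow_def_of_ne_zero hne, Complex.cpow_def_of_ne_zero hne, ← Complex.ofReal_log hx.le,
      ← Complex.exp_add]
    push_cast
    ring_nf
  have hback : ∀ ν : Measure ℝ, (∀ᵐ x ∂ν, 0 < x) →
      (((ν.withDensity w).map Real.log).map Real.exp).withDensity (fun x => (w x)⁻¹) = ν := by
    intro ν hp
    rw [Measure.map_map Real.measurable_exp Real.measurable_log]
    have : (Real.exp ∘ Real.log) =ᵐ[ν.withDensity w] id := by
      have := (withDensity_absolutelyContinuous ν w).ae_le hp
      filter_upwards [this] with x hx
      exact Real.exp_log hx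
    rw [Measure.map_congr this, Measure.map_id]
    refine withDensity_inv_same hwm ?_ ?_
    · filter_upwards [hp] with x hx
      have : 0 < x ^ (-(1/2:ℝ)) := by positivity
      simpa [hw] using this
    · exact Filter.Eventually.of_forall fun x => ENNReal.ofReal_ne_top
  have := hfin ν₁ hp₁ hi₁
  have := hfin ν₂ hp₂ hi₂
  have hE : (ν₁.withDensity w).map Real.log = (ν₂.withDensity w).map Real.log := by
    refine Measure.ext_of_charFun ?_
    funext s
    rw [hchar ν₁ hp₁, hchar ν₂ hp₂]
    exact heq _ (by simp)
  rw [← hback ν₁ hp₁, hE, hback ν₂ hp₂]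

lemma exp_law_moment {q : ℂ} (hq : q.re < 1) :
    Integrable (fun x : ℝ => (x:ℂ) ^ (-q)) ((volume.restrict (Ioi (0 : ℝ))).withDensity
        (fun x => ENNReal.ofReal (Real.exp (-x)))) ∧
    ∫ x : ℝ, (x:ℂ) ^ (-q) ∂((volume.restrict (Ioi (0 : ℝ))).withDensity
        (fun x => ENNReal.ofReal (Real.exp (-x)))) = Complex.Gamma (1 - q) := by
  have hs : 0 < (1 - q).re := by simp; exact hq
  have h1 : (0:ℝ) < (1:ℂ).re := by simp
  have hm : Measurable (fun x : ℝ => ENNReal.ofReal (Real.exp (-x))) := by fun_prop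
  have hf : ∀ x : ℝ, (ENNReal.ofReal (Real.exp (-x))).toReal • (x:ℂ) ^ (-q) =
      (x:ℂ) ^ ((1 - q) - 1) * Complex.exp (-(1 * x)) := by
    intro x
    rw [ENNReal.toReal_ofReal (Real.exp_pos _).le, Complex.real_smul, mul_comm]
    have : (1 - q) - 1 = -q := by ring
    rw [this, one_mul]
    push_cast; rfl
  constructor
  · rw [integrable_withDensity_iff_integrable_smul₀' hm.aemeasurable
      (Filter.Eventually.of_forall fun x => ENNReal.ofReal_lt_top)]
    simp_rw [hf]
    exact int_cplx hs h1
  · rw [integral_withDensity_eq_integral_toReal_smul hm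
      (Filter.Eventually.of_forall fun x => ENNReal.ofReal_lt_top)]
    simp_rw [hf]
    rw [gamma_cplx hs h1, Complex.one_cpow, one_mul]

lemma MWright_law_moment {β : ℝ} (h0 : 0 < β) (h1 : β < 1)
    (hprob : ∫⁻ t in Ioi (0:ℝ), ENNReal.ofReal (MWright β t) = 1)
    {p : ℂ} (hp0 : 0 < p.re) (hp1 : p.re < 1) :
    Integrable (fun x : ℝ => (x:ℂ) ^ (-p)) ((volume.restrict (Ioi (0 : ℝ))).withDensity
        (fun x => ENNReal.ofReal (MWright β x))) ∧
    ∫ x : ℝ, (x:ℂ) ^ (-p) ∂((volume.restrict (Ioi (0 : ℝ))).withDensity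
        (fun x => ENNReal.ofReal (MWright β x))) = Complex.Gamma (1 - p) / Complex.Gamma (1 - β * p) := by
  obtain ⟨hi, he⟩ := MWright_mellin h0 h1 hp0 hp1
  have hm : AEMeasurable (fun x : ℝ => ENNReal.ofReal (MWright β x)) (volume.restrict (Ioi (0:ℝ))) :=
    (MWright_aemeas h0 h1).ennreal_ofReal
  have hf : (fun t : ℝ => (t:ℂ)^(-p) * (MWright β t : ℂ)) =ᵐ[volume.restrict (Ioi (0:ℝ))]
      fun x : ℝ => (ENNReal.ofReal (MWright β x)).toReal • (x:ℂ) ^ (-p) := by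
    filter_upwards [MWright_nonneg h0 h1 hprob] with x hx
    rw [ENNReal.toReal_ofReal hx, Complex.real_smul, mul_comm]
  constructor
  · rw [integrable_withDensity_iff_integrable_smul₀' hm
      (Filter.Eventually.of_forall fun x => ENNReal.ofReal_lt_top)]
    exact Integrable.congr hi hf
  · rw [integral_withDensity_eq_integral_toReal_smul₀ hm
      (Filter.Eventually.of_forall fun x => ENNReal.ofReal_lt_top), ← integral_congr_ae hf, he]

lemma ae_pos_withDensity (f : ℝ → ENNReal) :
    ∀ᵐ x ∂((volume.restrict (Ioi (0 : ℝ))).withDensity f), 0 < x :=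
  (withDensity_absolutelyContinuous _ f).ae_le (self_mem_ae_restrict measurableSet_Ioi)

theorem exponential_mult_self_decomposition
    {Ω : Type*} [MeasurableSpace Ω] (μ : Measure Ω) [IsProbabilityMeasure μ]
    (β : ℝ) (hβ0 : 0 < β) (hβ1 : β < 1)
    (Y₀ Yβ : Ω → ℝ) (hY₀ : Measurable Y₀) (hYβ : Measurable Yβ)
    (hindep : ProbabilityTheory.IndepFun Y₀ Yβ μ)
    (hlaw₀ : μ.map Y₀ =
      (volume.restrict (Ioi (0 : ℝ))).withDensity
        (fun x => ENNReal.ofReal (Real.exp (-x))))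
    (hlawβ : μ.map Yβ =
      (volume.restrict (Ioi (0 : ℝ))).withDensity
        (fun t => ENNReal.ofReal (MWright β t))) :
    μ.map Y₀ = μ.map (fun ω => Y₀ ω ^ β * Yβ ω) := by
  have hXm : Measurable (fun ω => Y₀ ω ^ β * Yβ ω) := by fun_prop
  have hprob : ∫⁻ t in Ioi (0:ℝ), ENNReal.ofReal (MWright β t) = 1 := by
    have h : (μ.map Yβ) univ = 1 := by
      rw [Measure.map_apply hYβ MeasurableSet.univ]; simp
    rw [hlawβ, withDensity_apply _ MeasurableSet.univ, Measure.restrict_univ] at h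
    exact h
  have hpos0 : ∀ᵐ x ∂(μ.map Y₀), 0 < x := by rw [hlaw₀]; exact ae_pos_withDensity _
  have hposβ : ∀ᵐ x ∂(μ.map Yβ), 0 < x := by rw [hlawβ]; exact ae_pos_withDensity _
  have hpos0' : ∀ᵐ ω ∂μ, 0 < Y₀ ω := ae_of_ae_map hY₀.aemeasurable hpos0
  have hposβ' : ∀ᵐ ω ∂μ, 0 < Yβ ω := ae_of_ae_map hYβ.aemeasurable hposβ
  have hmeas : ∀ p : ℂ, Measurable (fun x : ℝ => (x:ℂ) ^ (-p)) := fun p => by fun_prop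
  have hmom0 : ∀ q : ℂ, q.re < 1 → Integrable (fun ω => (Y₀ ω : ℂ) ^ (-q)) μ ∧
      ∫ ω, (Y₀ ω : ℂ) ^ (-q) ∂μ = Complex.Gamma (1 - q) := by
    intro q hq
    have h := exp_law_moment hq
    rw [← hlaw₀, integrable_map_measure (hmeas q).aestronglyMeasurable hY₀.aemeasurable,
      integral_map hY₀.aemeasurable (hmeas q).aestronglyMeasurable] at h
    exact h
  have hmomβ : ∀ p : ℂ, 0 < p.re → p.re < 1 → Integrable (fun ω => (Yβ ω : ℂ) ^ (-p)) μ ∧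
      ∫ ω, (Yβ ω : ℂ) ^ (-p) ∂μ = Complex.Gamma (1 - p) / Complex.Gamma (1 - β * p) := by
    intro p hp hp1
    have h := MWright_law_moment hβ0 hβ1 hprob hp hp1
    rw [← hlawβ, integrable_map_measure (hmeas p).aestronglyMeasurable hYβ.aemeasurable,
      integral_map hYβ.aemeasurable (hmeas p).aestronglyMeasurable] at h
    exact h
  have hfac : ∀ p : ℂ, (fun ω => (Y₀ ω : ℂ) ^ (-(β * p)) * (Yβ ω : ℂ) ^ (-p)) =ᵐ[μ]
      fun ω => ((Y₀ ω ^ β * Yβ ω : ℝ) : ℂ) ^ (-p) := by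
    intro p
    filter_upwards [hpos0', hposβ'] with ω h1 h2
    have h3 : 0 < Y₀ ω ^ β := Real.rpow_pos_of_pos h1 β
    have n1 : (Y₀ ω : ℂ) ≠ 0 := by exact_mod_cast h1.ne'
    have n2 : (Yβ ω : ℂ) ≠ 0 := by exact_mod_cast h2.ne'
    have n3 : ((Y₀ ω ^ β * Yβ ω : ℝ) : ℂ) ≠ 0 := by exact_mod_cast (mul_pos h3 h2).ne'
    rw [Complex.cpow_def_of_ne_zero n1, Complex.cpow_def_of_ne_zero n2,
      Complex.cpow_def_of_ne_zero n3, ← Complex.ofReal_log h1.le, ← Complex.ofReal_log h2.le,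
      ← Complex.ofReal_log (mul_pos h3 h2).le, Real.log_mul h3.ne' h2.ne', Real.log_rpow h1,
      ← Complex.exp_add]
    push_cast
    ring_nf
  have hind : ∀ p : ℂ, ProbabilityTheory.IndepFun (fun ω => (Y₀ ω : ℂ) ^ (-(β * p)))
      (fun ω => (Yβ ω : ℂ) ^ (-p)) μ := fun p => hindep.comp (hmeas (β * p)) (hmeas p)
  have hre : ∀ p : ℂ, p.re = 1/2 → ((β:ℂ) * p).re < 1 := by
    intro p hp
    rw [Complex.re_ofReal_mul, hp]; linarith
  have hprob0 : IsProbabilityMeasure (μ.map Y₀) := Measure.isProbabilityMeasure_map hY₀.aemeasurable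
  have hprobX : IsProbabilityMeasure (μ.map (fun ω => Y₀ ω ^ β * Yβ ω)) :=
    Measure.isProbabilityMeasure_map hXm.aemeasurable
  refine ext_of_mellin hpos0 ?_ ?_ ?_ ?_
  · rw [ae_map_iff hXm.aemeasurable measurableSet_Ioi]
    filter_upwards [hpos0', hposβ'] with ω h1 h2
    positivity
  · rw [integrable_map_measure (hmeas _).aestronglyMeasurable hY₀.aemeasurable]
    exact (hmom0 (1/2) (by norm_num)).1
  · rw [integrable_map_measure (hmeas _).aestronglyMeasurable hXm.aemeasurable]
    refine Integrable.congr ((hind (1/2)).integrable_mul (hmom0 _ (hre _ (by norm_num))).1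
      (hmomβ _ (by norm_num) (by norm_num)).1) (hfac (1/2))
  · intro p hp
    rw [integral_map hY₀.aemeasurable (hmeas p).aestronglyMeasurable,
      integral_map hXm.aemeasurable (hmeas p).aestronglyMeasurable, ← integral_congr_ae (hfac p),
      (hind p).integral_fun_mul_eq_mul_integral
        (hmom0 _ (hre p hp)).1.aestronglyMeasurable
        (hmomβ p (by rw [hp]; norm_num) (by rw [hp]; norm_num)).1.aestronglyMeasurable,
      (hmom0 p (by rw [hp]; norm_num)).2, (hmom0 _ (hre p hp)).2,
      (hmomβ p (by rw [hp]; norm_num) (by rw [hp]; norm_num)).2]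
    have hne : Complex.Gamma (1 - β * p) ≠ 0 := by
      refine Complex.Gamma_ne_zero_of_re_pos ?_
      rw [Complex.sub_re, Complex.one_re]
      linarith [hre p hp]
    rw [mul_comm, div_mul_cancel₀ _ hne]
end

section
/- Let 0 < β < 1 and let Y be a positive random variable with continuous density ρ on (0,∞) and finite Mellin transform on Re(z) > 0. If Y has the same distribution as Y^β · Y_β, where Y_β is an independent random variable with M-Wright density M_β, then Y is exponentially distributed with rate 1. -/
open MeasureTheory Set

lemma re_exp_pos {l : ℂ} (hl : |l.im| < Real.pi / 2) : 0 < (Complex.exp l).re := by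
  rw [Complex.exp_re]
  have := Real.cos_pos_of_mem_Ioo (abs_lt.mp hl)
  positivity

lemma intOn_rpow_exp {a c : ℝ} (ha : 0 < a) (hc : 0 < c) :
    IntegrableOn (fun t : ℝ => t ^ (a - 1) * Real.exp (-(c * t))) (Ioi 0) := by
  have := integrableOn_rpow_mul_exp_neg_mul_rpow (p := 1) (s := a - 1) (b := c) (by linarith)
    one_pos hc
  simpa using this

open ProbabilityTheory in
lemma gammaC (a : ℝ) (ha : 0 < a) (l : ℂ) (hl : |l.im| < Real.pi / 2) :
    ∫ t in Ioi (0 : ℝ), ((t ^ (a - 1) : ℝ) : ℂ) * Complex.exp (-(Complex.exp l * t)) =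
      Complex.exp (-(a * l)) * (Real.Gamma a : ℂ) := by
  set ν : Measure ℝ := (volume.restrict (Ioi (0 : ℝ))).withDensity
    (fun t => ENNReal.ofReal (t ^ (a - 1))) with hν
  have hmeas : Measurable (fun t : ℝ => ENNReal.ofReal (t ^ (a - 1))) := by fun_prop
  have hint : ∀ z : ℂ, complexMGF id ν z =
      ∫ t in Ioi (0 : ℝ), ((t ^ (a - 1) : ℝ) : ℂ) * Complex.exp (z * t) := by
    intro z
    rw [complexMGF, hν, integral_withDensity_eq_integral_toReal_smul hmeas (by simp)]
    refine setIntegral_congr_fun measurableSet_Ioi fun t ht => ?_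
    have : 0 ≤ t ^ (a - 1) := Real.rpow_nonneg (le_of_lt ht) _
    simp [ENNReal.toReal_ofReal this]
  have hset : Iio 0 ⊆ integrableExpSet id ν := by
    intro x hx
    have hx' : 0 < -x := by simpa using hx
    rw [integrableExpSet]
    show Integrable _ _
    rw [hν, integrable_withDensity_iff hmeas (by simp)]
    refine (intOn_rpow_exp ha hx').congr_fun (fun t ht => ?_) measurableSet_Ioi
    have : 0 ≤ t ^ (a - 1) := Real.rpow_nonneg (le_of_lt ht) _
    simp [ENNReal.toReal_ofReal this, mul_comm]
  have hset' : Iio 0 ⊆ interior (integrableExpSet id ν) := interior_maximal hset isOpen_Iio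
  have hU : {z : ℂ | |z.im| < Real.pi / 2} = Complex.im ⁻¹' (Ioo (-(Real.pi/2)) (Real.pi / 2)) := by
    ext z; simp [abs_lt]
  have key : EqOn (fun l : ℂ => complexMGF id ν (-Complex.exp l))
      (fun l => Complex.exp (-(a * l)) * (Real.Gamma a : ℂ)) {z : ℂ | |z.im| < Real.pi / 2} := by
    refine AnalyticOnNhd.eqOn_of_preconnected_of_frequently_eq (𝕜 := ℂ) (z₀ := 0) ?_ ?_ ?_ ?_ ?_
    · intro z hz
      have h1 : AnalyticAt ℂ (complexMGF id ν) (-Complex.exp z) := by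
        apply analyticAt_complexMGF
        apply hset'
        simpa using re_exp_pos hz
      exact h1.comp (f := fun l => -Complex.exp l) (by fun_prop)
    · intro z hz
      fun_prop
    · rw [hU]
      exact ((convex_Ioo _ _).linear_preimage Complex.imLm).isPreconnected
    · simp [Real.pi_pos]
    · have h_real : ∀ x : ℝ, complexMGF id ν (-Complex.exp x) =
          Complex.exp (-(a * x)) * (Real.Gamma a : ℂ) := by
        intro x
        rw [hint]
        have := Real.integral_rpow_mul_exp_neg_mul_Ioi ha (Real.exp_pos x)
        have h2 : (1 / Real.exp x) ^ a = Real.exp (-(a * x)) := by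
          rw [one_div, ← Real.exp_neg, ← Real.exp_mul]; ring_nf
        rw [h2] at this
        have h3 := congrArg (fun x : ℝ => (x : ℂ)) this
        rw [← integral_complex_ofReal] at h3
        push_cast at h3
        rw [← h3]
        refine integral_congr_ae (Filter.Eventually.of_forall fun t => ?_)
        push_cast
        ring_nf
      have hx : Filter.Tendsto (fun x : ℝ => (x : ℂ)) (nhdsWithin 0 {0}ᶜ) (nhdsWithin 0 {0}ᶜ) := by
        rw [tendsto_nhdsWithin_iff]
        refine ⟨?_, ?_⟩
        · exact (Complex.continuous_ofReal.tendsto' 0 0 (by simp)).mono_left nhdsWithin_le_nhds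
        · filter_upwards [self_mem_nhdsWithin] with x hx
          simpa using hx
      exact hx.frequently (Filter.Frequently.of_forall h_real)
  have := key hl
  simp only [hint] at this
  rw [← this]
  simp

lemma rpow_le_lin (β : ℝ) (h0 : 0 < β) (h1 : β < 1) (t c : ℝ) (ht : 0 < t) (hc : 0 < c) :
    ∃ K, ∀ u : ℝ, 0 < u → t * u ^ β ≤ c * u + K := by
  set A := (t / c) ^ (1 / (1 - β)) with hA
  have hA0 : 0 < A := by positivity
  have hAe : A ^ (1 - β) = t / c := by
    rw [hA, ← Real.rpow_mul (by positivity), one_div_mul_cancel (by linarith), Real.rpow_one]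
  refine ⟨t * A ^ β, fun u hu => ?_⟩
  rcases le_total u A with h | h
  · have : u ^ β ≤ A ^ β := Real.rpow_le_rpow hu.le h h0.le
    nlinarith [mul_le_mul_of_nonneg_left this ht.le, mul_pos hc hu]
  · have h2 : t / c ≤ u ^ (1 - β) := hAe ▸ Real.rpow_le_rpow hA0.le h (by linarith)
    have h3 : u ^ (1 - β) * u ^ β = u := by
      rw [← Real.rpow_add hu]; simp
    have h4 : 0 < u ^ β := by positivity
    have h5 : t ≤ c * u ^ (1 - β) := by rwa [div_le_iff₀' hc] at h2
    have : 0 < t * A ^ β := by positivity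
    nlinarith [mul_le_mul_of_nonneg_right h5 h4.le]

lemma refl_gamma (x : ℝ) (hx : 0 < x) :
    Real.Gamma x * Real.sin (Real.pi * x) / Real.pi = 1 / Real.Gamma (1 - x) := by
  have h := Real.Gamma_mul_Gamma_one_sub x
  have hg := Real.Gamma_pos_of_pos hx
  by_cases hs : Real.sin (Real.pi * x) = 0
  · rw [hs, div_zero] at h
    have : Real.Gamma (1 - x) = 0 := by
      rcases mul_eq_zero.mp h with h | h
      · exact absurd h hg.ne'
      · exact h
    simp [this, hs]
  · have hne : Real.Gamma (1 - x) ≠ 0 := by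
      intro h0
      rw [h0, mul_zero] at h
      exact (div_ne_zero Real.pi_pos.ne' hs) h.symm
    rw [eq_div_iff hs] at h
    rw [div_eq_div_iff Real.pi_pos.ne' hne]
    linarith

lemma norm_e (x u : ℝ) :
    ‖Complex.exp (-(Complex.exp (x * Complex.I) * u))‖ = Real.exp (-(Real.cos x * u)) := by
  rw [Complex.norm_exp]
  simp [Complex.exp_ofReal_mul_I_re]

lemma norm_e' (x u : ℝ) :
    ‖Complex.exp (-(Complex.exp (-(x * Complex.I)) * u))‖ = Real.exp (-(Real.cos x * u)) := by
  have := norm_e (-x) u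
  simpa using this

/-- integrand of the rotated representation -/
noncomputable def kerK (β θ t u : ℝ) : ℂ :=
  ((u ^ (β - 1) : ℝ) : ℂ) * Complex.exp (-(Complex.exp (-(θ * Complex.I)) * u)) *
    (Complex.exp (θ * Complex.I) *
      Complex.exp (-(Complex.exp (θ * Complex.I) * ((t * u ^ β : ℝ) : ℂ))))

lemma mwright_hasSum (β θ : ℝ) (h0 : 0 < β) (h1 : β < 1) (hθ : θ * (1 + β) = Real.pi * β)
    (t : ℝ) (ht : 0 < t) :
    MWright β t = (∫ u in Ioi (0 : ℝ), kerK β θ t u).im / Real.pi := by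
  have hpi := Real.pi_pos
  have hθ0 : 0 < θ := by
    by_contra! h
    nlinarith [mul_pos hpi h0]
  have hθ1 : θ < Real.pi / 2 := by
    by_contra! h
    nlinarith [mul_pos hpi h0]
  have hc : 0 < Real.cos θ := Real.cos_pos_of_mem_Ioo ⟨by linarith, hθ1⟩
  set c := Real.cos θ with hcdef
  set F : ℕ → ℝ → ℂ := fun n u => (((-t) ^ n / n.factorial : ℝ) : ℂ) *
    Complex.exp (θ * (n + 1) * Complex.I) *
    (((u ^ (β * (n + 1) - 1) : ℝ) : ℂ) * Complex.exp (-(Complex.exp (-(θ * Complex.I)) * u))) with hF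
  have hFint : ∀ n, ∫ u in Ioi (0 : ℝ), F n u = (((-t) ^ n / n.factorial : ℝ) : ℂ) *
      (Complex.exp ((Real.pi * (β * (n + 1)) : ℝ) * Complex.I) * (Real.Gamma (β * (n + 1)) : ℂ)) := by
    intro n
    simp only [hF]
    rw [integral_const_mul, gammaC (β * (n + 1)) (by positivity) (-(θ * Complex.I))
      (by simp [abs_of_pos hθ0, hθ1])]
    rw [mul_assoc, ← mul_assoc (Complex.exp _), ← Complex.exp_add]
    congr 4
    have h2 : (θ : ℂ) * (1 + β) = Real.pi * β := by exact_mod_cast hθ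
    push_cast
    linear_combination (n + 1) * Complex.I * h2
  have hsum : HasSum (fun n => ∫ u in Ioi (0 : ℝ), F n u) (∫ u in Ioi (0 : ℝ), kerK β θ t u) := by
    refine hasSum_integral_of_dominated_convergence
      (fun n u => (t * u ^ β) ^ n / n.factorial * (u ^ (β - 1) * Real.exp (-(c * u)))) ?_ ?_ ?_ ?_ ?_
    · intro n
      apply Measurable.aestronglyMeasurable
      simp only [hF]
      fun_prop
    · intro n
      filter_upwards [ae_restrict_mem measurableSet_Ioi] with u hu
      have hu' : 0 < u := hu
      simp only [hF]
      rw [norm_mul, norm_mul, norm_mul, norm_e', Complex.norm_real, Complex.norm_real]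
      have e1 : ‖Complex.exp (θ * (n + 1) * Complex.I)‖ = 1 := by
        have := Complex.norm_exp_ofReal_mul_I (θ * (n + 1))
        push_cast at this
        exact this
      have e2 : u ^ (β * (n + 1) - 1) = (u ^ β) ^ n * u ^ (β - 1) := by
        rw [← Real.rpow_natCast, ← Real.rpow_mul hu'.le, ← Real.rpow_add hu']
        ring_nf
      rw [e1, e2, Real.norm_of_nonneg (by positivity : 0 ≤ (u ^ β) ^ n * u ^ (β - 1)), norm_div,
        norm_pow, norm_neg, Real.norm_of_nonneg ht.le, Real.norm_of_nonneg (by positivity), mul_pow]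
      apply le_of_eq
      ring
    · filter_upwards with u
      exact (Real.summable_pow_div_factorial _).mul_right _
    · have e : ∀ u : ℝ, ∑' n : ℕ, (t * u ^ β) ^ n / n.factorial *
          (u ^ (β - 1) * Real.exp (-(c * u))) =
          Real.exp (t * u ^ β) * (u ^ (β - 1) * Real.exp (-(c * u))) := by
        intro u
        rw [tsum_mul_right, Real.exp_eq_exp_ℝ, NormedSpace.exp_eq_tsum_div]
      simp only [e]
      obtain ⟨K, hK⟩ := rpow_le_lin β h0 h1 t (c / 2) ht (by positivity)
      refine Integrable.mono' ((intOn_rpow_exp h0 (half_pos hc)).const_mul (Real.exp K)) ?_ ?_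
      · apply Measurable.aestronglyMeasurable
        fun_prop
      · filter_upwards [ae_restrict_mem measurableSet_Ioi] with u hu
        have hu' : 0 < u := hu
        rw [Real.norm_of_nonneg (by positivity)]
        have h3 : Real.exp (t * u ^ β) * Real.exp (-(c * u)) ≤
            Real.exp K * Real.exp (-(c / 2 * u)) := by
          rw [← Real.exp_add, ← Real.exp_add]
          apply Real.exp_le_exp.mpr
          have := hK u hu'
          linarith
        have h4 : 0 ≤ u ^ (β - 1) := by positivity
        nlinarith [mul_le_mul_of_nonneg_left h3 h4]
    · filter_upwards [ae_restrict_mem measurableSet_Ioi] with u hu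
      have hu' : 0 < u := hu
      have h5 : HasSum (fun n : ℕ => (-(Complex.exp (θ * Complex.I) * ((t * u ^ β : ℝ) : ℂ))) ^ n
          / (n.factorial : ℂ))
          (Complex.exp (-(Complex.exp (θ * Complex.I) * ((t * u ^ β : ℝ) : ℂ)))) := by
        have := NormedSpace.expSeries_div_hasSum_exp
          (-(Complex.exp (θ * Complex.I) * ((t * u ^ β : ℝ) : ℂ)))
        rwa [← Complex.exp_eq_exp_ℂ] at this
      have h6 := (h5.mul_left (Complex.exp (θ * Complex.I))).mul_left (((u ^ (β - 1) : ℝ) : ℂ) *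
        Complex.exp (-(Complex.exp (-(θ * Complex.I)) * u)))
      unfold kerK
      suffices h7 : (fun n => F n u) = fun i : ℕ => ((u ^ (β - 1) : ℝ) : ℂ) *
          Complex.exp (-(Complex.exp (-(θ * Complex.I)) * u)) * (Complex.exp (θ * Complex.I) *
          ((-(Complex.exp (θ * Complex.I) * ((t * u ^ β : ℝ) : ℂ))) ^ i / (i.factorial : ℂ))) by
        rw [h7]
        exact h6
      funext n
      simp only [hF]
      have e2 : u ^ (β * (n + 1) - 1) = (u ^ β) ^ n * u ^ (β - 1) := by
        rw [← Real.rpow_natCast, ← Real.rpow_mul hu'.le, ← Real.rpow_add hu']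
        ring_nf
      have e3 : Complex.exp (θ * (n + 1) * Complex.I) =
          Complex.exp (θ * Complex.I) ^ n * Complex.exp (θ * Complex.I) := by
        rw [← Complex.exp_nat_mul, ← Complex.exp_add]
        ring_nf
      have e4 : -(Complex.exp (θ * Complex.I) * ((t * u ^ β : ℝ) : ℂ)) =
          (-t : ℂ) * ((u ^ β : ℝ) : ℂ) * Complex.exp (θ * Complex.I) := by
        push_cast
        ring
      rw [e2, e3, e4, mul_pow, mul_pow]
      push_cast
      ring
  have h7 := (Complex.hasSum_im hsum).div_const Real.pi
  rw [← h7.tsum_eq]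
  unfold MWright
  refine tsum_congr fun n => ?_
  rw [hFint, Complex.im_ofReal_mul, mul_comm (Complex.exp _), Complex.im_ofReal_mul,
    Complex.exp_ofReal_mul_I_im]
  have h8 := refl_gamma (β * (n + 1)) (by positivity)
  rw [show -β * n + 1 - β = 1 - β * (n + 1) by ring]
  rw [mul_div_assoc, h8]
  field_simp

lemma mwright_mellin (β : ℝ) (h0 : 0 < β) (h1 : β < 1) (s : ℝ) (hs0 : 0 < s) (hs1 : s < 1) :
    IntegrableOn (fun t : ℝ => t ^ (s - 1) * MWright β t) (Ioi 0) ∧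
    ∫ t in Ioi (0 : ℝ), t ^ (s - 1) * MWright β t =
      Real.Gamma s / Real.Gamma (1 - β * (1 - s)) := by
  have hpi := Real.pi_pos
  obtain ⟨θ, hθ⟩ : ∃ θ : ℝ, θ * (1 + β) = Real.pi * β :=
    ⟨Real.pi * β / (1 + β), div_mul_cancel₀ _ (by positivity)⟩
  have hθ0 : 0 < θ := by
    by_contra! h
    nlinarith [mul_pos hpi h0]
  have hθ1 : θ < Real.pi / 2 := by
    by_contra! h
    nlinarith [mul_pos hpi h0]
  have hc : 0 < Real.cos θ := Real.cos_pos_of_mem_Ioo ⟨by linarith, hθ1⟩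
  have ha : 0 < β * (1 - s) := mul_pos h0 (by linarith)
  set G : ℝ × ℝ → ℂ := fun p => ((p.1 ^ (s - 1) : ℝ) : ℂ) * kerK β θ p.1 p.2 with hG
  have hGm : Measurable G := by
    simp only [hG, kerK]
    fun_prop
  -- powers of u
  have epow : ∀ u : ℝ, 0 < u → u ^ (β - 1) * (u ^ β) ^ (-s) = u ^ (β * (1 - s) - 1) := by
    intro u hu
    rw [← Real.rpow_mul hu.le, ← Real.rpow_add hu]
    ring_nf
  have hnorm : ∀ u : ℝ, 0 < u → ∀ t : ℝ, 0 < t → ‖G (t, u)‖ =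
      (u ^ (β - 1) * Real.exp (-(Real.cos θ * u))) *
        (t ^ (s - 1) * Real.exp (-((Real.cos θ * u ^ β) * t))) := by
    intro u hu t ht
    simp only [hG, kerK]
    rw [norm_mul, norm_mul, norm_mul, norm_mul, norm_e, norm_e', Complex.norm_exp_ofReal_mul_I,
      Complex.norm_real, Complex.norm_real, Real.norm_of_nonneg (by positivity),
      Real.norm_of_nonneg (by positivity)]
    ring_nf
  have hint : Integrable G ((volume.restrict (Ioi (0 : ℝ))).prod (volume.restrict (Ioi (0 : ℝ)))) := by
    rw [integrable_prod_iff' hGm.aestronglyMeasurable]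
    constructor
    · filter_upwards [ae_restrict_mem measurableSet_Ioi] with u hu
      have hu' : 0 < u := hu
      rw [← integrable_norm_iff (by
        exact (hGm.comp (measurable_id.prodMk measurable_const)).aestronglyMeasurable)]
      refine IntegrableOn.congr_fun ((intOn_rpow_exp hs0 (c := Real.cos θ * u ^ β) (by positivity)).const_mul
        (u ^ (β - 1) * Real.exp (-(Real.cos θ * u)))) ?_ measurableSet_Ioi
      intro t ht
      exact (hnorm u hu t ht).symm
    · refine IntegrableOn.congr_fun ((intOn_rpow_exp ha hc).const_mul
        ((Real.cos θ) ^ (-s) * Real.Gamma s)) ?_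
        measurableSet_Ioi
      intro u hu
      have hu' : 0 < u := hu
      have : ∫ t in Ioi (0 : ℝ), ‖G (t, u)‖ = ∫ t in Ioi (0 : ℝ),
          (u ^ (β - 1) * Real.exp (-(Real.cos θ * u))) *
          (t ^ (s - 1) * Real.exp (-((Real.cos θ * u ^ β) * t))) :=
        setIntegral_congr_fun measurableSet_Ioi fun t ht => hnorm u hu t ht
      simp only
      rw [this, integral_const_mul, Real.integral_rpow_mul_exp_neg_mul_Ioi hs0 (by positivity),
        one_div, Real.inv_rpow (by positivity), ← Real.rpow_neg (by positivity),
        Real.mul_rpow (by positivity) (by positivity), ← epow u hu]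
      ring
  have hinner : ∀ u : ℝ, 0 < u → ∫ t in Ioi (0 : ℝ), G (t, u) =
      (Real.Gamma s : ℂ) * Complex.exp (θ * (1 - s) * Complex.I) *
      (((u ^ (β * (1 - s) - 1) : ℝ) : ℂ) *
        Complex.exp (-(Complex.exp (-(θ * Complex.I)) * u))) := by
    intro u hu
    have hl : Complex.exp ((Real.log (u ^ β) : ℝ) + θ * Complex.I) =
        ((u ^ β : ℝ) : ℂ) * Complex.exp (θ * Complex.I) := by
      rw [Complex.exp_add, ← Complex.ofReal_exp, Real.exp_log (by positivity)]
    have := gammaC s hs0 ((Real.log (u ^ β) : ℝ) + θ * Complex.I)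
      (by simp [abs_of_pos hθ0, hθ1])
    rw [hl] at this
    have h2 : ∀ t : ℝ, G (t, u) = (((u ^ (β - 1) : ℝ) : ℂ) *
        Complex.exp (-(Complex.exp (-(θ * Complex.I)) * u)) * Complex.exp (θ * Complex.I)) *
        (((t ^ (s - 1) : ℝ) : ℂ) *
          Complex.exp (-(((u ^ β : ℝ) : ℂ) * Complex.exp (θ * Complex.I) * t))) := by
      intro t
      simp only [hG, kerK]
      push_cast
      ring_nf
    simp only [h2]
    rw [integral_const_mul, this, ← epow u hu]
    have h3 : Complex.exp (-((s : ℂ) * ((Real.log (u ^ β) : ℝ) + θ * Complex.I))) =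
        (((u ^ β) ^ (-s) : ℝ) : ℂ) * Complex.exp (-(s * θ * Complex.I)) := by
      rw [Real.rpow_def_of_pos (by positivity : 0 < u ^ β), Complex.ofReal_exp, ← Complex.exp_add]
      push_cast
      ring_nf
    have h4 : Complex.exp (θ * (1 - s) * Complex.I) =
        Complex.exp (θ * Complex.I) * Complex.exp (-(s * θ * Complex.I)) := by
      rw [← Complex.exp_add]
      ring_nf
    rw [h3, h4]
    push_cast
    ring
  have hG2 : ∀ t : ℝ, 0 < t → (∫ u in Ioi (0 : ℝ), G (t, u)).im / Real.pi =
      t ^ (s - 1) * MWright β t := by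
    intro t ht
    simp only [hG]
    rw [integral_const_mul, Complex.im_ofReal_mul, mwright_hasSum β θ h0 h1 hθ t ht, mul_div_assoc]
  have hleft : Integrable (fun t => ∫ u in Ioi (0 : ℝ), G (t, u)) (volume.restrict (Ioi (0 : ℝ))) :=
    hint.integral_prod_left
  constructor
  · refine (hleft.im.div_const Real.pi).congr ?_
    filter_upwards [ae_restrict_mem measurableSet_Ioi] with t ht
    exact hG2 t ht
  · have e1 : ∫ t in Ioi (0 : ℝ), t ^ (s - 1) * MWright β t =
        (∫ t in Ioi (0 : ℝ), ∫ u in Ioi (0 : ℝ), G (t, u)).im / Real.pi := by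
      have := integral_im hleft
      have h9 : ∀ z : ℂ, RCLike.im z = z.im := fun _ => rfl
      simp only [h9] at this
      rw [← this, ← integral_div]
      exact setIntegral_congr_fun measurableSet_Ioi fun t ht => (hG2 t ht).symm
    rw [e1, integral_integral_swap hint, setIntegral_congr_fun measurableSet_Ioi hinner,
      integral_const_mul, gammaC _ ha _ (by simp [abs_of_pos hθ0, hθ1])]
    have h5 : Complex.exp (θ * (1 - s) * Complex.I) *
        Complex.exp (-(((β * (1 - s) : ℝ) : ℂ) * (-(θ * Complex.I)))) =
        Complex.exp ((Real.pi * (β * (1 - s)) : ℝ) * Complex.I) := by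
      rw [← Complex.exp_add]
      congr 1
      have h2 : (θ : ℂ) * (1 + β) = Real.pi * β := by exact_mod_cast hθ
      push_cast
      linear_combination (1 - s) * Complex.I * h2
    rw [mul_assoc, ← mul_assoc (Complex.exp _), h5, Complex.im_ofReal_mul, mul_comm (Complex.exp _),
      Complex.im_ofReal_mul, Complex.exp_ofReal_mul_I_im, mul_div_assoc, refl_gamma _ ha,
      mul_one_div]

lemma mwright_pos_part (β : ℝ) (h0 : 0 < β) (h1 : β < 1)
    (hM : ∫⁻ t in Ioi (0 : ℝ), ENNReal.ofReal (MWright β t) = 1) :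
    AEMeasurable (MWright β) (volume.restrict (Ioi (0 : ℝ))) ∧
    ∀ s : ℝ, 0 < s → s < 1 → ∫ t in Ioi (0 : ℝ), t ^ (s - 1) * max (MWright β t) 0 =
      Real.Gamma s / Real.Gamma (1 - β * (1 - s)) := by
  have hmeas : AEMeasurable (MWright β) (volume.restrict (Ioi (0 : ℝ))) := by
    have h2 := (mwright_mellin β h0 h1 (1 / 2) (by norm_num) (by norm_num)).1.aemeasurable
    have h3 : AEMeasurable (fun t : ℝ => t ^ (-((1 : ℝ) / 2 - 1)) *
        (t ^ ((1 : ℝ) / 2 - 1) * MWright β t)) (volume.restrict (Ioi (0 : ℝ))) :=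
      AEMeasurable.mul (by fun_prop) h2
    refine h3.congr ?_
    filter_upwards [ae_restrict_mem measurableSet_Ioi] with t ht
    have ht' : 0 < t := ht
    rw [← mul_assoc, ← Real.rpow_add ht']
    simp
  refine ⟨hmeas, ?_⟩
  have hPm : AEMeasurable (fun t => max (MWright β t) 0) (volume.restrict (Ioi (0 : ℝ))) :=
    hmeas.max aemeasurable_const
  have hPl : ∫⁻ t in Ioi (0 : ℝ), ENNReal.ofReal (max (MWright β t) 0) = 1 := by
    rw [← hM]
    refine lintegral_congr fun t => ?_
    simp
  have hPint : IntegrableOn (fun t => max (MWright β t) 0) (Ioi (0 : ℝ)) := by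
    refine (lintegral_ofReal_ne_top_iff_integrable hPm.aestronglyMeasurable
      (Filter.Eventually.of_forall fun t => le_max_right _ _)).mp ?_
    rw [hPl]
    simp
  have hP1 : ∫ t in Ioi (0 : ℝ), max (MWright β t) 0 = 1 := by
    rw [integral_eq_lintegral_of_nonneg_ae (f := fun t => max (MWright β t) 0)
      (Filter.Eventually.of_forall fun t => le_max_right _ _) hPm.aestronglyMeasurable, hPl]
    simp
  have hPs : ∀ s : ℝ, 0 < s → s < 1 →
      IntegrableOn (fun t => t ^ (s - 1) * max (MWright β t) 0) (Ioi (0 : ℝ)) := by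
    intro s hs0 hs1
    refine IntegrableOn.congr_fun (mwright_mellin β h0 h1 s hs0 hs1).1.pos_part ?_ measurableSet_Ioi
    intro t ht
    have ht' : 0 < t := ht
    simp only
    rw [mul_max_of_nonneg _ _ (by positivity), mul_zero]
  have hNs : ∀ s : ℝ, 0 < s → s < 1 →
      IntegrableOn (fun t => t ^ (s - 1) * max (-MWright β t) 0) (Ioi (0 : ℝ)) := by
    intro s hs0 hs1
    refine IntegrableOn.congr_fun (mwright_mellin β h0 h1 s hs0 hs1).1.neg_part ?_ measurableSet_Ioi
    intro t ht
    have ht' : 0 < t := ht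
    simp only
    rw [mul_max_of_nonneg _ _ (by positivity), mul_zero, mul_neg]
  have hAB : ∀ s : ℝ, 0 < s → s < 1 → ∫ t in Ioi (0 : ℝ), t ^ (s - 1) * max (-MWright β t) 0 =
      (∫ t in Ioi (0 : ℝ), t ^ (s - 1) * max (MWright β t) 0) -
        Real.Gamma s / Real.Gamma (1 - β * (1 - s)) := by
    intro s hs0 hs1
    rw [← (mwright_mellin β h0 h1 s hs0 hs1).2, ← integral_sub (hPs s hs0 hs1)
      (mwright_mellin β h0 h1 s hs0 hs1).1]
    refine integral_congr_ae (Filter.Eventually.of_forall fun t => ?_)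
    simp only
    rw [← mul_sub]
    congr 1
    rcases le_total (MWright β t) 0 with h | h
    · rw [max_eq_left (by linarith), max_eq_right h]; ring
    · rw [max_eq_right (by linarith), max_eq_left h]; ring
  have hmem : ∀ᶠ s : ℝ in nhdsWithin 1 (Iio 1), s ∈ Ioo (1 / 2 : ℝ) 1 :=
    Ioo_mem_nhdsLT (by norm_num)
  have hA : Filter.Tendsto (fun s : ℝ => ∫ t in Ioi (0 : ℝ), t ^ (s - 1) * max (MWright β t) 0)
      (nhdsWithin 1 (Iio 1)) (nhds 1) := by
    have :  Filter.Tendsto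
      (fun s : ℝ => ∫ t in Ioi (0 : ℝ), t ^ (s - 1) * max (MWright β t) 0)
      (nhdsWithin 1 (Iio 1)) (nhds (∫ t in Ioi (0 : ℝ), max (MWright β t) 0)) := by
      refine tendsto_integral_filter_of_dominated_convergence
        (fun t => t ^ ((1 : ℝ) / 2 - 1) * max (MWright β t) 0 + max (MWright β t) 0) ?_ ?_ ?_ ?_
      · filter_upwards [hmem] with s hs
        exact (hPs s (by linarith [hs.1]) hs.2).aestronglyMeasurable
      · filter_upwards [hmem] with s hs
        filter_upwards [ae_restrict_mem measurableSet_Ioi] with t ht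
        have ht' : 0 < t := ht
        have hm : 0 ≤ max (MWright β t) 0 := le_max_right _ _
        rw [Real.norm_of_nonneg (by positivity)]
        have : t ^ (s - 1) ≤ t ^ ((1 : ℝ) / 2 - 1) + 1 := by
          rcases le_total t 1 with h | h
          · have := Real.rpow_le_rpow_of_exponent_ge ht' h (by linarith [hs.1] : (1 : ℝ) / 2 - 1 ≤ s - 1)
            linarith
          · have := Real.rpow_le_one_of_one_le_of_nonpos h (by linarith [hs.2] : s - 1 ≤ 0)
            have : 0 ≤ t ^ ((1 : ℝ) / 2 - 1) := by positivity
            linarith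
        nlinarith [mul_le_mul_of_nonneg_right this hm]
      · exact (hPs (1 / 2) (by norm_num) (by norm_num)).add hPint
      · filter_upwards [ae_restrict_mem measurableSet_Ioi] with t ht
        have ht' : 0 < t := ht
        have hc : Continuous fun s : ℝ => t ^ (s - 1) * max (MWright β t) 0 := by
          have : Continuous fun s : ℝ => t ^ (s - 1) :=
            (Real.continuous_const_rpow ht'.ne').comp (by fun_prop)
          exact this.mul continuous_const
        have := hc.tendsto 1
        simp only [sub_self, Real.rpow_zero, one_mul] at this
        exact this.mono_left nhdsWithin_le_nhds
    rwa [hP1] at this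
  have hJ : Filter.Tendsto (fun s : ℝ => Real.Gamma s / Real.Gamma (1 - β * (1 - s)))
      (nhdsWithin 1 (Iio 1)) (nhds 1) := by
    have hg : ContinuousAt Real.Gamma 1 :=
      (Real.differentiableAt_Gamma fun m => by
        have : (0 : ℝ) ≤ m := m.cast_nonneg
        linarith).continuousAt
    have h2 : ContinuousAt (fun s : ℝ => Real.Gamma s / Real.Gamma (1 - β * (1 - s))) 1 := by
      refine hg.div (ContinuousAt.comp (g := Real.Gamma) (by simpa using hg) (by fun_prop)) ?_
      simp
    have h3 := h2.tendsto
    simp at h3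
    exact h3.mono_left nhdsWithin_le_nhds
  have hle : ∫ t in Ioi (0 : ℝ), min 1 t⁻¹ * max (-MWright β t) 0 ≤ 0 := by
    have hlim := hA.sub hJ
    rw [sub_self] at hlim
    refine ge_of_tendsto hlim ?_
    filter_upwards [hmem] with s hs
    have hs0 : 0 < s := by linarith [hs.1]
    rw [← hAB s hs0 hs.2]
    refine integral_mono_of_nonneg ?_ (hNs s hs0 hs.2) ?_
    · filter_upwards [ae_restrict_mem measurableSet_Ioi] with t ht
      have ht' : 0 < t := ht
      exact mul_nonneg (by positivity) (le_max_right _ _)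
    · filter_upwards [ae_restrict_mem measurableSet_Ioi] with t ht
      have ht' : 0 < t := ht
      refine mul_le_mul_of_nonneg_right ?_ (le_max_right _ _)
      rcases le_total t 1 with h | h
      · exact (min_le_left _ _).trans
          (Real.one_le_rpow_of_pos_of_le_one_of_nonpos ht' h (by linarith [hs.2]))
      · refine (min_le_right _ _).trans ?_
        rw [← Real.rpow_neg_one]
        exact Real.rpow_le_rpow_of_exponent_le h (by linarith)
  have hnn : 0 ≤ᵐ[volume.restrict (Ioi (0 : ℝ))] fun t => min 1 t⁻¹ * max (-MWright β t) 0 := by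
    filter_upwards [ae_restrict_mem measurableSet_Ioi] with t ht
    have ht' : 0 < t := ht
    exact mul_nonneg (by positivity) (le_max_right _ _)
  have hmint : IntegrableOn (fun t => min 1 t⁻¹ * max (-MWright β t) 0) (Ioi (0 : ℝ)) := by
    refine Integrable.mono' (hNs (1 / 2) (by norm_num) (by norm_num)) ?_ ?_
    · exact (AEMeasurable.mul (by fun_prop) (hmeas.neg.max aemeasurable_const)).aestronglyMeasurable
    · filter_upwards [ae_restrict_mem measurableSet_Ioi] with t ht
      have ht' : 0 < t := ht
      rw [Real.norm_of_nonneg (mul_nonneg (by positivity) (le_max_right _ _))]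
      refine mul_le_mul_of_nonneg_right ?_ (le_max_right _ _)
      rcases le_total t 1 with h | h
      · exact (min_le_left _ _).trans
          (Real.one_le_rpow_of_pos_of_le_one_of_nonpos ht' h (by norm_num))
      · refine (min_le_right _ _).trans ?_
        rw [← Real.rpow_neg_one]
        exact Real.rpow_le_rpow_of_exponent_le h (by norm_num)
  have hzero := (integral_eq_zero_iff_of_nonneg_ae hnn hmint).mp
    (le_antisymm hle (integral_nonneg_of_ae hnn))
  intro s hs0 hs1
  rw [← (mwright_mellin β h0 h1 s hs0 hs1).2]
  refine integral_congr_ae ?_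
  filter_upwards [hzero, ae_restrict_mem measurableSet_Ioi] with t hz ht
  have ht' : 0 < t := ht
  have hp : 0 < min 1 t⁻¹ := by positivity
  have : max (-MWright β t) 0 = 0 := by
    rcases mul_eq_zero.mp hz with h | h
    · exact absurd h hp.ne'
    · exact h
  have h2 : 0 ≤ MWright β t := by
    have := le_max_left (-MWright β t) 0
    linarith
  rw [max_eq_left h2]

open ProbabilityTheory in
lemma map_eq_of_mgf_eq {Ω Ω' : Type*} [MeasurableSpace Ω] [MeasurableSpace Ω'] (μ : Measure Ω)
    (ν : Measure Ω') [IsFiniteMeasure μ] [IsFiniteMeasure ν] (X : Ω → ℝ) (Z : Ω' → ℝ)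
    (hX : AEMeasurable X μ) (hZ : AEMeasurable Z ν)
    (hXi : Ioi (-1) ⊆ integrableExpSet X μ) (hZi : Ioi (-1) ⊆ integrableExpSet Z ν)
    (h : ∀ w ∈ Ioo (-1 : ℝ) 0, mgf X μ w = mgf Z ν w) : μ.map X = ν.map Z := by
  have hXi' := interior_maximal hXi isOpen_Ioi
  have hZi' := interior_maximal hZi isOpen_Ioi
  have key : EqOn (complexMGF X μ) (complexMGF Z ν) {z : ℂ | z.re ∈ Ioi (-1 : ℝ)} := by
    refine AnalyticOnNhd.eqOn_of_preconnected_of_frequently_eq (𝕜 := ℂ)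
      (z₀ := ((-(1 / 2) : ℝ) : ℂ)) ?_ ?_ ?_ ?_ ?_
    · exact fun z hz => analyticAt_complexMGF (hXi' hz)
    · exact fun z hz => analyticAt_complexMGF (hZi' hz)
    · exact ((convex_Ioi (-1 : ℝ)).linear_preimage Complex.reLm).isPreconnected
    · show (-1 : ℝ) < ((-(1 / 2) : ℝ) : ℂ).re
      rw [Complex.ofReal_re]
      norm_num
    · have hx : Filter.Tendsto (fun x : ℝ => (x : ℂ)) (nhdsWithin (-(1 / 2)) {-(1 / 2)}ᶜ)
          (nhdsWithin ((-(1 / 2) : ℝ) : ℂ) {((-(1 / 2) : ℝ) : ℂ)}ᶜ) := by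
        rw [tendsto_nhdsWithin_iff]
        refine ⟨?_, ?_⟩
        · exact (Complex.continuous_ofReal.tendsto _).mono_left nhdsWithin_le_nhds
        · filter_upwards [self_mem_nhdsWithin] with x hx
          simp only [mem_compl_iff, mem_singleton_iff, Complex.ofReal_inj]
          exact hx
      have hev : ∀ᶠ x : ℝ in nhdsWithin (-(1 / 2)) {-(1 / 2)}ᶜ,
          complexMGF X μ x = complexMGF Z ν x := by
        have : Ioo (-1 : ℝ) 0 ∈ nhds (-(1 / 2) : ℝ) := Ioo_mem_nhds (by norm_num) (by norm_num)
        filter_upwards [mem_nhdsWithin_of_mem_nhds this] with x hx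
        rw [complexMGF_ofReal, complexMGF_ofReal, h x hx]
      exact hx.frequently hev.frequently
  refine Measure.ext_of_charFun (funext fun t => ?_)
  rw [← complexMGF_mul_I hX, ← complexMGF_mul_I hZ]
  apply key
  simp


lemma log_exp_rpow {x : ℝ} (hx : 0 < x) (w : ℝ) : Real.exp (w * Real.log x) = x ^ w := by
  rw [Real.rpow_def_of_pos hx, mul_comm]

theorem exponential_characterization
    {Ω : Type*} [MeasurableSpace Ω] (μ : Measure Ω) [IsProbabilityMeasure μ]
    (β : ℝ) (hβ0 : 0 < β) (hβ1 : β < 1)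
    (Y Yβ : Ω → ℝ) (hY : Measurable Y) (hYβ : Measurable Yβ)
    (hpos : ∀ ω, 0 < Y ω)
    (hindep : ProbabilityTheory.IndepFun Y Yβ μ)
    (ρ : ℝ → ℝ) (hρcont : ContinuousOn ρ (Ioi 0))
    (hlawY : μ.map Y =
      (volume.restrict (Ioi (0 : ℝ))).withDensity (fun x => ENNReal.ofReal (ρ x)))
    (hMellin : ∀ z : ℂ, 0 < z.re →
      IntegrableOn (fun x : ℝ => (x : ℂ) ^ (z - 1) * (ρ x : ℂ)) (Ioi 0))
    (hlawβ : μ.map Yβ =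
      (volume.restrict (Ioi (0 : ℝ))).withDensity (fun t => ENNReal.ofReal (MWright β t)))
    (hdecomp : μ.map Y = μ.map (fun ω => Y ω ^ β * Yβ ω)) :
    μ.map Y =
      (volume.restrict (Ioi (0 : ℝ))).withDensity
        (fun x => ENNReal.ofReal (Real.exp (-x))) := by
  have hprobβ : IsProbabilityMeasure (μ.map Yβ) := Measure.isProbabilityMeasure_map hYβ.aemeasurable
  -- total mass of the M-Wright law
  have hM : ∫⁻ t in Ioi (0 : ℝ), ENNReal.ofReal (MWright β t) = 1 := by
    have h1 : (μ.map Yβ) univ = 1 := measure_univ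
    rw [hlawβ, withDensity_apply _ MeasurableSet.univ, Measure.restrict_univ] at h1
    exact h1
  obtain ⟨hMm, hMs⟩ := mwright_pos_part β hβ0 hβ1 hM
  -- moments of Yβ
  have hβmom : ∀ w ∈ Ioo (-1 : ℝ) 0, ∫ ω, Real.exp (w * Real.log (Yβ ω)) ∂μ =
      Real.Gamma (1 + w) / Real.Gamma (1 + β * w) := by
    intro w hw
    have h1 := hMs (1 + w) (by linarith [hw.1]) (by linarith [hw.2])
    rw [show 1 - β * (1 - (1 + w)) = 1 + β * w by ring] at h1
    rw [← h1]
    have h2 : ∫ y, Real.exp (w * Real.log y) ∂(μ.map Yβ) =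
        ∫ ω, Real.exp (w * Real.log (Yβ ω)) ∂μ :=
      integral_map hYβ.aemeasurable (Measurable.aestronglyMeasurable (by fun_prop))
    rw [← h2, hlawβ, integral_withDensity_eq_integral_toReal_smul₀ hMm.ennreal_ofReal (by simp)]
    refine setIntegral_congr_fun measurableSet_Ioi fun t ht => ?_
    have ht' : 0 < t := ht
    rw [log_exp_rpow ht', ENNReal.toReal_ofReal', smul_eq_mul]
    ring_nf
  have hβpos : ∀ᵐ ω ∂μ, 0 < Yβ ω := by
    have h1 : ∀ᵐ y ∂(μ.map Yβ), 0 < y := by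
      rw [hlawβ]
      exact (withDensity_absolutelyContinuous _ _).ae_le (ae_restrict_mem measurableSet_Ioi)
    exact ae_of_ae_map hYβ.aemeasurable h1
  set X : Ω → ℝ := fun ω => Real.log (Y ω) with hX
  have hXm : Measurable X := by fun_prop
  have hρm : AEMeasurable ρ (volume.restrict (Ioi (0 : ℝ))) := hρcont.aemeasurable measurableSet_Ioi
  have hXi : Ioi (-1) ⊆ ProbabilityTheory.integrableExpSet X μ := by
    intro w hw
    have hw' : -1 < w := hw
    show Integrable (fun ω => Real.exp (w * X ω)) μ
    have h1 : Integrable (fun y => Real.exp (w * Real.log y)) (μ.map Y) := by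
      rw [hlawY, integrable_withDensity_iff_integrable_smul₀' hρm.ennreal_ofReal (by simp)]
      have h2 := hMellin ((w : ℂ) + 1) (by simp; linarith)
      refine Integrable.mono h2 ?_ ?_
      · exact (AEMeasurable.smul hρm.ennreal_ofReal.ennreal_toReal
          (by fun_prop)).aestronglyMeasurable
      · filter_upwards [ae_restrict_mem measurableSet_Ioi] with t ht
        have ht' : 0 < t := ht
        rw [log_exp_rpow ht', ENNReal.toReal_ofReal', smul_eq_mul, norm_mul, norm_mul,
          add_sub_cancel_right, ← Complex.ofReal_cpow ht'.le, Complex.norm_real, Complex.norm_real,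
          mul_comm]
        refine mul_le_mul_of_nonneg_left ?_ (norm_nonneg _)
        rw [Real.norm_of_nonneg (le_max_right _ _)]
        exact max_le (le_abs_self _) (abs_nonneg _)
    exact h1.comp_measurable hY
  have hXi' := interior_maximal hXi isOpen_Ioi
  have hGpos : ∀ w : ℝ, -1 < w → 0 < Real.Gamma (1 + w) := fun w hw =>
    Real.Gamma_pos_of_pos (by linarith)
  -- functional equation
  have hfe : ∀ w ∈ Ioo (-1 : ℝ) 0, ProbabilityTheory.mgf X μ w / Real.Gamma (1 + w) =
      ProbabilityTheory.mgf X μ (β * w) / Real.Gamma (1 + β * w) := by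
    intro w hw
    have hm : Measurable fun y : ℝ => Real.exp (w * Real.log y) := by fun_prop
    have hm2 : Measurable fun y : ℝ => Real.exp (β * w * Real.log y) := by fun_prop
    have h1 : ProbabilityTheory.mgf X μ w = ProbabilityTheory.mgf X μ (β * w) *
        (Real.Gamma (1 + w) / Real.Gamma (1 + β * w)) := by
      rw [← hβmom w hw]
      have e1 : ProbabilityTheory.mgf X μ w = ∫ y, Real.exp (w * Real.log y) ∂(μ.map Y) :=
        (integral_map hY.aemeasurable hm.aestronglyMeasurable).symm
      rw [e1, hdecomp, integral_map (by fun_prop) hm.aestronglyMeasurable]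
      have hi := hindep.comp hm2 hm
      have e2 := hi.integral_fun_mul_eq_mul_integral (hm2.comp hY).aestronglyMeasurable
        (hm.comp hYβ).aestronglyMeasurable
      refine Eq.trans ?_ e2
      refine integral_congr_ae ?_
      filter_upwards [hβpos] with ω hω
      have := hpos ω
      simp only [Function.comp_apply]
      rw [Real.log_mul (by positivity) hω.ne', Real.log_rpow this, ← Real.exp_add]
      ring_nf
    rw [h1]
    have := (hGpos w hw.1).ne'
    field_simp
  -- iterate
  have hmgf : ∀ w ∈ Ioo (-1 : ℝ) 0, ProbabilityTheory.mgf X μ w = Real.Gamma (1 + w) := by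
    intro w hw
    have hit : ∀ n : ℕ, ProbabilityTheory.mgf X μ w / Real.Gamma (1 + w) =
        ProbabilityTheory.mgf X μ (β ^ n * w) / Real.Gamma (1 + β ^ n * w) := by
      intro n
      induction n with
      | zero => simp
      | succ n ih =>
        have hb0 : 0 < β ^ n := by positivity
        have hb1 : β ^ n ≤ 1 := pow_le_one₀ hβ0.le hβ1.le
        rw [ih, hfe (β ^ n * w) ⟨by nlinarith [hw.1, hw.2], by nlinarith [hw.2]⟩, pow_succ]
        ring_nf
    have ht : Filter.Tendsto (fun n : ℕ => β ^ n * w) Filter.atTop (nhds 0) := by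
      simpa using (tendsto_pow_atTop_nhds_zero_of_lt_one hβ0.le hβ1).mul_const w
    have hc : ContinuousAt (fun v : ℝ => ProbabilityTheory.mgf X μ v / Real.Gamma (1 + v)) 0 := by
      refine ContinuousAt.div ?_ ?_ ?_
      · exact (ProbabilityTheory.analyticAt_mgf (hXi' (by simp))).continuousAt
      · have hg : ContinuousAt Real.Gamma 1 :=
          (Real.differentiableAt_Gamma fun m => by
            have : (0 : ℝ) ≤ m := m.cast_nonneg
            linarith).continuousAt
        exact ContinuousAt.comp (g := Real.Gamma) (by simpa using hg) (by fun_prop)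
      · simp
    have h2 := hc.tendsto.comp ht
    have h3 : (fun n : ℕ => ProbabilityTheory.mgf X μ w / Real.Gamma (1 + w)) =
        (fun v : ℝ => ProbabilityTheory.mgf X μ v / Real.Gamma (1 + v)) ∘
          fun n : ℕ => β ^ n * w := funext hit
    rw [← h3] at h2
    have h4 := tendsto_nhds_unique tendsto_const_nhds h2
    simp only [ProbabilityTheory.mgf_zero, add_zero, Real.Gamma_one, div_one] at h4
    rwa [div_eq_one_iff_eq (hGpos w hw.1).ne'] at h4
  -- the exponential law
  set ν : Measure ℝ := (volume.restrict (Ioi (0 : ℝ))).withDensity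
    (fun x => ENNReal.ofReal (Real.exp (-x))) with hν
  have hem : Measurable fun x : ℝ => ENNReal.ofReal (Real.exp (-x)) := by fun_prop
  have hexp : ∀ w : ℝ, -1 < w → EqOn (fun x : ℝ => x ^ (1 + w - 1) * Real.exp (-(1 * x)))
      (fun x => (ENNReal.ofReal (Real.exp (-x))).toReal • Real.exp (w * Real.log x)) (Ioi 0) := by
    intro w hw x hx
    simp only
    rw [log_exp_rpow hx, ENNReal.toReal_ofReal (Real.exp_pos _).le, smul_eq_mul, mul_comm]
    ring_nf
  have hZi : Ioi (-1) ⊆ ProbabilityTheory.integrableExpSet Real.log ν := by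
    intro w hw
    have hw' : -1 < w := hw
    show Integrable (fun x => Real.exp (w * Real.log x)) ν
    rw [hν, integrable_withDensity_iff_integrable_smul₀' hem.aemeasurable (by simp)]
    exact (intOn_rpow_exp (a := 1 + w) (by linarith) one_pos).congr_fun (hexp w hw')
      measurableSet_Ioi
  have hZ : ∀ w ∈ Ioo (-1 : ℝ) 0, ProbabilityTheory.mgf Real.log ν w = Real.Gamma (1 + w) := by
    intro w hw
    rw [ProbabilityTheory.mgf, hν,
      integral_withDensity_eq_integral_toReal_smul₀ hem.aemeasurable (by simp),
      ← setIntegral_congr_fun measurableSet_Ioi (hexp w hw.1),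
      Real.integral_rpow_mul_exp_neg_mul_Ioi (by linarith [hw.1]) one_pos]
    simp
  have hfin : IsFiniteMeasure ν := by
    have h0 : Integrable (fun x : ℝ => Real.exp (0 * Real.log x)) ν :=
      hZi (by simp : (0 : ℝ) ∈ Ioi (-1 : ℝ))
    simp only [zero_mul, Real.exp_zero] at h0
    rw [integrable_const_iff] at h0
    simpa using h0
  have hmap := map_eq_of_mgf_eq μ ν X Real.log hXm.aemeasurable (by fun_prop) hXi hZi
    (fun w hw => (hmgf w hw).trans (hZ w hw).symm)
  have h5 := congrArg (Measure.map Real.exp) hmap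
  rw [Measure.map_map (by fun_prop) hXm, Measure.map_map (by fun_prop) (by fun_prop)] at h5
  have e1 : Real.exp ∘ X = Y := funext fun ω => Real.exp_log (hpos ω)
  have e2 : ν.map (Real.exp ∘ Real.log) = ν := by
    have : Real.exp ∘ Real.log =ᵐ[ν] id := by
      have h6 : ∀ᵐ x ∂ν, 0 < x :=
        (withDensity_absolutelyContinuous _ _).ae_le (ae_restrict_mem measurableSet_Ioi)
      filter_upwards [h6] with x hx
      exact Real.exp_log hx
    rw [Measure.map_congr this, Measure.map_id]
  rwa [e1, e2] at h5
end
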